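/- Fix a sign σ ∈ {1, −1} and k ∈ ℕ. Let u be a Schwartz-regular solution of i ∂ₜu − Δu + |x|² u + σ u |u|² = 0. Then for all t, (1/2) d/dt ‖A ∂ₜᵏ u(t)‖²_{L²} = −σ ( Σ_{i=1}^{2} Re ∫_{ℝ²} ∂ₜᵏ ∂_{x_i}( u |u|² )(t,x) · ∂ₜ^{k+1} ∂_{x_i} conj(u)(t,x) dx + Re ∫_{ℝ²} |x|² ∂ₜᵏ( u |u|² )(t,x) · ∂ₜ^{k+1} conj(u)(t,x) dx ). -/

import Mathlib

open MeasureTheory Complex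

noncomputable section

abbrev E2 : Type := EuclideanSpace ℝ (Fin 2)

/-- Partial derivative in the `i`-th coordinate direction. -/
noncomputable def pd (i : Fin 2) (f : E2 → ℂ) : E2 → ℂ :=
  fun x => fderiv ℝ f x (EuclideanSpace.single i 1)

/-- The Laplacian on `ℝ²`. -/
noncomputable def lap (f : E2 → ℂ) : E2 → ℂ :=
  fun x => ∑ i : Fin 2, pd i (pd i f) x

/-- The harmonic oscillator `A f = -Δ f + |x|² f`. -/
noncomputable def Aop (f : E2 → ℂ) : E2 → ℂ :=
  fun x => -lap f x + (‖x‖ : ℂ)^2 * f x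

/-- Time derivative of a time-dependent function. -/
noncomputable def tderiv (F : ℝ → E2 → ℂ) : ℝ → E2 → ℂ :=
  fun t x => deriv (fun s => F s x) t

/-- Squared euclidean norm of the gradient, `|∇f|²(x)`. -/
noncomputable def gradSq (f : E2 → ℂ) (x : E2) : ℝ := ∑ i : Fin 2, ‖pd i f x‖^2

/-- The `L²` norm. -/
noncomputable def L2norm (f : E2 → ℂ) : ℝ := Real.sqrt (∫ x : E2, ‖f x‖^2)

/-- The `ℋ¹` norm: `(‖∇φ‖² + ‖|x|φ‖²)^(1/2)`. -/
noncomputable def H1norm (f : E2 → ℂ) : ℝ :=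
  Real.sqrt ((∫ x : E2, gradSq f x) + ∫ x : E2, ‖x‖^2 * ‖f x‖^2)

/-- A Schwartz-regular solution of the cubic NLS with harmonic potential,
`i ∂ₜ u - Δu + |x|² u + σ u |u|² = 0`. -/
def IsSolution (σ : ℝ) (u : ℝ → SchwartzMap E2 ℂ) : Prop :=
  ContDiff ℝ (⊤ : ℕ∞) (fun p : ℝ × E2 => u p.1 p.2) ∧
  ∀ (t : ℝ) (x : E2), Complex.I * deriv (fun s => u s x) t - lap (fun y => u t y) x
    + (‖x‖ : ℂ)^2 * u t x + (σ : ℂ) * u t x * (‖u t x‖ : ℂ)^2 = 0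

/-- A Schwartz-regular solution of the linear Schrödinger equation with harmonic
potential, `i ∂ₜ w - Δw + |x|² w = 0`. -/
def IsLinSolution (w : ℝ → SchwartzMap E2 ℂ) : Prop :=
  ContDiff ℝ (⊤ : ℕ∞) (fun p : ℝ × E2 => w p.1 p.2) ∧
  ∀ (t : ℝ) (x : E2), Complex.I * deriv (fun s => w s x) t - lap (fun y => w t y) x
    + (‖x‖ : ℂ)^2 * w t x = 0

/-- Partial derivative for real-valued functions. -/
noncomputable def pdR (i : Fin 2) (f : E2 → ℝ) : E2 → ℝ :=
  fun x => fderiv ℝ f x (EuclideanSpace.single i 1)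

/-- The Laplacian for real-valued functions. -/
noncomputable def lapR (f : E2 → ℝ) : E2 → ℝ :=
  fun x => ∑ i : Fin 2, pdR i (pdR i f) x

/-! ### Schwartz functions as a predicate -/

/-- `f` is (the underlying function of) a Schwartz function. -/
def IsS (f : E2 → ℂ) : Prop := ∃ g : SchwartzMap E2 ℂ, ⇑g = f

lemma IsS.of (g : SchwartzMap E2 ℂ) : IsS (fun x => g x) := ⟨g, rfl⟩

lemma IsS.add {f g : E2 → ℂ} (hf : IsS f) (hg : IsS g) : IsS (fun x => f x + g x) := by
  obtain ⟨F, rfl⟩ := hf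
  obtain ⟨G, rfl⟩ := hg
  exact ⟨F + G, by ext x; simp⟩

lemma IsS.const_mul {f : E2 → ℂ} (c : ℂ) (hf : IsS f) : IsS (fun x => c * f x) := by
  obtain ⟨F, rfl⟩ := hf
  exact ⟨c • F, by ext x; simp⟩

lemma IsS.neg {f : E2 → ℂ} (hf : IsS f) : IsS (fun x => -f x) := by
  simpa using hf.const_mul (-1)

lemma IsS.sub {f g : E2 → ℂ} (hf : IsS f) (hg : IsS g) : IsS (fun x => f x - g x) := by
  simpa [sub_eq_add_neg] using hf.add hg.neg

lemma IsS.conj {f : E2 → ℂ} (hf : IsS f) : IsS (fun x => (starRingEnd ℂ) (f x)) := by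
  obtain ⟨F, rfl⟩ := hf
  exact ⟨F.postcompCLM (Complex.conjCLE : ℂ →L[ℝ] ℂ), by ext x; simp⟩

lemma IsS.mul {f g : E2 → ℂ} (hf : IsS f) (hg : IsS g) : IsS (fun x => f x * g x) := by
  obtain ⟨F, rfl⟩ := hf
  obtain ⟨G, rfl⟩ := hg
  exact ⟨SchwartzMap.pairing (ContinuousLinearMap.mul ℂ ℂ) F G, by
    ext x; simp [SchwartzMap.pairing_apply_apply]⟩

lemma IsS.temperate_mul {f : E2 → ℂ} {g : E2 → ℂ} (hg : Function.HasTemperateGrowth g)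
    (hf : IsS f) : IsS (fun x => g x * f x) := by
  obtain ⟨F, rfl⟩ := hf
  exact ⟨SchwartzMap.smulLeftCLM ℂ g F, by ext x; simp [SchwartzMap.smulLeftCLM_apply_apply hg]⟩

lemma coord_temperate (i : Fin 2) :
    Function.HasTemperateGrowth (fun x : E2 => ((x i : ℝ) : ℂ)) :=
  ((Complex.ofRealCLM).comp (EuclideanSpace.proj (𝕜 := ℝ) i)).hasTemperateGrowth

lemma IsS.coord_mul {f : E2 → ℂ} (i : Fin 2) (hf : IsS f) :
    IsS (fun x => ((x i : ℝ) : ℂ) * f x) := hf.temperate_mul (coord_temperate i)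

lemma normSq_eq_coord (x : E2) :
    (‖x‖ : ℂ) ^ 2 = ((x 0 : ℝ) : ℂ) * ((x 0 : ℝ) : ℂ) + ((x 1 : ℝ) : ℂ) * ((x 1 : ℝ) : ℂ) := by
  have := EuclideanSpace.norm_sq_eq x
  rw [Fin.sum_univ_two] at this
  rw [← Complex.ofReal_pow, this]
  simp [sq]

lemma IsS.normSq_mul {f : E2 → ℂ} (hf : IsS f) :
    IsS (fun x => (‖x‖ : ℂ) ^ 2 * f x) := by
  have := ((hf.coord_mul 0).coord_mul 0).add ((hf.coord_mul 1).coord_mul 1)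
  convert this using 2 with x
  rw [normSq_eq_coord]; ring

lemma IsS.pd {f : E2 → ℂ} (i : Fin 2) (hf : IsS f) : IsS (pd i f) := by
  obtain ⟨F, rfl⟩ := hf
  exact ⟨LineDeriv.lineDerivOp (EuclideanSpace.single i (1 : ℝ) : E2) F, by
    ext x; simp [SchwartzMap.lineDerivOp_apply_eq_fderiv, _root_.pd]⟩

lemma IsS.lap {f : E2 → ℂ} (hf : IsS f) : IsS (lap f) := by
  have := ((hf.pd 0).pd 0).add ((hf.pd 1).pd 1)
  convert this using 2 with x
  simp [_root_.lap]

lemma IsS.Aop {f : E2 → ℂ} (hf : IsS f) : IsS (Aop f) :=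
  hf.lap.neg.add hf.normSq_mul

lemma IsS.contDiff {f : E2 → ℂ} (hf : IsS f) : ContDiff ℝ (⊤ : ℕ∞) f := by
  obtain ⟨F, rfl⟩ := hf
  exact F.smooth _

lemma IsS.differentiable {f : E2 → ℂ} (hf : IsS f) : Differentiable ℝ f :=
  hf.contDiff.differentiable (by simp)

lemma IsS.continuous {f : E2 → ℂ} (hf : IsS f) : Continuous f := hf.contDiff.continuous

lemma IsS.memLp {f : E2 → ℂ} (hf : IsS f) (p : ENNReal) : MemLp f p := by
  obtain ⟨F, rfl⟩ := hf
  exact F.memLp p _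

lemma IsS.integrable {f : E2 → ℂ} (hf : IsS f) : Integrable f := by
  obtain ⟨F, rfl⟩ := hf
  exact F.integrable

/-- Integration by parts in the `i`-th coordinate direction. -/
lemma integral_mul_pd {f g : E2 → ℂ} (i : Fin 2) (hf : Differentiable ℝ f)
    (hg : Differentiable ℝ g) (h1 : Integrable (fun x => pd i f x * g x))
    (h2 : Integrable (fun x => f x * pd i g x)) (h3 : Integrable (fun x => f x * g x)) :
    ∫ x, f x * pd i g x = -∫ x, pd i f x * g x :=
  integral_mul_fderiv_eq_neg_fderiv_mul_of_integrable h1 h2 h3 (fun x _ => hf x) (fun x _ => hg x)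

lemma IsS.integral_mul_pd {f g : E2 → ℂ} (i : Fin 2) (hf : IsS f) (hg : IsS g) :
    ∫ x, f x * _root_.pd i g x = -∫ x, _root_.pd i f x * g x :=
  _root_.integral_mul_pd i hf.differentiable hg.differentiable ((hf.pd i).mul hg).integrable
    (hf.mul (hg.pd i)).integrable (hf.mul hg).integrable

/-! ### Calculus rules for `pd` -/

lemma pd_add {f g : E2 → ℂ} (i : Fin 2) (hf : Differentiable ℝ f) (hg : Differentiable ℝ g)
    (x : E2) : pd i (fun y => f y + g y) x = pd i f x + pd i g x := by
  simp only [pd]; rw [fderiv_fun_add (hf x) (hg x)]; rfl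

lemma pd_const_mul {f : E2 → ℂ} (i : Fin 2) (c : ℂ) (hf : Differentiable ℝ f) (x : E2) :
    pd i (fun y => c * f y) x = c * pd i f x := by
  simp only [pd]; rw [fderiv_const_mul (hf x)]; rfl

lemma pd_mul {f g : E2 → ℂ} (i : Fin 2) (hf : Differentiable ℝ f) (hg : Differentiable ℝ g)
    (x : E2) : pd i (fun y => f y * g y) x = pd i f x * g x + f x * pd i g x := by
  simp only [pd]; rw [fderiv_fun_mul (hf x) (hg x)]; simp; ring

lemma pd_conj {f : E2 → ℂ} (i : Fin 2) (hf : Differentiable ℝ f) (x : E2) :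
    pd i (fun y => (starRingEnd ℂ) (f y)) x = (starRingEnd ℂ) (pd i f x) := by
  have h : HasFDerivAt (fun y => (starRingEnd ℂ) (f y))
      ((Complex.conjCLE : ℂ →L[ℝ] ℂ).comp (fderiv ℝ f x)) x :=
    (Complex.conjCLE : ℂ →L[ℝ] ℂ).hasFDerivAt.comp x (hf x).hasFDerivAt
  simp only [pd]; rw [h.fderiv]; simp

lemma pd_coord (i j : Fin 2) (x : E2) :
    pd i (fun y => ((y j : ℝ) : ℂ)) x = if i = j then 1 else 0 := by
  have h : HasFDerivAt (fun y : E2 => ((y j : ℝ) : ℂ))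
      ((Complex.ofRealCLM).comp (EuclideanSpace.proj (𝕜 := ℝ) j)) x :=
    ((Complex.ofRealCLM).comp (EuclideanSpace.proj (𝕜 := ℝ) j)).hasFDerivAt
  simp only [pd]; rw [h.fderiv]
  by_cases hij : i = j
  · simp [hij]
  · simp [hij, Ne.symm hij]

lemma differentiable_coord (j : Fin 2) : Differentiable ℝ (fun y : E2 => ((y j : ℝ) : ℂ)) :=
  ((Complex.ofRealCLM).comp (EuclideanSpace.proj (𝕜 := ℝ) j)).differentiable

/-! ### Jointly smooth families -/

/-- `F` is jointly smooth in time and space. -/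
def JS (F : ℝ → E2 → ℂ) : Prop := ContDiff ℝ (⊤ : ℕ∞) (fun p : ℝ × E2 => F p.1 p.2)

lemma JS.add {F G : ℝ → E2 → ℂ} (hF : JS F) (hG : JS G) : JS (fun t x => F t x + G t x) :=
  ContDiff.add hF hG

lemma JS.mul {F G : ℝ → E2 → ℂ} (hF : JS F) (hG : JS G) : JS (fun t x => F t x * G t x) :=
  ContDiff.mul hF hG

lemma JS.const_mul {F : ℝ → E2 → ℂ} (c : ℂ) (hF : JS F) : JS (fun t x => c * F t x) :=
  ContDiff.mul contDiff_const hF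

lemma JS.conj {F : ℝ → E2 → ℂ} (hF : JS F) : JS (fun t x => (starRingEnd ℂ) (F t x)) :=
  (Complex.conjCLE : ℂ →L[ℝ] ℂ).contDiff.comp hF

lemma JS.coord_mul {F : ℝ → E2 → ℂ} (i : Fin 2) (hF : JS F) :
    JS (fun t x => ((x i : ℝ) : ℂ) * F t x) :=
  ContDiff.mul (((Complex.ofRealCLM).comp
    ((EuclideanSpace.proj (𝕜 := ℝ) i).comp (ContinuousLinearMap.snd ℝ ℝ E2))).contDiff) hF

lemma JS.continuous {F : ℝ → E2 → ℂ} (hF : JS F) : Continuous (fun p : ℝ × E2 => F p.1 p.2) :=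
  ContDiff.continuous hF

lemma JS.slice {F : ℝ → E2 → ℂ} (hF : JS F) (t : ℝ) : ContDiff ℝ (⊤ : ℕ∞) (F t) :=
  ContDiff.comp (f := fun x : E2 => (t, x)) hF (by fun_prop)

lemma JS.slice_time {F : ℝ → E2 → ℂ} (hF : JS F) (x : E2) :
    ContDiff ℝ (⊤ : ℕ∞) (fun t => F t x) :=
  ContDiff.comp (f := fun t : ℝ => (t, x)) hF (by fun_prop)

lemma JS.hasFDerivAt {F : ℝ → E2 → ℂ} (hF : JS F) (p : ℝ × E2) :
    HasFDerivAt (fun p : ℝ × E2 => F p.1 p.2) (fderiv ℝ (fun p : ℝ × E2 => F p.1 p.2) p) p :=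
  (ContDiff.differentiable hF (by simp) p).hasFDerivAt

lemma JS.hasDerivAt_time {F : ℝ → E2 → ℂ} (hF : JS F) (t : ℝ) (x : E2) :
    HasDerivAt (fun s => F s x) (tderiv F t x) t :=
  ((hF.slice_time x).differentiable (by simp) t).hasDerivAt

lemma JS.tderiv_eq {F : ℝ → E2 → ℂ} (hF : JS F) (t : ℝ) (x : E2) :
    tderiv F t x = fderiv ℝ (fun p : ℝ × E2 => F p.1 p.2) (t, x) (1, 0) := by
  have h : HasDerivAt (fun s : ℝ => (s, x)) ((1 : ℝ), (0 : E2)) t :=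
    (hasDerivAt_id t).prodMk (hasDerivAt_const t x)
  exact ((hF.hasFDerivAt (t, x)).comp_hasDerivAt t h).deriv

lemma JS.pd_eq {F : ℝ → E2 → ℂ} (hF : JS F) (i : Fin 2) (t : ℝ) (x : E2) :
    pd i (F t) x =
      fderiv ℝ (fun p : ℝ × E2 => F p.1 p.2) (t, x) (0, EuclideanSpace.single i 1) := by
  have h : HasFDerivAt (fun y : E2 => (t, y)) (ContinuousLinearMap.inr ℝ ℝ E2) x :=
    hasFDerivAt_prodMk_right t x
  have h2 := ((hF.hasFDerivAt (t, x)).comp x h).fderiv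
  simp only [pd]
  rw [show F t = ((fun p : ℝ × E2 => F p.1 p.2) ∘ fun y : E2 => (t, y)) from rfl, h2]
  simp

lemma JS.fderiv_apply {F : ℝ → E2 → ℂ} (hF : JS F) (v : ℝ × E2) :
    ContDiff ℝ (⊤ : ℕ∞) (fun p => fderiv ℝ (fun p : ℝ × E2 => F p.1 p.2) p v) :=
  (ContDiff.fderiv_right hF (by simp)).clm_apply contDiff_const

lemma JS.tderiv {F : ℝ → E2 → ℂ} (hF : JS F) : JS (tderiv F) := by
  have := hF.fderiv_apply (1, 0)
  unfold JS
  convert this using 2 with p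
  exact hF.tderiv_eq p.1 p.2

lemma JS.pd {F : ℝ → E2 → ℂ} (hF : JS F) (i : Fin 2) : JS (fun t => pd i (F t)) := by
  have := hF.fderiv_apply (0, EuclideanSpace.single i 1)
  unfold JS
  convert this using 2 with p
  exact hF.pd_eq i p.1 p.2

lemma JS.tderiv_pd {F : ℝ → E2 → ℂ} (hF : JS F) (i : Fin 2) (t : ℝ) (x : E2) :
    _root_.tderiv (fun s => _root_.pd i (F s)) t x = _root_.pd i (_root_.tderiv F t) x := by
  rw [(hF.pd i).tderiv_eq, hF.tderiv.pd_eq]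
  have e1 : (fun p : ℝ × E2 => _root_.pd i (F p.1) p.2) = fun p =>
      fderiv ℝ (fun p : ℝ × E2 => F p.1 p.2) p (0, EuclideanSpace.single i 1) := by
    ext p; exact hF.pd_eq i p.1 p.2
  have e2 : (fun p : ℝ × E2 => _root_.tderiv F p.1 p.2) = fun p =>
      fderiv ℝ (fun p : ℝ × E2 => F p.1 p.2) p (1, 0) := by
    ext p; exact hF.tderiv_eq p.1 p.2
  have hd : DifferentiableAt ℝ (fderiv ℝ (fun p : ℝ × E2 => F p.1 p.2)) (t, x) :=
    (ContDiff.fderiv_right (m := (⊤ : ℕ∞)) hF (by simp)).differentiable (by simp) _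
  have hs : IsSymmSndFDerivAt ℝ (fun p : ℝ × E2 => F p.1 p.2) (t, x) :=
    (ContDiff.contDiffAt hF).isSymmSndFDerivAt (by
      rw [minSmoothness_of_isRCLikeNormedField]
      exact WithTop.coe_le_coe.2 (le_top : (2 : ℕ∞) ≤ ⊤))
  rw [e1, e2, fderiv_clm_apply hd (differentiableAt_const _),
    fderiv_clm_apply hd (differentiableAt_const _)]
  simpa using hs _ _

/-! ### Time derivatives of regular families -/

lemma tderiv_add {F G : ℝ → E2 → ℂ} (hF : JS F) (hG : JS G) :
    tderiv (fun t x => F t x + G t x) = fun t x => tderiv F t x + tderiv G t x := by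
  ext t x
  exact ((hF.hasDerivAt_time t x).add (hG.hasDerivAt_time t x)).deriv

lemma tderiv_mul {F G : ℝ → E2 → ℂ} (hF : JS F) (hG : JS G) :
    tderiv (fun t x => F t x * G t x) =
      fun t x => tderiv F t x * G t x + F t x * tderiv G t x := by
  ext t x
  exact ((hF.hasDerivAt_time t x).mul (hG.hasDerivAt_time t x)).deriv

lemma tderiv_const_mul {F : ℝ → E2 → ℂ} (c : ℂ) (hF : JS F) :
    tderiv (fun t x => c * F t x) = fun t x => c * tderiv F t x := by
  ext t x
  exact ((hF.hasDerivAt_time t x).const_mul c).deriv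

lemma tderiv_coord_mul {F : ℝ → E2 → ℂ} (i : Fin 2) (hF : JS F) :
    tderiv (fun t x => ((x i : ℝ) : ℂ) * F t x) = fun t x => ((x i : ℝ) : ℂ) * tderiv F t x := by
  ext t x
  exact ((hF.hasDerivAt_time t x).const_mul _).deriv

lemma tderiv_conj {F : ℝ → E2 → ℂ} (hF : JS F) :
    tderiv (fun t x => (starRingEnd ℂ) (F t x)) = fun t x => (starRingEnd ℂ) (tderiv F t x) := by
  ext t x
  exact ((Complex.conjCLE : ℂ →L[ℝ] ℂ).hasFDerivAt.comp_hasDerivAt t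
    (hF.hasDerivAt_time t x)).deriv

lemma tderiv_pd {F : ℝ → E2 → ℂ} (i : Fin 2) (hF : JS F) :
    tderiv (fun t => pd i (F t)) = fun t => pd i (tderiv F t) := by
  ext t x
  exact hF.tderiv_pd i t x

/-- Jointly smooth families of Schwartz functions. -/
structure Reg (F : ℝ → E2 → ℂ) : Prop where
  js : JS F
  sch : ∀ t, IsS (F t)

lemma Reg.add {F G : ℝ → E2 → ℂ} (hF : Reg F) (hG : Reg G) : Reg (fun t x => F t x + G t x) :=
  ⟨hF.js.add hG.js, fun t => (hF.sch t).add (hG.sch t)⟩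

lemma Reg.mul {F G : ℝ → E2 → ℂ} (hF : Reg F) (hG : Reg G) : Reg (fun t x => F t x * G t x) :=
  ⟨hF.js.mul hG.js, fun t => (hF.sch t).mul (hG.sch t)⟩

lemma Reg.conj {F : ℝ → E2 → ℂ} (hF : Reg F) : Reg (fun t x => (starRingEnd ℂ) (F t x)) :=
  ⟨hF.js.conj, fun t => (hF.sch t).conj⟩

lemma Reg.const_mul {F : ℝ → E2 → ℂ} (c : ℂ) (hF : Reg F) : Reg (fun t x => c * F t x) :=
  ⟨hF.js.const_mul c, fun t => (hF.sch t).const_mul c⟩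

lemma Reg.pd {F : ℝ → E2 → ℂ} (i : Fin 2) (hF : Reg F) : Reg (fun t => pd i (F t)) :=
  ⟨hF.js.pd i, fun t => (hF.sch t).pd i⟩

lemma Reg.coord_mul {F : ℝ → E2 → ℂ} (i : Fin 2) (hF : Reg F) :
    Reg (fun t x => ((x i : ℝ) : ℂ) * F t x) :=
  ⟨hF.js.coord_mul i, fun t => (hF.sch t).coord_mul i⟩

/-- Families generated from `u` by algebraic operations, conjugation, spatial derivatives and
multiplication by coordinates. -/
inductive Gen (u : ℝ → E2 → ℂ) : (ℝ → E2 → ℂ) → Prop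
  | base : Gen u u
  | add {F G} : Gen u F → Gen u G → Gen u (fun t x => F t x + G t x)
  | mul {F G} : Gen u F → Gen u G → Gen u (fun t x => F t x * G t x)
  | conj {F} : Gen u F → Gen u (fun t x => (starRingEnd ℂ) (F t x))
  | const_mul {F} (c : ℂ) : Gen u F → Gen u (fun t x => c * F t x)
  | pd {F} (i : Fin 2) : Gen u F → Gen u (fun t => pd i (F t))
  | coord_mul {F} (i : Fin 2) : Gen u F → Gen u (fun t x => ((x i : ℝ) : ℂ) * F t x)

lemma Gen.reg {u F : ℝ → E2 → ℂ} (hu : Reg u) (hF : Gen u F) : Reg F := by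
  induction hF with
  | base => exact hu
  | add _ _ h1 h2 => exact h1.add h2
  | mul _ _ h1 h2 => exact h1.mul h2
  | conj _ h => exact h.conj
  | const_mul c _ h => exact h.const_mul c
  | pd i _ h => exact h.pd i
  | coord_mul i _ h => exact h.coord_mul i

lemma Gen.tderiv {u F : ℝ → E2 → ℂ} (hu : Reg u) (hut : Gen u (tderiv u)) (hF : Gen u F) :
    Gen u (tderiv F) := by
  induction hF with
  | base => exact hut
  | add h1 h2 i1 i2 => rw [tderiv_add (h1.reg hu).js (h2.reg hu).js]; exact i1.add i2
  | mul h1 h2 i1 i2 =>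
    rw [tderiv_mul (h1.reg hu).js (h2.reg hu).js]; exact (i1.mul h2).add (h1.mul i2)
  | conj h i => rw [tderiv_conj (h.reg hu).js]; exact i.conj
  | const_mul c h i => rw [tderiv_const_mul c (h.reg hu).js]; exact i.const_mul c
  | pd j h i => rw [tderiv_pd j (h.reg hu).js]; exact i.pd j
  | coord_mul j h i => rw [tderiv_coord_mul j (h.reg hu).js]; exact i.coord_mul j

lemma Gen.lap {u F : ℝ → E2 → ℂ} (hF : Gen u F) : Gen u (fun t => lap (F t)) := by
  have := ((hF.pd 0).pd 0).add ((hF.pd 1).pd 1)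
  convert this using 3 with t x
  simp [_root_.lap]

lemma Gen.normSq_mul {u F : ℝ → E2 → ℂ} (hF : Gen u F) :
    Gen u (fun t x => (‖x‖ : ℂ) ^ 2 * F t x) := by
  have := ((hF.coord_mul 0).coord_mul 0).add ((hF.coord_mul 1).coord_mul 1)
  convert this using 3 with t x
  rw [normSq_eq_coord]; ring

lemma Gen.Aop {u F : ℝ → E2 → ℂ} (hF : Gen u F) : Gen u (fun t => Aop (F t)) := by
  have := (hF.lap.const_mul (-1)).add hF.normSq_mul
  convert this using 3 with t x
  simp [_root_.Aop]

lemma JS.lap {F : ℝ → E2 → ℂ} (hF : JS F) : JS (fun t => lap (F t)) := by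
  have := ((hF.pd 0).pd 0).add ((hF.pd 1).pd 1)
  convert this using 3 with t x
  simp [_root_.lap]

lemma JS.normSq_mul {F : ℝ → E2 → ℂ} (hF : JS F) : JS (fun t x => (‖x‖ : ℂ) ^ 2 * F t x) := by
  have := ((hF.coord_mul 0).coord_mul 0).add ((hF.coord_mul 1).coord_mul 1)
  convert this using 3 with t x
  rw [normSq_eq_coord]; ring

lemma JS.Aop {F : ℝ → E2 → ℂ} (hF : JS F) : JS (fun t => Aop (F t)) := by
  have := (hF.lap.const_mul (-1)).add hF.normSq_mul
  convert this using 3 with t x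
  simp [_root_.Aop]

lemma tderiv_Aop {F : ℝ → E2 → ℂ} (hF : JS F) :
    tderiv (fun t => Aop (F t)) = fun t => Aop (tderiv F t) := by
  have e : (fun t => Aop (F t)) = fun t x => -1 * (pd 0 (pd 0 (F t)) x + pd 1 (pd 1 (F t)) x) +
      (((x 0 : ℝ) : ℂ) * (((x 0 : ℝ) : ℂ) * F t x) + ((x 1 : ℝ) : ℂ) * (((x 1 : ℝ) : ℂ) * F t x)) := by
    ext t x
    simp only [Aop, lap, Fin.sum_univ_two, normSq_eq_coord]; ring
  have h0 := (hF.pd 0).pd 0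
  have h1 := (hF.pd 1).pd 1
  rw [e, tderiv_add ((h0.add h1).const_mul _)
    (((hF.coord_mul 0).coord_mul 0).add ((hF.coord_mul 1).coord_mul 1)),
    tderiv_const_mul _ (h0.add h1), tderiv_add h0 h1, tderiv_pd 0 (hF.pd 0), tderiv_pd 1 (hF.pd 1),
    tderiv_pd 0 hF, tderiv_pd 1 hF,
    tderiv_add ((hF.coord_mul 0).coord_mul 0) ((hF.coord_mul 1).coord_mul 1),
    tderiv_coord_mul 0 (hF.coord_mul 0), tderiv_coord_mul 1 (hF.coord_mul 1),
    tderiv_coord_mul 0 hF, tderiv_coord_mul 1 hF]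
  ext t x
  simp only [Aop, lap, Fin.sum_univ_two, normSq_eq_coord]; ring

/-! ### The nonlinear equation -/

/-- The cubic nonlinearity. -/
def cubic (u : ℝ → E2 → ℂ) : ℝ → E2 → ℂ := fun t x => u t x * (‖u t x‖ : ℂ) ^ 2

/-- A regular solution, in evolution form. -/
structure Sol (σ : ℝ) (u : ℝ → E2 → ℂ) : Prop where
  reg : Reg u
  eqn : ∀ t x, tderiv u t x = I * (Aop (u t) x + σ * cubic u t x)

lemma IsSolution.sol {σ : ℝ} {u : ℝ → SchwartzMap E2 ℂ} (hu : IsSolution σ u) :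
    Sol σ (fun t x => u t x) := by
  refine ⟨⟨hu.1, fun t => IsS.of (u t)⟩, fun t x => ?_⟩
  have h := hu.2 t x
  have h2 : I * tderiv (fun t x => u t x) t x = -(Aop (fun y => u t y) x
      + σ * cubic (fun t x => u t x) t x) := by
    simp only [tderiv, Aop, cubic]
    linear_combination h
  have h3 : tderiv (fun t x => u t x) t x = -I * (I * tderiv (fun t x => u t x) t x) := by
    rw [← mul_assoc]; simp
  rw [h3, h2]; ring

lemma cubic_eq (u : ℝ → E2 → ℂ) :
    cubic u = fun t x => u t x * (u t x * (starRingEnd ℂ) (u t x)) := by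
  ext t x
  simp only [cubic, Complex.mul_conj, Complex.normSq_eq_norm_sq]; push_cast; ring

lemma gen_cubic (u : ℝ → E2 → ℂ) : Gen u (cubic u) := by
  rw [cubic_eq]; exact Gen.base.mul (Gen.base.mul Gen.base.conj)

namespace Sol
variable {σ : ℝ} {u : ℝ → E2 → ℂ}

lemma gen_tderiv_self (hu : Sol σ u) : Gen u (tderiv u) := by
  have := ((Gen.base (u := u)).Aop.add ((gen_cubic u).const_mul σ)).const_mul I
  convert this using 3 with t x
  exact hu.eqn t x

lemma gen_tderiv (hu : Sol σ u) {F : ℝ → E2 → ℂ} (hF : Gen u F) : Gen u (tderiv F) :=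
  Gen.tderiv hu.reg hu.gen_tderiv_self hF

lemma gen_iter (hu : Sol σ u) {F : ℝ → E2 → ℂ} (hF : Gen u F) (k : ℕ) :
    Gen u (tderiv^[k] F) := by
  induction k with
  | zero => exact hF
  | succ k ih => rw [Function.iterate_succ_apply']; exact hu.gen_tderiv ih

lemma reg_iter (hu : Sol σ u) {F : ℝ → E2 → ℂ} (hF : Gen u F) (k : ℕ) :
    Reg (tderiv^[k] F) := (hu.gen_iter hF k).reg hu.reg

lemma reg_self (hu : Sol σ u) (k : ℕ) : Reg (tderiv^[k] u) := hu.reg_iter Gen.base k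

lemma reg_cubic (hu : Sol σ u) (k : ℕ) : Reg (tderiv^[k] (cubic u)) :=
  hu.reg_iter (gen_cubic u) k

lemma eqn_iter (hu : Sol σ u) (k : ℕ) (t : ℝ) (x : E2) :
    tderiv^[k + 1] u t x =
      I * (Aop (tderiv^[k] u t) x + σ * tderiv^[k] (cubic u) t x) := by
  induction k generalizing t x with
  | zero => exact hu.eqn t x
  | succ k ih =>
    have h1 := hu.reg_self k
    have h2 := hu.reg_cubic k
    have e : tderiv^[k + 1] u = fun t x => I * (Aop (tderiv^[k] u t) x +
        σ * tderiv^[k] (cubic u) t x) := by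
      ext t x; exact ih t x
    have e' : tderiv (tderiv^[k + 1] u) t x = I * (Aop (tderiv^[k + 1] u t) x +
        σ * tderiv^[k + 1] (cubic u) t x) := by
      conv_lhs => rw [e]
      rw [tderiv_const_mul _ (h1.js.Aop.add (h2.js.const_mul _)),
      tderiv_add h1.js.Aop (h2.js.const_mul _), tderiv_const_mul _ h2.js, tderiv_Aop h1.js,
      ← Function.iterate_succ_apply' tderiv k (cubic u), ← Function.iterate_succ_apply' tderiv k u]
    rw [Function.iterate_succ_apply', e']

lemma iter_pd (hu : Sol σ u) {F : ℝ → E2 → ℂ} (hF : Gen u F) (i : Fin 2) (k : ℕ) :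
    tderiv^[k] (fun s => pd i (F s)) = fun t => pd i (tderiv^[k] F t) := by
  induction k with
  | zero => rfl
  | succ k ih =>
    rw [Function.iterate_succ_apply', ih, tderiv_pd i (hu.reg_iter hF k).js,
      Function.iterate_succ_apply']

lemma iter_conj (hu : Sol σ u) {F : ℝ → E2 → ℂ} (hF : Gen u F) (k : ℕ) :
    tderiv^[k] (fun s x => (starRingEnd ℂ) (F s x)) =
      fun t x => (starRingEnd ℂ) (tderiv^[k] F t x) := by
  induction k with
  | zero => rfl
  | succ k ih =>
    rw [Function.iterate_succ_apply', ih, tderiv_conj (hu.reg_iter hF k).js,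
      Function.iterate_succ_apply']

end Sol

/-! ### Trilinear expansion of derivatives of the nonlinearity -/

/-- Sums of products `∂ᵃu ∂ᵇu ∂ᶜū` with `a + b + c = n`. -/
inductive Tri (u : ℝ → E2 → ℂ) : ℕ → (ℝ → E2 → ℂ) → Prop
  | term (a b c : ℕ) : Tri u (a + b + c) (fun t x => tderiv^[a] u t x *
      (tderiv^[b] u t x * (starRingEnd ℂ) (tderiv^[c] u t x)))
  | add {n F G} : Tri u n F → Tri u n G → Tri u n (fun t x => F t x + G t x)

namespace Sol
variable {σ : ℝ} {u : ℝ → E2 → ℂ}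

lemma tri_reg (hu : Sol σ u) {n : ℕ} {F : ℝ → E2 → ℂ} (hF : Tri u n F) : Reg F := by
  induction hF with
  | term a b c => exact (hu.reg_self a).mul ((hu.reg_self b).mul (hu.reg_self c).conj)
  | add _ _ h1 h2 => exact h1.add h2

lemma tri_tderiv (hu : Sol σ u) {n : ℕ} {F : ℝ → E2 → ℂ} (hF : Tri u n F) :
    Tri u (n + 1) (tderiv F) := by
  induction hF with
  | term a b c =>
    have ha := hu.reg_self a
    have hb := hu.reg_self b
    have hc := hu.reg_self c
    rw [tderiv_mul ha.js (hb.mul hc.conj).js, tderiv_mul hb.js hc.conj.js, tderiv_conj hc.js]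
    simp only [← Function.iterate_succ_apply' tderiv]
    have h1 := Tri.term (u := u) (a + 1) b c
    have h2 := Tri.term (u := u) a (b + 1) c
    have h3 := Tri.term (u := u) a b (c + 1)
    rw [show a + 1 + b + c = a + b + c + 1 by ring] at h1
    rw [show a + (b + 1) + c = a + b + c + 1 by ring] at h2
    convert h1.add (h2.add h3) using 3 with t x
    ring
  | add h1 h2 i1 i2 =>
    rw [tderiv_add (hu.tri_reg h1).js (hu.tri_reg h2).js]; exact i1.add i2

lemma tri_cubic (hu : Sol σ u) (k : ℕ) : Tri u k (tderiv^[k] (cubic u)) := by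
  induction k with
  | zero =>
    rw [cubic_eq]; exact Tri.term 0 0 0
  | succ k ih => rw [Function.iterate_succ_apply']; exact hu.tri_tderiv ih

end Sol

/-! ### `L²` toolkit -/

lemma L2norm_nonneg (f : E2 → ℂ) : 0 ≤ L2norm f := Real.sqrt_nonneg _

lemma L2norm_sq (f : E2 → ℂ) : L2norm f ^ 2 = ∫ x, ‖f x‖ ^ 2 :=
  Real.sq_sqrt (integral_nonneg fun _ => by positivity)

lemma MemLp.integrable_sq_norm {f : E2 → ℂ} (hf : MemLp f 2) :
    Integrable (fun x => ‖f x‖ ^ 2) :=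
  (memLp_two_iff_integrable_sq_norm hf.1).1 hf

lemma lintegral_sq_eq {f : E2 → ℂ} (hf : MemLp f 2) :
    ∫⁻ x, ‖f x‖ₑ ^ 2 = ENNReal.ofReal (L2norm f ^ 2) := by
  rw [L2norm_sq, ofReal_integral_eq_lintegral_ofReal (MemLp.integrable_sq_norm hf)
    (Filter.Eventually.of_forall fun _ => by positivity)]
  congr 1 with x
  rw [ENNReal.ofReal_pow (norm_nonneg _), ofReal_norm]

lemma memLp_of_lintegral_sq_le {f : E2 → ℂ} (hf : AEStronglyMeasurable f) {M : ℝ} (hM : 0 ≤ M)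
    (h : ∫⁻ x, ‖f x‖ₑ ^ 2 ≤ ENNReal.ofReal (M ^ 2)) : MemLp f 2 ∧ L2norm f ≤ M := by
  have h1 : MemLp f 2 := by
    rw [memLp_two_iff_integrable_sq_norm hf]
    refine ⟨(hf.norm.pow 2), ?_⟩
    rw [hasFiniteIntegral_iff_enorm]
    refine lt_of_le_of_lt ?_ (h.trans_lt ENNReal.ofReal_lt_top)
    refine lintegral_mono fun x => ?_
    rw [Real.enorm_eq_ofReal (by positivity), ENNReal.ofReal_pow (norm_nonneg _), ofReal_norm]
  refine ⟨h1, ?_⟩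
  rw [lintegral_sq_eq h1, ENNReal.ofReal_le_ofReal_iff (by positivity)] at h
  exact (pow_le_pow_iff_left₀ (L2norm_nonneg f) hM two_ne_zero).1 h

lemma L2norm_eq_toReal {f : E2 → ℂ} (hf : MemLp f 2) : L2norm f = (eLpNorm f 2).toReal := by
  rw [MemLp.eLpNorm_eq_integral_rpow_norm (by simp) (by simp) hf,
    ENNReal.toReal_ofReal (by positivity), L2norm, Real.sqrt_eq_rpow]
  simp

lemma L2norm_add_le {f g : E2 → ℂ} (hf : MemLp f 2) (hg : MemLp g 2) :
    L2norm (fun x => f x + g x) ≤ L2norm f + L2norm g := by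
  have h := eLpNorm_add_le hf.1 hg.1 (p := 2) (by simp)
  have h2 : MemLp (fun x => f x + g x) 2 := hf.add hg
  rw [L2norm_eq_toReal hf, L2norm_eq_toReal hg, L2norm_eq_toReal h2,
    ← ENNReal.toReal_add hf.2.ne hg.2.ne]
  exact ENNReal.toReal_mono (ENNReal.add_ne_top.2 ⟨hf.2.ne, hg.2.ne⟩) h

lemma L2norm_const_mul (c : ℂ) (f : E2 → ℂ) : L2norm (fun x => c * f x) = ‖c‖ * L2norm f := by
  simp only [L2norm, norm_mul, mul_pow]
  rw [integral_const_mul, Real.sqrt_mul (by positivity), Real.sqrt_sq (norm_nonneg _)]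

lemma L2norm_neg (f : E2 → ℂ) : L2norm (fun x => -f x) = L2norm f := by
  simp [L2norm]

lemma L2norm_conj (f : E2 → ℂ) : L2norm (fun x => (starRingEnd ℂ) (f x)) = L2norm f := by
  simp [L2norm]

lemma L2norm_sub_le {f g : E2 → ℂ} (hf : MemLp f 2) (hg : MemLp g 2) :
    L2norm (fun x => f x - g x) ≤ L2norm f + L2norm g := by
  have := L2norm_add_le hf hg.neg
  rw [show -g = fun x => -g x from rfl, L2norm_neg g] at this
  simpa only [sub_eq_add_neg] using this

lemma L2norm_mono {f g : E2 → ℂ} (hg : MemLp g 2) (h : ∀ x, ‖f x‖ ≤ ‖g x‖) :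
    L2norm f ≤ L2norm g := by
  refine Real.sqrt_le_sqrt ?_
  exact integral_mono_of_nonneg (Filter.Eventually.of_forall fun _ => by positivity)
    (MemLp.integrable_sq_norm hg)
    (Filter.Eventually.of_forall fun x => pow_le_pow_left₀ (norm_nonneg _) (h x) 2)

lemma L2norm_mul_le {f g : E2 → ℂ} {C : ℝ} (hg : MemLp g 2)
    (hC : ∀ x, ‖f x‖ ≤ C) : L2norm (fun x => f x * g x) ≤ C * L2norm g := by
  have hC0 : 0 ≤ C := (norm_nonneg _).trans (hC 0)
  have h := L2norm_mono (f := fun x => f x * g x) (g := fun x => (C : ℂ) * g x)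
    (hg.const_mul _) fun x => by
      rw [norm_mul, norm_mul, Complex.norm_real, Real.norm_of_nonneg hC0]
      exact mul_le_mul_of_nonneg_right (hC x) (norm_nonneg _)
  rwa [L2norm_const_mul, Complex.norm_real, Real.norm_of_nonneg hC0] at h

lemma integrable_mul_conj {f g : E2 → ℂ} (hf : MemLp f 2) (hg : MemLp g 2) :
    Integrable (fun x => f x * (starRingEnd ℂ) (g x)) :=
  MemLp.integrable_mul (p := 2) (q := 2) hf (hg.star)

lemma integrable_norm_mul {f g : E2 → ℂ} (hf : MemLp f 2) (hg : MemLp g 2) :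
    Integrable (fun x => ‖f x‖ * ‖g x‖) :=
  MemLp.integrable_mul (p := 2) (q := 2) hf.norm hg.norm

/-- Cauchy–Schwarz. -/
lemma integral_norm_mul_le {f g : E2 → ℂ} (hf : MemLp f 2) (hg : MemLp g 2) :
    ∫ x, ‖f x‖ * ‖g x‖ ≤ L2norm f * L2norm g := by
  have h := integral_mul_norm_le_Lp_mul_Lq (μ := volume) (f := f) (g := g)
    Real.HolderConjugate.two_two (by simpa using hf) (by simpa using hg)
  simpa [L2norm, Real.sqrt_eq_rpow] using h

lemma norm_integral_mul_conj_le {f g : E2 → ℂ} (hf : MemLp f 2) (hg : MemLp g 2) :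
    ‖∫ x, f x * (starRingEnd ℂ) (g x)‖ ≤ L2norm f * L2norm g := by
  refine (norm_integral_le_integral_norm _).trans ?_
  simpa using integral_norm_mul_le hf hg

lemma integral_self_mul_conj (f : E2 → ℂ) :
    ∫ x, f x * (starRingEnd ℂ) (f x) = ((L2norm f ^ 2 : ℝ) : ℂ) := by
  rw [L2norm_sq, ← integral_complex_ofReal]
  congr 1 with x
  rw [Complex.mul_conj, Complex.normSq_eq_norm_sq]

/-- Fatou's lemma for `L²` bounds. -/
lemma memLp_of_tendsto_of_le {f : ℕ → E2 → ℂ} {g : E2 → ℂ} {b : ℕ → ℝ} {M : ℝ}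
    (hf : ∀ n, MemLp (f n) 2) (hb : ∀ n, L2norm (f n) ≤ b n)
    (hbM : Filter.Tendsto b Filter.atTop (nhds M))
    (hl : ∀ x, Filter.Tendsto (fun n => f n x) Filter.atTop (nhds (g x))) :
    MemLp g 2 ∧ L2norm g ≤ M := by
  have hM : 0 ≤ M := ge_of_tendsto' hbM fun n => (L2norm_nonneg _).trans (hb n)
  have hg : AEStronglyMeasurable g :=
    aestronglyMeasurable_of_tendsto_ae Filter.atTop (fun n => (hf n).1)
      (Filter.Eventually.of_forall hl)
  have h1 : eLpNorm g 2 ≤ ENNReal.ofReal M := by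
    refine (Lp.eLpNorm_lim_le_liminf_eLpNorm (fun n => (hf n).1) g
      (Filter.Eventually.of_forall hl)).trans ?_
    rw [← (ENNReal.tendsto_ofReal hbM).liminf_eq]
    refine Filter.liminf_le_liminf (Filter.Eventually.of_forall fun n => ?_)
    rw [← ENNReal.ofReal_toReal (hf n).2.ne, ← L2norm_eq_toReal (hf n)]
    exact ENNReal.ofReal_le_ofReal (hb n)
  have h2 : MemLp g 2 := ⟨hg, h1.trans_lt ENNReal.ofReal_lt_top⟩
  refine ⟨h2, ?_⟩
  rw [L2norm_eq_toReal h2]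
  exact ENNReal.toReal_le_of_le_ofReal hM h1

/-- Minkowski's integral inequality in time. -/
lemma memLp_intervalIntegral {v : ℝ → E2 → ℂ} (hv : Continuous fun p : ℝ × E2 => v p.1 p.2)
    {a b M : ℝ} (hab : a ≤ b) (h : ∀ t ∈ Set.Icc a b, MemLp (v t) 2 ∧ L2norm (v t) ≤ M) :
    MemLp (fun x => ∫ t in a..b, v t x) 2 ∧ L2norm (fun x => ∫ t in a..b, v t x) ≤ (b - a) * M := by
  have hM : 0 ≤ M := (L2norm_nonneg _).trans (h a ⟨le_rfl, hab⟩).2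
  have hmeas : AEStronglyMeasurable (fun x => ∫ t in a..b, v t x) :=
    (intervalIntegral.continuous_parametric_intervalIntegral_of_continuous'
      (f := fun x t => v t x) (hv.comp continuous_swap) a b).aestronglyMeasurable
  refine memLp_of_lintegral_sq_le hmeas (by nlinarith) ?_
  have hpt : ∀ x, ‖∫ t in a..b, v t x‖ₑ ^ 2 ≤
      ENNReal.ofReal (b - a) * ∫⁻ t in Set.Ioc a b, ‖v t x‖ₑ ^ 2 := fun x => by
    rw [intervalIntegral.integral_of_le hab]
    have h1 := enorm_integral_le_lintegral_enorm (μ := volume.restrict (Set.Ioc a b))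
      (fun t => v t x)
    have hc : Continuous fun t => v t x := hv.comp (by fun_prop : Continuous fun t : ℝ => (t, x))
    have h2 := ENNReal.lintegral_mul_le_Lp_mul_Lq (volume.restrict (Set.Ioc a b))
      Real.HolderConjugate.two_two (f := fun t => ‖v t x‖ₑ) (g := fun _ => 1)
      hc.enorm.aemeasurable aemeasurable_const
    simp only [Pi.mul_apply, mul_one, ENNReal.one_rpow, lintegral_const, one_mul,
      MeasurableSet.univ, Measure.restrict_apply, Set.univ_inter, Real.volume_Ioc] at h2
    calc _ ≤ (((∫⁻ t in Set.Ioc a b, ‖v t x‖ₑ ^ (2 : ℝ)) ^ (1 / 2 : ℝ) *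
          (ENNReal.ofReal (b - a)) ^ (1 / 2 : ℝ))) ^ 2 := pow_le_pow_left' (h1.trans h2) 2
      _ = _ := by
        rw [mul_pow, ← ENNReal.rpow_natCast, ← ENNReal.rpow_natCast, ← ENNReal.rpow_mul,
          ← ENNReal.rpow_mul, mul_comm]
        norm_num
  calc ∫⁻ x, ‖∫ t in a..b, v t x‖ₑ ^ 2
      ≤ ∫⁻ x, ENNReal.ofReal (b - a) * ∫⁻ t in Set.Ioc a b, ‖v t x‖ₑ ^ 2 := lintegral_mono hpt
    _ = ENNReal.ofReal (b - a) * ∫⁻ x, ∫⁻ t in Set.Ioc a b, ‖v t x‖ₑ ^ 2 :=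
        lintegral_const_mul' _ _ ENNReal.ofReal_ne_top
    _ = ENNReal.ofReal (b - a) * ∫⁻ t in Set.Ioc a b, ∫⁻ x, ‖v t x‖ₑ ^ 2 := by
        rw [lintegral_lintegral_swap]
        exact (hv.comp continuous_swap).enorm.measurable.pow_const 2 |>.aemeasurable
    _ ≤ ENNReal.ofReal (b - a) * ∫⁻ t in Set.Ioc a b, ENNReal.ofReal (M ^ 2) := by
        refine mul_le_mul_right ?_ _
        refine setLIntegral_mono' measurableSet_Ioc fun t ht => ?_
        have := h t (Set.Ioc_subset_Icc_self ht)
        rw [lintegral_sq_eq this.1]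
        exact ENNReal.ofReal_le_ofReal (pow_le_pow_left₀ (L2norm_nonneg _) this.2 2)
    _ = ENNReal.ofReal (((b - a) * M) ^ 2) := by
        simp only [lintegral_const, MeasurableSet.univ, Measure.restrict_apply, Set.univ_inter,
          Real.volume_Ioc]
        rw [← ENNReal.ofReal_mul (by positivity), ← ENNReal.ofReal_mul (by linarith)]
        congr 1; ring

/-! ### Smooth dependence of interval integrals on parameters -/

section Parametric
variable {E F : Type} [NormedAddCommGroup E] [NormedSpace ℝ E] [FiniteDimensional ℝ E]
  [NormedAddCommGroup F] [NormedSpace ℝ F]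

lemma hasFDerivAt_intervalIntegral_param [CompleteSpace F] {f : ℝ × E → F}
    (hf : ContDiff ℝ (⊤ : ℕ∞) f) (a b : ℝ) (x : E) :
    HasFDerivAt (fun y => ∫ θ in a..b, f (θ, y))
      (∫ θ in a..b, (fderiv ℝ f (θ, x)).comp (ContinuousLinearMap.inr ℝ ℝ E)) x := by
  have hc : Continuous fun p : ℝ × E => (fderiv ℝ f p).comp (ContinuousLinearMap.inr ℝ ℝ E) :=
    (hf.continuous_fderiv (by simp)).clm_comp continuous_const
  obtain ⟨C, hC⟩ := ((isCompact_uIcc (a := a) (b := b)).prod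
    (isCompact_closedBall x 1)).exists_bound_of_continuousOn hc.continuousOn
  refine intervalIntegral.hasFDerivAt_integral_of_dominated_of_fderiv_le
    (s := Metric.ball x 1) (bound := fun _ => C) (Metric.ball_mem_nhds x one_pos)
    (F := fun y θ => f (θ, y))
    (F' := fun y θ => (fderiv ℝ f (θ, y)).comp (ContinuousLinearMap.inr ℝ ℝ E)) ?_ ?_ ?_ ?_ ?_ ?_
  · exact Filter.Eventually.of_forall fun y =>
      (hf.continuous.comp (by fun_prop : Continuous fun θ : ℝ => (θ, y))).aestronglyMeasurable
  · exact (hf.continuous.comp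
      (by fun_prop : Continuous fun θ : ℝ => (θ, x))).intervalIntegrable _ _
  · exact (hc.comp (by fun_prop : Continuous fun θ : ℝ => (θ, x))).aestronglyMeasurable
  · exact Filter.Eventually.of_forall fun θ hθ y hy =>
      hC (θ, y) ⟨Set.uIoc_subset_uIcc hθ, Metric.ball_subset_closedBall hy⟩
  · exact intervalIntegrable_const
  · refine Filter.Eventually.of_forall fun θ _ y _ => ?_
    exact ((hf.differentiable (by simp) (θ, y)).hasFDerivAt).comp y (hasFDerivAt_prodMk_right θ y)

lemma contDiff_intervalIntegral_nat (n : ℕ) (a b : ℝ) : ∀ {F : Type} [NormedAddCommGroup F]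
    [NormedSpace ℝ F] [CompleteSpace F] {f : ℝ × E → F}, ContDiff ℝ (⊤ : ℕ∞) f →
    ContDiff ℝ n (fun y => ∫ θ in a..b, f (θ, y)) := by
  induction n with
  | zero =>
    intro F _ _ _ f hf
    exact contDiff_zero.2 (continuous_iff_continuousAt.2 fun x =>
      (hasFDerivAt_intervalIntegral_param hf a b x).continuousAt)
  | succ n ih =>
    intro F _ _ _ f hf
    rw [Nat.cast_add, Nat.cast_one, contDiff_succ_iff_fderiv]
    refine ⟨fun x => (hasFDerivAt_intervalIntegral_param hf a b x).differentiableAt,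
      by simp, ?_⟩
    have e : fderiv ℝ (fun y => ∫ θ in a..b, f (θ, y)) = fun x =>
        ∫ θ in a..b, (fderiv ℝ f (θ, x)).comp (ContinuousLinearMap.inr ℝ ℝ E) := by
      ext1 x; exact (hasFDerivAt_intervalIntegral_param hf a b x).fderiv
    rw [e]
    exact ih (f := fun p => (fderiv ℝ f p).comp (ContinuousLinearMap.inr ℝ ℝ E))
      ((hf.fderiv_right (by simp)).clm_comp contDiff_const)

lemma contDiff_intervalIntegral_param [CompleteSpace F] {f : ℝ × E → F}
    (hf : ContDiff ℝ (⊤ : ℕ∞) f) (a b : ℝ) :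
    ContDiff ℝ (⊤ : ℕ∞) (fun y => ∫ θ in a..b, f (θ, y)) :=
  contDiff_infty.2 fun n => contDiff_intervalIntegral_nat n a b hf

end Parametric

/-- The time primitive of `v` vanishing at time `0`. -/
def prim (v : ℝ → E2 → ℂ) : ℝ → E2 → ℂ := fun t x => ∫ τ in (0 : ℝ)..t, v τ x

lemma JS.prim {v : ℝ → E2 → ℂ} (hv : JS v) : JS (prim v) := by
  have h : ContDiff ℝ (⊤ : ℕ∞) fun q : ℝ × (ℝ × E2) => (q.2.1 : ℂ) * v (q.2.1 * q.1) q.2.2 :=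
    ContDiff.mul (Complex.ofRealCLM.contDiff.comp (by fun_prop))
      (ContDiff.comp (f := fun q : ℝ × (ℝ × E2) => (q.2.1 * q.1, q.2.2)) hv (by fun_prop))
  have h2 := contDiff_intervalIntegral_param h 0 1
  unfold JS
  convert h2 using 2 with p
  dsimp only
  rw [intervalIntegral.integral_const_mul, ← Complex.real_smul,
    intervalIntegral.smul_integral_comp_mul_left (fun τ => v τ p.2)]
  simp [_root_.prim]

lemma JS.intervalIntegrable {v : ℝ → E2 → ℂ} (hv : JS v) (x : E2) (a b : ℝ) :
    IntervalIntegrable (fun t => v t x) volume a b :=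
  (hv.slice_time x).continuous.intervalIntegrable _ _

lemma JS.hasDerivAt_prim {v : ℝ → E2 → ℂ} (hv : JS v) (t : ℝ) (x : E2) :
    HasDerivAt (fun s => _root_.prim v s x) (v t x) t :=
  intervalIntegral.integral_hasDerivAt_right (hv.intervalIntegrable x _ _)
    (hv.slice_time x).continuous.stronglyMeasurable.stronglyMeasurableAtFilter
    (hv.slice_time x).continuous.continuousAt

lemma prim_sub {v : ℝ → E2 → ℂ} (hv : JS v) (a b : ℝ) (x : E2) :
    prim v b x - prim v a x = ∫ τ in a..b, v τ x :=
  intervalIntegral.integral_interval_sub_left (hv.intervalIntegrable x _ _)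
    (hv.intervalIntegrable x _ _)

lemma pd_prim {v : ℝ → E2 → ℂ} (hv : JS v) (i : Fin 2) (t : ℝ) :
    pd i (prim v t) = prim (fun s => pd i (v s)) t := by
  ext x
  have h := hasFDerivAt_intervalIntegral_param (show ContDiff ℝ (⊤ : ℕ∞)
    (fun p : ℝ × E2 => v p.1 p.2) from hv) 0 t x
  have hc : Continuous fun θ : ℝ => (fderiv ℝ (fun p : ℝ × E2 => v p.1 p.2) (θ, x)).comp
      (ContinuousLinearMap.inr ℝ ℝ E2) :=
    ((ContDiff.continuous_fderiv hv (by simp)).comp (by fun_prop)).clm_comp continuous_const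
  have h' : HasFDerivAt (prim v t) _ x := h
  simp only [pd, prim]
  rw [h'.fderiv, ContinuousLinearMap.intervalIntegral_apply (hc.intervalIntegrable _ _)]
  congr 1 with θ
  have := hv.pd_eq i θ x
  simp only [pd] at this
  rw [this]; simp

lemma Aop_prim {v : ℝ → E2 → ℂ} (hv : JS v) (t : ℝ) :
    Aop (prim v t) = prim (fun s => Aop (v s)) t := by
  ext x
  have h0 := ((hv.pd 0).pd 0).intervalIntegrable x 0 t
  have h1 := ((hv.pd 1).pd 1).intervalIntegrable x 0 t
  simp only [Aop, lap, Fin.sum_univ_two, pd_prim hv, pd_prim (hv.pd _)]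
  simp only [prim, Aop, lap, Fin.sum_univ_two]
  have h2 : IntervalIntegrable (fun t => -(pd 0 (pd 0 (v t)) x + pd 1 (pd 1 (v t)) x))
      volume 0 t := (h0.add h1).neg
  rw [intervalIntegral.integral_add h2 ((hv.intervalIntegrable x 0 t).const_mul _),
    intervalIntegral.integral_neg, intervalIntegral.integral_add h0 h1,
    intervalIntegral.integral_const_mul]

/-! ### Spatial cutoffs -/

/-- Smooth compactly supported functions. -/
structure IsCutoff (η : E2 → ℝ) : Prop where
  smooth : ContDiff ℝ (⊤ : ℕ∞) (fun x => (η x : ℂ))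
  supp : HasCompactSupport (fun x => (η x : ℂ))
  nonneg : ∀ x, 0 ≤ η x
  le_one : ∀ x, η x ≤ 1

lemma exists_cutoffs_ball : ∃ (C : ℝ) (η : ℕ → E2 → ℝ), 0 ≤ C ∧ (∀ n, IsCutoff (η n)) ∧
    (∀ (n : ℕ) x, ‖x‖ ≤ n + 1 → η n x = 1) ∧
    ∀ n i x, ‖pd i (fun x => (η n x : ℂ)) x‖ ≤ C / (n + 1) := by
  let f : ContDiffBump (0 : E2) := ⟨1, 2, one_pos, one_lt_two⟩
  have hf : ContDiff ℝ (⊤ : ℕ∞) (fun x => (f x : ℂ)) := Complex.ofRealCLM.contDiff.comp f.contDiff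
  have hs : HasCompactSupport (fun x => (f x : ℂ)) :=
    f.hasCompactSupport.comp_left (g := fun r : ℝ => (r : ℂ)) (by simp)
  obtain ⟨C, hC⟩ := (hs.fderiv (𝕜 := ℝ)).exists_bound_of_continuous
    (hf.continuous_fderiv (by simp))
  have hC0 : 0 ≤ C := (norm_nonneg _).trans (hC 0)
  refine ⟨C, fun n x => f (((n : ℝ) + 1)⁻¹ • x), hC0, fun n => ⟨?_, ?_, fun x => f.nonneg,
    fun x => f.le_one⟩, fun n x hx => ?_, fun n i x => ?_⟩
  · exact hf.comp (contDiff_const_smul _)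
  · exact hs.comp_homeomorph (Homeomorph.smulOfNeZero ((n : ℝ) + 1)⁻¹ (by positivity))
  · apply f.one_of_mem_closedBall
    rw [mem_closedBall_zero_iff, norm_smul, norm_inv, Real.norm_of_nonneg (by positivity),
      inv_mul_le_iff₀ (by positivity)]
    show ‖x‖ ≤ ((n : ℝ) + 1) * 1
    linarith
  · have h1 : HasFDerivAt (fun x : E2 => ((n : ℝ) + 1)⁻¹ • x)
        (((n : ℝ) + 1)⁻¹ • ContinuousLinearMap.id ℝ E2) x :=
      (((n : ℝ) + 1)⁻¹ • ContinuousLinearMap.id ℝ E2).hasFDerivAt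
    have h : HasFDerivAt (fun x => (f (((n : ℝ) + 1)⁻¹ • x) : ℂ))
        ((fderiv ℝ (fun x => (f x : ℂ)) (((n : ℝ) + 1)⁻¹ • x)).comp
          (((n : ℝ) + 1)⁻¹ • ContinuousLinearMap.id ℝ E2)) x :=
      HasFDerivAt.comp x ((hf.differentiable (by simp) _).hasFDerivAt) h1
    simp only [pd]
    rw [h.fderiv]
    simp only [ContinuousLinearMap.comp_apply, smul_apply,
      ContinuousLinearMap.id_apply, map_smul, norm_smul, norm_inv]
    rw [Real.norm_of_nonneg (by positivity), div_eq_inv_mul]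
    gcongr
    refine (ContinuousLinearMap.le_opNorm _ _).trans ?_
    simpa using hC (((n : ℝ) + 1)⁻¹ • x)

lemma exists_cutoffs : ∃ (C : ℝ) (η : ℕ → E2 → ℝ), 0 ≤ C ∧ (∀ n, IsCutoff (η n)) ∧
    (∀ x, ∀ᶠ n in Filter.atTop, η n x = 1) ∧
    ∀ n i x, ‖pd i (fun x => (η n x : ℂ)) x‖ ≤ C / (n + 1) := by
  obtain ⟨C, η, hC, hη, h1, hd⟩ := exists_cutoffs_ball
  refine ⟨C, η, hC, hη, fun x => ?_, hd⟩
  obtain ⟨N, hN⟩ := exists_nat_ge ‖x‖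
  filter_upwards [Filter.eventually_ge_atTop N] with n hn
  have : (N : ℝ) ≤ n := by exact_mod_cast hn
  exact h1 n x (by linarith)

lemma IsCutoff.integrable {η : E2 → ℝ} (hη : IsCutoff η) {f : E2 → ℂ} (hf : Continuous f) :
    Integrable (fun x => (η x : ℂ) * f x) :=
  (hη.smooth.continuous.mul hf).integrable_of_hasCompactSupport hη.supp.mul_right

lemma IsCutoff.memLp {η : E2 → ℝ} (hη : IsCutoff η) {f : E2 → ℂ} (hf : Continuous f) :
    MemLp (fun x => (η x : ℂ) * f x) 2 :=
  (hη.smooth.continuous.mul hf).memLp_of_hasCompactSupport hη.supp.mul_right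

lemma IsCutoff.norm_le {η : E2 → ℝ} (hη : IsCutoff η) (x : E2) : ‖(η x : ℂ)‖ ≤ 1 := by
  rw [Complex.norm_real, Real.norm_of_nonneg (hη.nonneg x)]; exact hη.le_one x

lemma IsCutoff.L2norm_le {η : E2 → ℝ} (hη : IsCutoff η) {f : E2 → ℂ} (hf : MemLp f 2) :
    L2norm (fun x => (η x : ℂ) * f x) ≤ L2norm f := by
  simpa using L2norm_mul_le hf hη.norm_le

/-- Differentiation in time of a spatial integral with compactly supported integrand. -/
lemma IsCutoff.hasDerivAt_integral {η : E2 → ℝ} (hη : IsCutoff η) {Φ : ℝ → E2 → ℂ} (hΦ : JS Φ)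
    (t : ℝ) : HasDerivAt (fun s => ∫ x, (η x : ℂ) * Φ s x) (∫ x, (η x : ℂ) * tderiv Φ t x) t := by
  have hc : Continuous fun p : ℝ × E2 => (η p.2 : ℂ) * tderiv Φ p.1 p.2 :=
    (hη.smooth.continuous.comp continuous_snd).mul hΦ.tderiv.continuous
  obtain ⟨C, hC⟩ := ((isCompact_closedBall t 1).prod hη.supp).exists_bound_of_continuousOn
    hc.continuousOn
  have hS : Integrable ((tsupport fun x => (η x : ℂ)).indicator fun _ => C) :=
    (integrable_indicator_iff (isClosed_tsupport _).measurableSet).2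
      (integrableOn_const hη.supp.measure_lt_top.ne)
  refine (hasDerivAt_integral_of_dominated_loc_of_deriv_le (Metric.ball_mem_nhds t one_pos)
    (F := fun s x => (η x : ℂ) * Φ s x) (F' := fun s x => (η x : ℂ) * tderiv Φ s x)
    ?_ (hη.integrable (hΦ.slice t).continuous)
    (hη.smooth.continuous.mul (hΦ.tderiv.slice t).continuous).aestronglyMeasurable ?_ hS ?_).2
  · exact Filter.Eventually.of_forall fun s =>
      (hη.smooth.continuous.mul (hΦ.slice s).continuous).aestronglyMeasurable
  · refine Filter.Eventually.of_forall fun x s hs => ?_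
    by_cases hx : x ∈ tsupport fun x => (η x : ℂ)
    · rw [Set.indicator_of_mem hx]
      exact hC (s, x) ⟨Metric.ball_subset_closedBall hs, hx⟩
    · rw [Set.indicator_of_notMem hx, show (η x : ℂ) = 0 from
        image_eq_zero_of_notMem_tsupport (f := fun x => (η x : ℂ)) hx]
      simp
  · exact Filter.Eventually.of_forall fun x s _ => (hΦ.hasDerivAt_time s x).const_mul _

lemma IsCutoff.caccioppoli {η : E2 → ℝ} (hη : IsCutoff η) {f : E2 → ℂ}
    (hf : ContDiff ℝ (⊤ : ℕ∞) f) (hL : MemLp f 2) (hA : MemLp (Aop f) 2) {M K δ : ℝ}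
    (hM : L2norm f ≤ M) (hK : L2norm (Aop f) ≤ K)
    (hδ : ∀ i x, ‖pd i (fun x => (η x : ℂ)) x‖ ≤ δ) :
    |(∫ x, (η x : ℂ) * (Aop f x * (η x * (starRingEnd ℂ) (f x)))).im| ≤
      2 * δ * M * (1 + 2 * K * M + 4 * δ * M) := by
  have hM0 : 0 ≤ M := (L2norm_nonneg _).trans hM
  have hK0 : 0 ≤ K := (L2norm_nonneg _).trans hK
  have hδ0 : 0 ≤ δ := (norm_nonneg _).trans (hδ 0 0)
  have hfc := hf.continuous
  have hcc : Continuous fun x => (starRingEnd ℂ) (f x) := Complex.continuous_conj.comp hfc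
  have hηc := hη.smooth.continuous
  have hηd : Differentiable ℝ fun x => (η x : ℂ) := hη.smooth.differentiable (by simp)
  have hfd : Differentiable ℝ f := hf.differentiable (by simp)
  have hcd : Differentiable ℝ fun x => (starRingEnd ℂ) (f x) :=
    (Complex.conjCLE : ℂ →L[ℝ] ℂ).differentiable.comp hfd
  have hpdf : ∀ i, ContDiff ℝ (⊤ : ℕ∞) (pd i f) := fun i =>
    (hf.fderiv_right (by simp)).clm_apply contDiff_const
  have hpde : ∀ i, Continuous (pd i fun x => (η x : ℂ)) := fun i =>
    ((hη.smooth.fderiv_right (m := (⊤ : ℕ∞)) (by simp)).clm_apply contDiff_const).continuous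
  have hpdc : ∀ i, Continuous (pd i f) := fun i => (hpdf i).continuous
  have hpdcc : ∀ i, Continuous fun x => (starRingEnd ℂ) (pd i f x) := fun i =>
    Complex.continuous_conj.comp (hpdc i)
  have hpdd : ∀ i, Differentiable ℝ (pd i f) := fun i => (hpdf i).differentiable (by simp)
  have hppc : ∀ i, Continuous (pd i (pd i f)) := fun i =>
    (((hpdf i).fderiv_right (m := (⊤ : ℕ∞)) (by simp)).clm_apply contDiff_const).continuous
  set W : E2 → ℂ := fun x => (η x : ℂ) * (η x * (starRingEnd ℂ) (f x)) with hW
  have hηcd : Differentiable ℝ fun x => (η x : ℂ) * (starRingEnd ℂ) (f x) := hηd.mul hcd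
  have hWd : Differentiable ℝ W := hηd.mul hηcd
  have hpW : ∀ i x, pd i W x = (η x : ℂ) * (2 * (pd i (fun x => (η x : ℂ)) x *
      (starRingEnd ℂ) (f x)) + η x * (starRingEnd ℂ) (pd i f x)) := fun i x => by
    rw [hW, pd_mul i hηd hηcd, pd_mul i hηd hcd, pd_conj i hfd]; ring
  set g : Fin 2 → ℝ := fun i => L2norm (fun x => (η x : ℂ) * pd i f x) with hg
  set Y : Fin 2 → ℂ := fun i => ∫ x, (η x : ℂ) * (2 * (pd i (fun x => (η x : ℂ)) x *
      (starRingEnd ℂ) (f x)) * pd i f x) with hY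
  have hIBP : ∀ i, ∫ x, (η x : ℂ) * ((η x * (starRingEnd ℂ) (f x)) * pd i (pd i f) x) =
      -(((g i ^ 2 : ℝ) : ℂ) + Y i) := fun i => by
    have h := integral_mul_pd i hWd (hpdd i)
      (by
        have := hη.integrable (f := fun x => (2 * (pd i (fun x => (η x : ℂ)) x *
          (starRingEnd ℂ) (f x)) + η x * (starRingEnd ℂ) (pd i f x)) * pd i f x)
          (((continuous_const.mul ((hpde i).mul hcc)).add (hηc.mul (hpdcc i))).mul (hpdc i))
        refine this.congr (Filter.Eventually.of_forall fun x => ?_)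
        simp only [hpW]; ring)
      (by
        have := hη.integrable (f := fun x => (η x * (starRingEnd ℂ) (f x)) * pd i (pd i f) x)
          ((hηc.mul hcc).mul (hppc i))
        refine this.congr (Filter.Eventually.of_forall fun x => ?_)
        simp only [hW]; ring)
      (by
        have := hη.integrable (f := fun x => (η x * (starRingEnd ℂ) (f x)) * pd i f x)
          ((hηc.mul hcc).mul (hpdc i))
        refine this.congr (Filter.Eventually.of_forall fun x => ?_)
        simp only [hW]; ring)
    have e1 : ∫ x, (η x : ℂ) * ((η x * (starRingEnd ℂ) (f x)) * pd i (pd i f) x) =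
        ∫ x, W x * pd i (pd i f) x := by congr 1 with x; simp only [hW]; ring
    rw [e1, h, hg, ← integral_self_mul_conj, ← integral_add]
    · congr 2 with x
      rw [hpW]; simp only [map_mul, Complex.conj_ofReal]; ring
    · exact integrable_mul_conj (hη.memLp (hpdc i)) (hη.memLp (hpdc i))
    · exact hη.integrable ((continuous_const.mul ((hpde i).mul hcc)).mul (hpdc i))
  set P : ℝ := ∫ x, ‖x‖ ^ 2 * ‖(η x : ℂ) * f x‖ ^ 2 with hP
  have hP0 : 0 ≤ P := integral_nonneg fun x => by positivity
  have hnc : Continuous fun x : E2 => (‖x‖ : ℂ) ^ 2 :=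
    (Complex.continuous_ofReal.comp continuous_norm).pow 2
  have hmain : ∫ x, (η x : ℂ) * (Aop f x * (η x * (starRingEnd ℂ) (f x))) =
      ((g 0 ^ 2 + g 1 ^ 2 + P : ℝ) : ℂ) + (Y 0 + Y 1) := by
    have hPc : (P : ℂ) = ∫ x, (η x : ℂ) * ((‖x‖ : ℂ) ^ 2 * f x * (η x * (starRingEnd ℂ) (f x))) := by
      rw [hP, ← integral_complex_ofReal]
      congr 1 with x
      have := Complex.mul_conj ((η x : ℂ) * f x)
      rw [Complex.normSq_eq_norm_sq] at this
      push_cast at this ⊢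
      rw [← this]; simp only [map_mul, Complex.conj_ofReal]; ring
    have hi : ∀ i, Integrable fun x =>
        (η x : ℂ) * ((η x * (starRingEnd ℂ) (f x)) * pd i (pd i f) x) := fun i =>
      hη.integrable ((hηc.mul hcc).mul (hppc i))
    have e : ∫ x, (η x : ℂ) * (Aop f x * (η x * (starRingEnd ℂ) (f x))) =
        -((∫ x, (η x : ℂ) * ((η x * (starRingEnd ℂ) (f x)) * pd 0 (pd 0 f) x)) +
          ∫ x, (η x : ℂ) * ((η x * (starRingEnd ℂ) (f x)) * pd 1 (pd 1 f) x)) + P := by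
      rw [hPc, ← integral_add (hi 0) (hi 1), ← integral_neg, ← integral_add]
      · congr 1 with x
        simp only [Aop, lap, Fin.sum_univ_two]; ring
      · exact ((hi 0).add (hi 1)).neg
      · exact hη.integrable ((hnc.mul hfc).mul (hηc.mul hcc))
    rw [e, hIBP 0, hIBP 1]; push_cast; ring
  have hYb : ∀ i, ‖Y i‖ ≤ 2 * δ * M * g i := fun i => by
    have h1 : Y i = 2 * ∫ x, ((η x : ℂ) * pd i f x) * (starRingEnd ℂ)
        ((starRingEnd ℂ) (pd i (fun x => (η x : ℂ)) x) * f x) := by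
      rw [← integral_const_mul]
      show integral _ _ = _
      congr 1 with x
      simp only [map_mul, Complex.conj_conj]; ring
    have hb : ∀ x, ‖(starRingEnd ℂ) (pd i (fun x => (η x : ℂ)) x)‖ ≤ δ := fun x => by
      simpa using hδ i x
    have hm : MemLp (fun x => (starRingEnd ℂ) (pd i (fun x => (η x : ℂ)) x) * f x) 2 := by
      refine (hL.const_mul (δ : ℂ)).of_le
        ((Complex.continuous_conj.comp (hpde i)).mul hfc).aestronglyMeasurable
        (Filter.Eventually.of_forall fun x => ?_)
      rw [norm_mul, norm_mul, Complex.norm_real, Real.norm_of_nonneg hδ0]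
      exact mul_le_mul_of_nonneg_right (hb x) (norm_nonneg _)
    rw [h1, norm_mul]
    have h2 := norm_integral_mul_conj_le (hη.memLp (hpdc i)) hm
    have h3 := (L2norm_mul_le hL hb).trans (mul_le_mul_of_nonneg_left hM hδ0)
    have h4 : 0 ≤ g i := L2norm_nonneg _
    have h5 := h2.trans (mul_le_mul_of_nonneg_left h3 (L2norm_nonneg _))
    simp only [RCLike.norm_ofNat]
    calc _ ≤ 2 * (g i * (δ * M)) := by gcongr
      _ = _ := by ring
  have hKM : ‖∫ x, (η x : ℂ) * (Aop f x * (η x * (starRingEnd ℂ) (f x)))‖ ≤ K * M := by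
    have h1 : ∫ x, (η x : ℂ) * (Aop f x * (η x * (starRingEnd ℂ) (f x))) =
        ∫ x, ((η x : ℂ) * Aop f x) * (starRingEnd ℂ) (η x * f x) := by
      congr 1 with x
      simp only [map_mul, Complex.conj_ofReal]; ring
    have hAm : MemLp (fun x => (η x : ℂ) * Aop f x) 2 :=
      hA.of_le (hηc.aestronglyMeasurable.mul hA.1) (Filter.Eventually.of_forall fun x => by
        rw [norm_mul]; exact mul_le_of_le_one_left (norm_nonneg _) (hη.norm_le x))
    rw [h1]
    refine (norm_integral_mul_conj_le hAm (hη.memLp hfc)).trans ?_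
    exact mul_le_mul ((hη.L2norm_le hA).trans hK) ((hη.L2norm_le hL).trans hM)
      (L2norm_nonneg _) hK0
  have hre := (Complex.re_le_norm _).trans hKM
  rw [hmain, Complex.add_re, Complex.ofReal_re] at hre
  have hY0 := Complex.abs_re_le_norm (Y 0 + Y 1)
  have hYs : ‖Y 0 + Y 1‖ ≤ 2 * δ * M * (g 0 + g 1) :=
    (norm_add_le _ _).trans (by linarith [hYb 0, hYb 1])
  have hlow := (abs_le.1 (hY0.trans hYs)).1
  have hg0 : 0 ≤ g 0 := L2norm_nonneg _
  have hg1 : 0 ≤ g 1 := L2norm_nonneg _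
  have hsum : g 0 + g 1 ≤ 1 + 2 * K * M + 4 * δ * M := by
    have hq : (g 0 + g 1) ^ 2 ≤ 2 * K * M + 4 * δ * M * (g 0 + g 1) := by
      nlinarith [sq_nonneg (g 0 - g 1)]
    by_contra hcon
    push Not at hcon
    have : 0 ≤ K * M := by positivity
    have : 0 ≤ δ * M := by positivity
    nlinarith
  rw [hmain, Complex.add_im, Complex.ofReal_im, zero_add]
  refine (Complex.abs_im_le_norm _).trans (hYs.trans ?_)
  exact mul_le_mul_of_nonneg_left hsum (by positivity)

/-! ### Growth of `L²` norms along inhomogeneous linear flows -/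

lemma sub_le_mul_sub_of_hasDerivAt_le {s s' : ℝ → ℝ} {c d C : ℝ} (hcd : c ≤ d)
    (hs : ∀ t ∈ Set.Icc c d, HasDerivAt s (s' t) t) (hC : ∀ t ∈ Set.Icc c d, s' t ≤ C) :
    s d - s c ≤ C * (d - c) := by
  refine (convex_Icc c d).image_sub_le_mul_sub_of_deriv_le
    (fun t ht => (hs t ht).continuousAt.continuousWithinAt)
    (fun t ht => (hs t (interior_subset ht)).differentiableAt.differentiableWithinAt)
    (fun t ht => ?_) c (Set.left_mem_Icc.2 hcd) d (Set.right_mem_Icc.2 hcd) hcd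
  rw [(hs t (interior_subset ht)).deriv]
  exact hC t (interior_subset ht)

lemma IsCutoff.growth {η : E2 → ℝ} (hη : IsCutoff η) {V : ℝ → E2 → ℂ} (hV : JS V)
    {c d M K m δ κ : ℝ} (hcd : c ≤ d) (hκ : 0 < κ)
    (hV2 : ∀ t ∈ Set.Icc c d, MemLp (V t) 2 ∧ L2norm (V t) ≤ M)
    (hA2 : ∀ t ∈ Set.Icc c d, MemLp (Aop (V t)) 2 ∧ L2norm (Aop (V t)) ≤ K)
    (hG2 : ∀ t ∈ Set.Icc c d, MemLp (fun x => I * tderiv V t x + Aop (V t) x) 2 ∧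
      L2norm (fun x => I * tderiv V t x + Aop (V t) x) ≤ m)
    (hδ : ∀ i x, ‖pd i (fun x => (η x : ℂ)) x‖ ≤ δ) :
    L2norm (fun x => η x * V d x) ≤ L2norm (V c) + κ +
      (m + 2 * δ * M * (1 + 2 * K * M + 4 * δ * M) / κ) * (d - c) := by
  set E := 2 * δ * M * (1 + 2 * K * M + 4 * δ * M) with hE
  have hM0 : 0 ≤ M := (L2norm_nonneg _).trans (hV2 c ⟨le_rfl, hcd⟩).2
  have hK0 : 0 ≤ K := (L2norm_nonneg _).trans (hA2 c ⟨le_rfl, hcd⟩).2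
  have hm0 : 0 ≤ m := (L2norm_nonneg _).trans (hG2 c ⟨le_rfl, hcd⟩).2
  have hδ0 : 0 ≤ δ := (norm_nonneg _).trans (hδ 0 0)
  have hE0 : 0 ≤ E := by positivity
  have hηJ : JS (fun _ x => (η x : ℂ)) := hη.smooth.comp contDiff_snd
  set q : ℝ → ℝ := fun t => L2norm (fun x => η x * V t x) ^ 2 with hq
  set q' : ℝ → ℝ := fun t =>
    (2 * ∫ x, (η x : ℂ) * (tderiv V t x * (η x * (starRingEnd ℂ) (V t x)))).re with hq'
  have hηc := hη.smooth.continuous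
  have hVc : ∀ t, Continuous (V t) := fun t => (hV.slice t).continuous
  have hVtc : ∀ t, Continuous (tderiv V t) := fun t => (hV.tderiv.slice t).continuous
  have hcc : ∀ t, Continuous fun x => (starRingEnd ℂ) (V t x) := fun t =>
    Complex.continuous_conj.comp (hVc t)
  have hctc : ∀ t, Continuous fun x => (starRingEnd ℂ) (tderiv V t x) := fun t =>
    Complex.continuous_conj.comp (hVtc t)
  have hqd : ∀ t, HasDerivAt q (q' t) t := fun t => by
    have hΦ : JS (fun t x => V t x * (η x * (starRingEnd ℂ) (V t x))) := hV.mul (hηJ.mul hV.conj)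
    have h := (Complex.reCLM.hasFDerivAt.comp_hasDerivAt t (hη.hasDerivAt_integral hΦ t))
    have e1 : (Complex.reCLM ∘ fun s => ∫ x, (η x : ℂ) * (V s x * (η x * (starRingEnd ℂ) (V s x))))
        = q := by
      funext s
      have := integral_self_mul_conj (fun x => η x * V s x)
      simp only [Function.comp, Complex.reCLM_apply, hq]
      rw [← Complex.ofReal_re (L2norm _ ^ 2), ← this]
      congr 2 with x
      simp only [map_mul, Complex.conj_ofReal]; ring
    rw [e1] at h
    suffices hs : q' t = (∫ x, (η x : ℂ) *
        tderiv (fun t x => V t x * (η x * (starRingEnd ℂ) (V t x))) t x).re by rw [hs]; exact h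
    have e2 : ∀ x, tderiv (fun t x => V t x * (η x * (starRingEnd ℂ) (V t x))) t x =
        tderiv V t x * (η x * (starRingEnd ℂ) (V t x)) +
          (starRingEnd ℂ) (tderiv V t x * (η x * (starRingEnd ℂ) (V t x))) := fun x => by
      have h1 := hV.hasDerivAt_time t x
      have h2 := hV.conj.hasDerivAt_time t x
      have h3 := congrFun (congrFun (tderiv_conj hV) t) x
      have h4 : tderiv (fun t x => (starRingEnd ℂ) (V t x)) t x =
        (starRingEnd ℂ) (tderiv V t x) := h3
      rw [show tderiv (fun t x => V t x * (η x * (starRingEnd ℂ) (V t x))) t x = _ from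
        (h1.mul (h2.const_mul (η x : ℂ))).deriv, h4]
      simp only [map_mul, Complex.conj_ofReal, Complex.conj_conj]; ring
    simp only [e2, mul_add, hq']
    have hi : Integrable fun x => (η x : ℂ) * (tderiv V t x * (η x * (starRingEnd ℂ) (V t x))) :=
      hη.integrable ((hVtc t).mul (hηc.mul (hcc t)))
    have hi2 : Integrable fun x => (η x : ℂ) *
        (starRingEnd ℂ) (tderiv V t x * (η x * (starRingEnd ℂ) (V t x))) :=
      hη.integrable (Complex.continuous_conj.comp ((hVtc t).mul (hηc.mul (hcc t))))
    rw [integral_add hi hi2]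
    have e3 : ∫ x, (η x : ℂ) * (starRingEnd ℂ) (tderiv V t x * (η x * (starRingEnd ℂ) (V t x))) =
        (starRingEnd ℂ) (∫ x, (η x : ℂ) * (tderiv V t x * (η x * (starRingEnd ℂ) (V t x)))) := by
      rw [← integral_conj]
      congr 1 with x
      simp only [map_mul, Complex.conj_ofReal]
    rw [e3, Complex.add_re, Complex.conj_re, ← two_mul, Complex.mul_re]
    simp
  have hbound : ∀ t ∈ Set.Icc c d, q' t ≤ 2 * m * L2norm (fun x => η x * V t x) + 2 * E := by
    intro t ht
    have hcac := hη.caccioppoli (hV.slice t) (hV2 t ht).1 (hA2 t ht).1 (hV2 t ht).2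
      (hA2 t ht).2 hδ
    rw [← hE] at hcac
    have hAc : Continuous (Aop (V t)) := (hV.Aop.slice t).continuous
    have e1 : ∫ x, (η x : ℂ) * (tderiv V t x * (η x * (starRingEnd ℂ) (V t x))) =
        -I * (∫ x, (η x * (I * tderiv V t x + Aop (V t) x)) * (starRingEnd ℂ) (η x * V t x)) +
        I * ∫ x, (η x : ℂ) * (Aop (V t) x * (η x * (starRingEnd ℂ) (V t x))) := by
      rw [← integral_const_mul, ← integral_const_mul, ← integral_add]
      · congr 1 with x
        simp only [map_mul, Complex.conj_ofReal]
        linear_combination ((η x : ℂ) * (tderiv V t x * (η x * (starRingEnd ℂ) (V t x)))) * I_sq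
      · refine (integrable_mul_conj ?_ (hη.memLp (hVc t))).const_mul _
        exact hη.memLp ((continuous_const.mul (hVtc t)).add hAc)
      · exact (hη.integrable (hAc.mul (hηc.mul (hcc t)))).const_mul _
    have e2 := norm_integral_mul_conj_le
      (hη.memLp ((continuous_const.mul (hVtc t)).add hAc)) (hη.memLp (hVc t)) (f := fun x =>
        (η x * (I * tderiv V t x + Aop (V t) x)))
    have e3 := (hη.L2norm_le (hG2 t ht).1).trans (hG2 t ht).2
    have e4 := e2.trans (mul_le_mul_of_nonneg_right e3 (L2norm_nonneg _))
    have e5 := (Complex.abs_im_le_norm _).trans e4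
    simp only [hq', e1]
    simp only [Complex.mul_re, Complex.add_re, Complex.neg_re, Complex.I_re, Complex.neg_im,
      Complex.I_im, Complex.re_ofNat, Complex.im_ofNat]
    have e6 := (abs_le.1 hcac).1
    have e7 := (abs_le.1 e5).2
    linarith
  have hq0 : ∀ t, 0 ≤ q t := fun t => sq_nonneg _
  have hpos : ∀ t, 0 < q t + κ ^ 2 := fun t => by have := hq0 t; positivity
  have hsd : ∀ t ∈ Set.Icc c d, HasDerivAt (fun t => Real.sqrt (q t + κ ^ 2))
      (q' t / (2 * Real.sqrt (q t + κ ^ 2))) t := fun t _ =>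
    ((hqd t).add_const _).sqrt (hpos t).ne'
  have hmv := sub_le_mul_sub_of_hasDerivAt_le hcd hsd (C := m + E / κ) fun t ht => by
    have hs1 : L2norm (fun x => η x * V t x) ≤ Real.sqrt (q t + κ ^ 2) :=
      Real.le_sqrt_of_sq_le (by simp only [hq]; nlinarith)
    have hs2 : κ ≤ Real.sqrt (q t + κ ^ 2) := Real.le_sqrt_of_sq_le (by linarith [hq0 t])
    set s := Real.sqrt (q t + κ ^ 2)
    have hs0 : 0 < s := hκ.trans_le hs2
    rw [div_le_iff₀ (by positivity)]
    have h1 : E ≤ E / κ * s := by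
      rw [div_mul_eq_mul_div, le_div_iff₀ hκ]; exact mul_le_mul_of_nonneg_left hs2 hE0
    have h2 := mul_le_mul_of_nonneg_left hs1 hm0
    nlinarith [hbound t ht]
  have h1 : L2norm (fun x => η x * V d x) ≤ Real.sqrt (q d + κ ^ 2) :=
    Real.le_sqrt_of_sq_le (by simp only [hq]; nlinarith)
  have h2 : Real.sqrt (q c + κ ^ 2) ≤ L2norm (V c) + κ := by
    rw [Real.sqrt_le_left (by have := L2norm_nonneg (V c); positivity)]
    have := hη.L2norm_le (hV2 c ⟨le_rfl, hcd⟩).1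
    have h3 := pow_le_pow_left₀ (L2norm_nonneg _) this 2
    have := L2norm_nonneg (V c)
    simp only [hq]; nlinarith
  linarith

/-- Growth bound when both `V` and `A V` are bounded in `L²`. -/
lemma L2norm_growth {V : ℝ → E2 → ℂ} (hV : JS V) {c d M K m : ℝ} (hcd : c ≤ d)
    (hV2 : ∀ t ∈ Set.Icc c d, MemLp (V t) 2 ∧ L2norm (V t) ≤ M)
    (hA2 : ∀ t ∈ Set.Icc c d, MemLp (Aop (V t)) 2 ∧ L2norm (Aop (V t)) ≤ K)
    (hG2 : ∀ t ∈ Set.Icc c d, MemLp (fun x => I * tderiv V t x + Aop (V t) x) 2 ∧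
      L2norm (fun x => I * tderiv V t x + Aop (V t) x) ≤ m) :
    L2norm (V d) ≤ L2norm (V c) + m * (d - c) := by
  obtain ⟨C, η, hC, hη, hη1, hηd⟩ := exists_cutoffs
  refine le_of_forall_pos_le_add fun κ hκ => ?_
  have hlim : Filter.Tendsto (fun n : ℕ => C / ((n : ℝ) + 1)) Filter.atTop (nhds 0) :=
    tendsto_const_div_atTop_nhds_zero_nat C |>.comp (Filter.tendsto_add_atTop_nat 1) |>.congr
      fun n => by simp
  have h := memLp_of_tendsto_of_le (g := V d)
    (fun n => (hη n).memLp (hV.slice d).continuous)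
    (fun n => (hη n).growth hV hcd hκ hV2 hA2 hG2 (hηd n))
    (M := L2norm (V c) + κ + m * (d - c)) ?_ ?_
  · linarith [h.2]
  · have hc : Continuous fun δ : ℝ => L2norm (V c) + κ +
      (m + 2 * δ * M * (1 + 2 * K * M + 4 * δ * M) / κ) * (d - c) := by fun_prop
    have h0 := (hc.tendsto 0).comp hlim
    have e0 : L2norm (V c) + κ + (m + 2 * 0 * M * (1 + 2 * K * M + 4 * 0 * M) / κ) * (d - c) =
      L2norm (V c) + κ + m * (d - c) := by simp
    rw [e0] at h0
    exact h0
  · intro x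
    refine tendsto_const_nhds.congr' ?_
    filter_upwards [hη1 x] with n hn
    simp [hn]

lemma Aop_add {f g : E2 → ℂ} (hf : ContDiff ℝ (⊤ : ℕ∞) f) (hg : ContDiff ℝ (⊤ : ℕ∞) g) (x : E2) :
    Aop (fun y => f y + g y) x = Aop f x + Aop g x := by
  have hd : ∀ {f : E2 → ℂ}, ContDiff ℝ (⊤ : ℕ∞) f → ∀ i, Differentiable ℝ (pd i f) := fun hf i =>
    ((hf.fderiv_right (m := (⊤ : ℕ∞)) (by simp)).clm_apply contDiff_const).differentiable (by simp)
  have h1 : ∀ i, pd i (fun y => f y + g y) = fun y => pd i f y + pd i g y := fun i => by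
    ext y; exact pd_add i (hf.differentiable (by simp)) (hg.differentiable (by simp)) y
  simp only [Aop, lap, h1, pd_add _ (hd hf _) (hd hg _), Finset.sum_add_distrib]
  ring

lemma Aop_const_mul {f : E2 → ℂ} (c : ℂ) (hf : ContDiff ℝ (⊤ : ℕ∞) f) (x : E2) :
    Aop (fun y => c * f y) x = c * Aop f x := by
  have hd : ∀ i, Differentiable ℝ (pd i f) := fun i =>
    ((hf.fderiv_right (m := (⊤ : ℕ∞)) (by simp)).clm_apply contDiff_const).differentiable (by simp)
  have h1 : ∀ i, pd i (fun y => c * f y) = fun y => c * pd i f y := fun i => by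
    ext y; exact pd_const_mul i c (hf.differentiable (by simp)) y
  simp only [Aop, lap, h1, pd_const_mul _ c (hd _), ← Finset.mul_sum]
  ring

lemma Aop_prim_sub {v : ℝ → E2 → ℂ} (hv : JS v) (c : ℂ) (p q : ℝ) (x : E2) :
    Aop (fun y => c * (prim v q y + -1 * prim v p y)) x =
      c * ((∫ τ in p..q, (I * tderiv v τ x + Aop (v τ) x)) - I * (v q x - v p x)) := by
  have hq := hv.prim.slice q
  have hp := hv.prim.slice p
  have hp' : ContDiff ℝ (⊤ : ℕ∞) (fun y => -1 * prim v p y) := contDiff_const.mul hp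
  have e1 : ∫ τ in p..q, tderiv v τ x = v q x - v p x :=
    intervalIntegral.integral_eq_sub_of_hasDerivAt (fun t _ => hv.hasDerivAt_time t x)
      (hv.tderiv.intervalIntegrable x p q)
  have e2 : Aop (prim v q) x - Aop (prim v p) x = ∫ τ in p..q, Aop (v τ) x := by
    rw [Aop_prim hv, Aop_prim hv]
    exact prim_sub hv.Aop p q x
  rw [Aop_const_mul c (hq.add hp'), Aop_add hq hp', Aop_const_mul (-1) hp,
    intervalIntegral.integral_add, intervalIntegral.integral_const_mul, e1, ← e2]
  · ring
  · exact (hv.tderiv.intervalIntegrable x p q).const_mul I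
  · exact hv.Aop.intervalIntegrable x p q

/-- Growth bound for an inhomogeneous linear flow; only `v` and the forcing are assumed bounded
in `L²`. -/
lemma L2norm_growth_forced {v : ℝ → E2 → ℂ} (hv : JS v) {a b M m : ℝ} (hab : a ≤ b)
    (hv2 : ∀ t ∈ Set.Icc a b, MemLp (v t) 2 ∧ L2norm (v t) ≤ M)
    (hF2 : ∀ t ∈ Set.Icc a b, MemLp (fun x => I * tderiv v t x + Aop (v t) x) 2 ∧
      L2norm (fun x => I * tderiv v t x + Aop (v t) x) ≤ m) :
    L2norm (v b) ≤ L2norm (v a) + m * (b - a) := by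
  have hM0 : 0 ≤ M := (L2norm_nonneg _).trans (hv2 a ⟨le_rfl, hab⟩).2
  have hm0 : 0 ≤ m := (L2norm_nonneg _).trans (hF2 a ⟨le_rfl, hab⟩).2
  set F : ℝ → E2 → ℂ := fun t x => I * tderiv v t x + Aop (v t) x with hF
  have hFJ : JS F := (hv.tderiv.const_mul I).add hv.Aop
  have hFint : ∀ p q, p ≤ q → a ≤ p → q ≤ b → MemLp (fun x => ∫ τ in p..q, F τ x) 2 ∧
      L2norm (fun x => ∫ τ in p..q, F τ x) ≤ (q - p) * m := fun p q hpq hp hq =>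
    memLp_intervalIntegral hFJ.continuous hpq fun t ht => hF2 t ⟨hp.trans ht.1, ht.2.trans hq⟩
  have hvint : ∀ p q, p ≤ q → a ≤ p → q ≤ b → MemLp (fun x => prim v q x + -1 * prim v p x) 2 ∧
      L2norm (fun x => prim v q x + -1 * prim v p x) ≤ (q - p) * M := fun p q hpq hp hq => by
    have e : (fun x => prim v q x + -1 * prim v p x) = fun x => ∫ τ in p..q, v τ x := by
      funext x; rw [← prim_sub hv]; ring
    rw [e]
    exact memLp_intervalIntegral hv.continuous hpq fun t ht => hv2 t ⟨hp.trans ht.1, ht.2.trans hq⟩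
  have hAint : ∀ (c : ℂ) p q, p ≤ q → a ≤ p → q ≤ b →
      MemLp (Aop fun x => c * (prim v q x + -1 * prim v p x)) 2 ∧
      L2norm (Aop fun x => c * (prim v q x + -1 * prim v p x)) ≤
        ‖c‖ * ((b - a) * m + (M + M)) := fun c p q hpq hp hq => by
    have hq' := hv2 q ⟨hp.trans hpq, hq⟩
    have hp' := hv2 p ⟨hp, hpq.trans hq⟩
    have e : (Aop fun x => c * (prim v q x + -1 * prim v p x)) =
        fun x => c * ((∫ τ in p..q, F τ x) - I * (v q x - v p x)) := by
      funext x; exact Aop_prim_sub hv c p q x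
    have hd : MemLp (fun x => v q x - v p x) 2 := hq'.1.sub hp'.1
    have hId : MemLp (fun x => I * (v q x - v p x)) 2 := hd.const_mul I
    have hi := hFint p q hpq hp hq
    rw [e]
    refine ⟨(hi.1.sub hId).const_mul c, ?_⟩
    rw [L2norm_const_mul]
    refine mul_le_mul_of_nonneg_left ?_ (norm_nonneg _)
    refine (L2norm_sub_le hi.1 hId).trans (add_le_add (hi.2.trans ?_) ?_)
    · exact mul_le_mul_of_nonneg_right (by linarith) hm0
    · rw [L2norm_const_mul, Complex.norm_I, one_mul]
      exact (L2norm_sub_le hq'.1 hp'.1).trans (add_le_add hq'.2 hp'.2)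
  have hstep1 : ∀ h, 0 ≤ h → a + h ≤ b →
      L2norm (fun x => prim v (a + h) x + -1 * prim v a x) ≤ (L2norm (v a) + h * m) * h := by
    intro h hh hhb
    have hconst : JS (fun _ x => prim v a x) :=
      ContDiff.comp (g := prim v a) (hv.prim.slice a) contDiff_snd
    have hVJ : JS (fun t x => 1 * (prim v t x + -1 * prim v a x)) :=
      (hv.prim.add (hconst.const_mul (-1))).const_mul 1
    have htd : ∀ t x, tderiv (fun t x => 1 * (prim v t x + -1 * prim v a x)) t x = v t x :=
      fun t x => (((hv.hasDerivAt_prim t x).add_const (-1 * prim v a x)).const_mul 1).deriv.trans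
        (one_mul _)
    have key := L2norm_growth hVJ (c := a) (d := a + h) (M := (b - a) * M)
      (K := ‖(1 : ℂ)‖ * ((b - a) * m + (M + M))) (m := L2norm (v a) + h * m) (by linarith)
      (fun t ht => ?_) (fun t ht => hAint 1 a t ht.1 le_rfl (ht.2.trans hhb)) (fun t ht => ?_)
    · simp only [one_mul] at key
      have h0 : L2norm (fun x => prim v a x + -1 * prim v a x) = 0 := by simp [L2norm]
      rw [h0] at key
      linarith
    · simp only [one_mul]
      have := hvint a t ht.1 le_rfl (ht.2.trans hhb)
      exact ⟨this.1, this.2.trans (mul_le_mul_of_nonneg_right (by linarith [ht.2]) hM0)⟩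
    · have e : (fun x => I * tderiv (fun t x => 1 * (prim v t x + -1 * prim v a x)) t x +
          Aop (fun x => 1 * (prim v t x + -1 * prim v a x)) x) =
          fun x => I * v a x + ∫ τ in a..t, F τ x := by
        funext x
        rw [htd, Aop_prim_sub hv 1 a t x]; ring
      have hi := hFint a t ht.1 le_rfl (ht.2.trans hhb)
      have ha := (hv2 a ⟨le_rfl, hab⟩).1.const_mul I
      rw [e]
      refine ⟨ha.add hi.1, (L2norm_add_le ha hi.1).trans (add_le_add ?_ ?_)⟩
      · rw [L2norm_const_mul]; simp
      · exact hi.2.trans (mul_le_mul_of_nonneg_right (by linarith [ht.2]) hm0)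
  have hstep2 : ∀ h, 0 < h → a + h ≤ b →
      MemLp (fun x => ((h⁻¹ : ℝ) : ℂ) * (prim v b x + -1 * prim v (b - h) x)) 2 ∧
      L2norm (fun x => ((h⁻¹ : ℝ) : ℂ) * (prim v b x + -1 * prim v (b - h) x)) ≤
        L2norm (v a) + m * (b - a) := by
    intro h hh hhb
    have hn : ‖((h⁻¹ : ℝ) : ℂ)‖ = h⁻¹ := by
      rw [Complex.norm_real, Real.norm_of_nonneg (inv_nonneg.2 hh.le)]
    have hshift : JS (fun t x => prim v (t + h) x) :=
      ContDiff.comp (g := fun p : ℝ × E2 => prim v p.1 p.2)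
        (f := fun p : ℝ × E2 => (p.1 + h, p.2)) hv.prim (by fun_prop)
    have hWJ : JS (fun t x => ((h⁻¹ : ℝ) : ℂ) * (prim v (t + h) x + -1 * prim v t x)) :=
      (hshift.add (hv.prim.const_mul (-1))).const_mul _
    have htd : ∀ t x, tderiv (fun t x => ((h⁻¹ : ℝ) : ℂ) * (prim v (t + h) x + -1 * prim v t x)) t x =
        ((h⁻¹ : ℝ) : ℂ) * (v (t + h) x + -1 * v t x) := fun t x =>
      ((((hv.hasDerivAt_prim (t + h) x).comp_add_const t h).add
        ((hv.hasDerivAt_prim t x).const_mul (-1))).const_mul _).deriv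
    have key := L2norm_growth hWJ (c := a) (d := b - h) (M := ‖((h⁻¹ : ℝ) : ℂ)‖ * (h * M))
      (K := ‖((h⁻¹ : ℝ) : ℂ)‖ * ((b - a) * m + (M + M))) (m := m) (by linarith)
      (fun t ht => ?_) (fun t ht => hAint _ t (t + h) (by linarith) ht.1 (by linarith [ht.2]))
      (fun t ht => ?_)
    · rw [sub_add_cancel] at key
      refine ⟨(hvint (b - h) b (by linarith) (by linarith) le_rfl).1.const_mul _, key.trans ?_⟩
      rw [L2norm_const_mul, hn]
      have h1 := hstep1 h hh.le hhb
      have h2 : h⁻¹ * L2norm (fun x => prim v (a + h) x + -1 * prim v a x) ≤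
          L2norm (v a) + h * m := by
        rw [inv_mul_le_iff₀ hh]; linarith
      linarith
    · have := hvint t (t + h) (by linarith) ht.1 (by linarith [ht.2])
      refine ⟨this.1.const_mul _, ?_⟩
      rw [L2norm_const_mul]
      refine mul_le_mul_of_nonneg_left (this.2.trans (by linarith)) (norm_nonneg _)
    · have e : (fun x => I * tderiv (fun t x => ((h⁻¹ : ℝ) : ℂ) *
          (prim v (t + h) x + -1 * prim v t x)) t x +
          Aop (fun x => ((h⁻¹ : ℝ) : ℂ) * (prim v (t + h) x + -1 * prim v t x)) x) =
          fun x => ((h⁻¹ : ℝ) : ℂ) * ∫ τ in t..(t + h), F τ x := by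
        funext x
        rw [htd, Aop_prim_sub hv _ t (t + h) x]; ring
      have hi := hFint t (t + h) (by linarith) ht.1 (by linarith [ht.2])
      rw [e]
      refine ⟨hi.1.const_mul _, ?_⟩
      rw [L2norm_const_mul, hn, inv_mul_le_iff₀ hh]
      linarith [hi.2]
  rcases hab.eq_or_lt with rfl | hlt
  · simp
  have hpos : ∀ n : ℕ, 0 < (b - a) * ((n : ℝ) + 1)⁻¹ := fun n => by
    have := sub_pos.2 hlt; positivity
  have hle : ∀ n : ℕ, a + (b - a) * ((n : ℝ) + 1)⁻¹ ≤ b := fun n => by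
    have : ((n : ℝ) + 1)⁻¹ ≤ 1 := inv_le_one_of_one_le₀ (by linarith [n.cast_nonneg (α := ℝ)])
    nlinarith [sub_pos.2 hlt]
  refine (memLp_of_tendsto_of_le (fun n => (hstep2 _ (hpos n) (hle n)).1)
    (fun n => (hstep2 _ (hpos n) (hle n)).2) tendsto_const_nhds fun x => ?_).2
  have hd := (hv.hasDerivAt_prim b x).tendsto_slope
  have hlim : Filter.Tendsto (fun n : ℕ => b - (b - a) * ((n : ℝ) + 1)⁻¹) Filter.atTop
      (nhdsWithin b {b}ᶜ) := by
    refine tendsto_nhdsWithin_iff.2 ⟨?_, Filter.Eventually.of_forall fun n => ?_⟩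
    · have h1 : Filter.Tendsto (fun n : ℕ => ((n : ℝ) + 1)⁻¹) Filter.atTop (nhds 0) :=
        tendsto_one_div_add_atTop_nhds_zero_nat.congr fun n => by simp
      simpa using (h1.const_mul (b - a)).const_sub b
    · have := hpos n
      simp only [Set.mem_compl_iff, Set.mem_singleton_iff]; linarith
  refine (hd.comp hlim).congr fun n => ?_
  simp only [Function.comp, slope_def_module, sub_sub_cancel_left, inv_neg, neg_smul]
  rw [Complex.real_smul]; ring

/-! ### Coercivity of the harmonic oscillator -/

lemma L2norm_add_sq {f g : E2 → ℂ} (hf : MemLp f 2) (hg : MemLp g 2) :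
    L2norm (fun x => f x + g x) ^ 2 =
      L2norm f ^ 2 + L2norm g ^ 2 + 2 * (∫ x, f x * (starRingEnd ℂ) (g x)).re := by
  have h1 := integrable_mul_conj hf hf
  have h2 := integrable_mul_conj hg hg
  have h3 := integrable_mul_conj hf hg
  have h4 := integrable_mul_conj hg hf
  have e : ∫ x, (f x + g x) * (starRingEnd ℂ) (f x + g x) =
      (∫ x, f x * (starRingEnd ℂ) (f x)) + (∫ x, g x * (starRingEnd ℂ) (g x)) +
      ((∫ x, f x * (starRingEnd ℂ) (g x)) + (∫ x, g x * (starRingEnd ℂ) (f x))) := by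
    have h12 : Integrable fun x => f x * (starRingEnd ℂ) (f x) + g x * (starRingEnd ℂ) (g x) :=
      h1.add h2
    have h34 : Integrable fun x => f x * (starRingEnd ℂ) (g x) + g x * (starRingEnd ℂ) (f x) :=
      h3.add h4
    rw [← integral_add h1 h2, ← integral_add h3 h4, ← integral_add h12 h34]
    congr 1 with x
    simp only [map_add]; ring
  have e2 : ∫ x, g x * (starRingEnd ℂ) (f x) =
      (starRingEnd ℂ) (∫ x, f x * (starRingEnd ℂ) (g x)) := by
    rw [← integral_conj]; congr 1 with x; simp [mul_comm]
  rw [integral_self_mul_conj (fun x => f x + g x), integral_self_mul_conj,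
    integral_self_mul_conj, e2] at e
  have := congrArg Complex.re e
  simp only [Complex.add_re, Complex.ofReal_re, Complex.conj_re] at this
  linarith

/-- `‖∇f‖²`. -/
def gradN (f : E2 → ℂ) : ℝ := ∑ i, L2norm (pd i f) ^ 2

/-- `‖x f‖²`. -/
def posN (f : E2 → ℂ) : ℝ := ∑ i : Fin 2, L2norm (fun x => ((x i : ℝ) : ℂ) * f x) ^ 2

lemma gradN_nonneg (f : E2 → ℂ) : 0 ≤ gradN f := Finset.sum_nonneg fun _ _ => sq_nonneg _
lemma posN_nonneg (f : E2 → ℂ) : 0 ≤ posN f := Finset.sum_nonneg fun _ _ => sq_nonneg _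

lemma IsS.integral_pd_pd {f g : E2 → ℂ} (hf : IsS f) (hg : IsS g) (i : Fin 2) :
    ∫ x, _root_.pd i (_root_.pd i f) x * (starRingEnd ℂ) (g x) =
      -∫ x, _root_.pd i f x * (starRingEnd ℂ) (_root_.pd i g x) := by
  have h := IsS.integral_mul_pd i hg.conj (hf.pd i)
  have e : ∫ x, _root_.pd i (_root_.pd i f) x * (starRingEnd ℂ) (g x) =
    ∫ x, (starRingEnd ℂ) (g x) * _root_.pd i (_root_.pd i f) x := by congr 1 with x; ring
  rw [e, h]
  congr 2 with x
  rw [pd_conj i hg.differentiable]; ring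

lemma IsS.integral_Aop {f g : E2 → ℂ} (hf : IsS f) (hg : IsS g) :
    ∫ x, _root_.Aop f x * (starRingEnd ℂ) (g x) =
      ∑ i, ((∫ x, _root_.pd i f x * (starRingEnd ℂ) (_root_.pd i g x)) +
        ∫ x, (((x i : ℝ) : ℂ) * f x) * (starRingEnd ℂ) (((x i : ℝ) : ℂ) * g x)) := by
  have h1 : ∀ i, Integrable fun x =>
      _root_.pd i (_root_.pd i f) x * (starRingEnd ℂ) (g x) := fun i =>
    (((hf.pd i).pd i).mul hg.conj).integrable
  have h2 : ∀ i : Fin 2, Integrable fun x : E2 =>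
      (((x i : ℝ) : ℂ) * f x) * (starRingEnd ℂ) (((x i : ℝ) : ℂ) * g x) := fun i =>
    ((hf.coord_mul i).mul (hg.coord_mul i).conj).integrable
  have h3 : ∀ i, ∫ x, _root_.pd i f x * (starRingEnd ℂ) (_root_.pd i g x) =
      -∫ x, _root_.pd i (_root_.pd i f) x * (starRingEnd ℂ) (g x) := fun i => by
    rw [hf.integral_pd_pd hg]; ring
  simp only [h3, ← integral_neg]
  have h4 : ∀ i, Integrable fun x =>
      -(_root_.pd i (_root_.pd i f) x * (starRingEnd ℂ) (g x)) := fun i => (h1 i).neg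
  have h5 : ∀ i : Fin 2, Integrable fun x : E2 =>
      -(_root_.pd i (_root_.pd i f) x * (starRingEnd ℂ) (g x)) +
      (((x i : ℝ) : ℂ) * f x) * (starRingEnd ℂ) (((x i : ℝ) : ℂ) * g x) := fun i =>
    (h4 i).add (h2 i)
  rw [Fin.sum_univ_two, ← integral_add (h4 0) (h2 0), ← integral_add (h4 1) (h2 1),
    ← integral_add (h5 0) (h5 1)]
  congr 1 with x
  simp only [_root_.Aop, _root_.lap, normSq_eq_coord, Fin.sum_univ_two, map_mul,
    Complex.conj_ofReal]
  ring

lemma IsS.form_eq {f : E2 → ℂ} (hf : IsS f) :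
    ∫ x, _root_.Aop f x * (starRingEnd ℂ) (f x) = ((gradN f + posN f : ℝ) : ℂ) := by
  rw [hf.integral_Aop hf]
  simp only [integral_self_mul_conj, integral_self_mul_conj (fun x : E2 => ((x _ : ℝ) : ℂ) * f x),
    gradN, posN, Finset.sum_add_distrib]
  push_cast
  rfl

lemma IsS.grad_add_pos_le {f : E2 → ℂ} (hf : IsS f) :
    gradN f + posN f ≤ L2norm (_root_.Aop f) * L2norm f := by
  have h := norm_integral_mul_conj_le (hf.Aop.memLp 2) (hf.memLp 2)
  rw [hf.form_eq, Complex.norm_real] at h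
  exact (le_abs_self _).trans h

lemma IsS.gradN_le {f : E2 → ℂ} (hf : IsS f) : gradN f ≤ L2norm (_root_.Aop f) * L2norm f := by
  linarith [hf.grad_add_pos_le, posN_nonneg f]

lemma IsS.posN_le {f : E2 → ℂ} (hf : IsS f) : posN f ≤ L2norm (_root_.Aop f) * L2norm f := by
  linarith [hf.grad_add_pos_le, gradN_nonneg f]

lemma IsS.pd_coord_mul {f : E2 → ℂ} (hf : IsS f) (i j : Fin 2) (x : E2) :
    _root_.pd i (fun x => ((x j : ℝ) : ℂ) * f x) x =
      (if i = j then 1 else 0) * f x + ((x j : ℝ) : ℂ) * _root_.pd i f x := by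
  rw [pd_mul i (differentiable_coord j) hf.differentiable, pd_coord]

lemma IsS.re_integral_pd_pd_le {f : E2 → ℂ} (hf : IsS f) (i j : Fin 2) :
    (∫ x, _root_.pd i (_root_.pd i f) x *
      (starRingEnd ℂ) (((x j : ℝ) : ℂ) * (((x j : ℝ) : ℂ) * f x))).re ≤
      (if i = j then 1 else 0) * L2norm f ^ 2 := by
  have hxf := hf.coord_mul j
  have hxp := (hf.pd i).coord_mul j
  set δ : ℝ := if i = j then 1 else 0 with hδ
  have hδc : ((if i = j then 1 else 0 : ℂ)) = (δ : ℂ) := by rw [hδ]; split_ifs <;> simp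
  have hδ2 : δ * δ = δ := by rw [hδ]; split_ifs <;> simp
  have hδ0 : 0 ≤ δ := by rw [hδ]; split_ifs <;> simp
  rw [hf.integral_pd_pd (hxf.coord_mul j)]
  have e : ∫ x, _root_.pd i f x * (starRingEnd ℂ)
      (_root_.pd i (fun x => ((x j : ℝ) : ℂ) * (((x j : ℝ) : ℂ) * f x)) x) =
      2 * δ * (∫ x, (((x j : ℝ) : ℂ) * _root_.pd i f x) * (starRingEnd ℂ) (f x)) +
      ((L2norm (fun x => ((x j : ℝ) : ℂ) * _root_.pd i f x) ^ 2 : ℝ) : ℂ) := by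
    rw [← integral_self_mul_conj, ← integral_const_mul, ← integral_add]
    · congr 1 with x
      rw [hxf.pd_coord_mul, hf.pd_coord_mul, hδc]
      simp only [map_mul, map_add, Complex.conj_ofReal]; ring
    · exact ((hxp.mul hf.conj).integrable).const_mul _
    · exact (hxp.mul hxp.conj).integrable
  have h2 := (Complex.abs_re_le_norm _).trans
    (norm_integral_mul_conj_le (hxp.memLp 2) (hf.memLp 2))
  have h3 := (abs_le.1 h2).1
  rw [e, Complex.neg_re, Complex.add_re, Complex.ofReal_re,
    show (2 * (δ : ℂ)) = ((2 * δ : ℝ) : ℂ) by push_cast; ring, Complex.re_ofReal_mul]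
  have h4 := mul_le_mul_of_nonneg_left h3 hδ0
  nlinarith [sq_nonneg (L2norm (fun x => ((x j : ℝ) : ℂ) * _root_.pd i f x) - δ * L2norm f)]

lemma IsS.lap_sq_le {f : E2 → ℂ} (hf : IsS f) :
    L2norm (_root_.lap f) ^ 2 ≤ L2norm (_root_.Aop f) ^ 2 + 4 * L2norm f ^ 2 := by
  have hx := hf.normSq_mul
  have h := L2norm_add_sq (hf.lap.neg.memLp 2) (hx.memLp 2)
  rw [show (fun x => -_root_.lap f x + (‖x‖ : ℂ) ^ 2 * f x) = _root_.Aop f from rfl,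
    L2norm_neg] at h
  have e : ∫ x, -_root_.lap f x * (starRingEnd ℂ) ((‖x‖ : ℂ) ^ 2 * f x) =
      -∑ i : Fin 2, ∑ j : Fin 2, ∫ x, _root_.pd i (_root_.pd i f) x *
        (starRingEnd ℂ) (((x j : ℝ) : ℂ) * (((x j : ℝ) : ℂ) * f x)) := by
    have hi : ∀ i j : Fin 2, Integrable fun x : E2 => _root_.pd i (_root_.pd i f) x *
        (starRingEnd ℂ) (((x j : ℝ) : ℂ) * (((x j : ℝ) : ℂ) * f x)) := fun i j =>
      (((hf.pd i).pd i).mul ((hf.coord_mul j).coord_mul j).conj).integrable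
    have e : ∀ i, ∑ j : Fin 2, ∫ x, _root_.pd i (_root_.pd i f) x *
        (starRingEnd ℂ) (((x j : ℝ) : ℂ) * (((x j : ℝ) : ℂ) * f x)) =
        ∫ x, ∑ j : Fin 2, _root_.pd i (_root_.pd i f) x *
        (starRingEnd ℂ) (((x j : ℝ) : ℂ) * (((x j : ℝ) : ℂ) * f x)) := fun i =>
      (integral_finsetSum _ fun j _ => hi i j).symm
    simp only [e]
    rw [← integral_finsetSum _ fun i _ => integrable_finsetSum _ fun j _ => hi i j, ← integral_neg]
    congr 1 with x
    simp only [_root_.lap, normSq_eq_coord, Fin.sum_univ_two, map_mul, map_add,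
      Complex.conj_ofReal]
    ring
  have h1 := fun i j => hf.re_integral_pd_pd_le i j
  rw [e] at h
  simp only [Complex.neg_re, Fin.sum_univ_two, Complex.add_re] at h
  have h00 := h1 0 0
  have h01 := h1 0 1
  have h10 := h1 1 0
  have h11 := h1 1 1
  simp only [if_true, one_mul, zero_ne_one, one_ne_zero, if_false, zero_mul] at h00 h01 h10 h11
  nlinarith [sq_nonneg (L2norm fun x => (‖x‖ : ℂ) ^ 2 * f x)]

/-! ### Propagation of local boundedness -/

open Filter Topology Set in
/-- `φ` is bounded above near `t`. -/
def LocBdd (φ : ℝ → ℝ) (t : ℝ) : Prop := ∃ C, ∀ᶠ s in 𝓝 t, φ s ≤ C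

open Filter Topology Set in
lemma isOpen_locBdd (φ : ℝ → ℝ) : IsOpen {t | LocBdd φ t} := by
  rw [isOpen_iff_mem_nhds]
  rintro t ⟨C, hC⟩
  filter_upwards [eventually_eventually_nhds.2 hC] with s hs
  exact ⟨C, hs⟩

open Filter Topology Set in
lemma LocBdd.bdd_Icc {φ : ℝ → ℝ} {a b : ℝ} (h : ∀ t ∈ Icc a b, LocBdd φ t) :
    ∃ C, ∀ t ∈ Icc a b, φ t ≤ C := by
  refine isCompact_Icc.induction_on (p := fun s => ∃ C, ∀ t ∈ s, φ t ≤ C) ⟨0, by simp⟩ ?_ ?_ ?_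
  · rintro s t hst ⟨C, hC⟩
    exact ⟨C, fun x hx => hC x (hst hx)⟩
  · rintro s t ⟨C, hC⟩ ⟨D, hD⟩
    exact ⟨max C D, fun x hx => hx.elim (fun h => (hC x h).trans (le_max_left _ _))
      fun h => (hD x h).trans (le_max_right _ _)⟩
  · intro t ht
    obtain ⟨C, hC⟩ := h t ht
    exact ⟨_, mem_nhdsWithin_of_mem_nhds hC, C, fun x hx => hx⟩

open Filter Topology Set in
lemma gap_right {Ω : Set ℝ} {φ : ℝ → ℝ} {N δ C p r t : ℝ}
    (hR : ∀ a b, a < b → b ≤ a + δ → Icc a b ⊆ Ω → φ a ≤ N →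
      (∀ t ∈ Ioo a b, LocBdd φ t) → ∀ t ∈ Ioo a b, φ t ≤ C)
    (hrδ : r ≤ δ) (hΩ : Ioo (p - r) (p + r) ⊆ Ω) (hp : ¬ LocBdd φ p)
    (hN : ∀ t ∈ Ioo (p - r) (p + r), ¬ LocBdd φ t → φ t ≤ N)
    (ht : LocBdd φ t) (hpt : p < t) (htr : t < p + r) : φ t ≤ C := by
  set K := {t | ¬ LocBdd φ t} ∩ Icc p t with hK
  have hKc : IsClosed K := (isOpen_locBdd φ).isClosed_compl.inter isClosed_Icc
  have hKn : K.Nonempty := ⟨p, hp, le_rfl, hpt.le⟩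
  have hKb : BddAbove K := ⟨t, fun x hx => hx.2.2⟩
  obtain ⟨haK, hpa, hat⟩ := hKc.csSup_mem hKn hKb
  set a := sSup K with ha
  have hat' : a < t := lt_of_le_of_ne hat fun h => haK (h ▸ ht)
  obtain ⟨b', hb', hb'2⟩ := exists_Ico_subset_of_mem_nhds ((isOpen_locBdd φ).mem_nhds ht)
    ⟨t + 1, by linarith⟩
  set b := min b' ((t + (p + r)) / 2) with hb
  have htb : t < b := lt_min hb' (by linarith)
  have hbr : b < p + r := (min_le_right _ _).trans_lt (by linarith)
  refine hR a b (hat'.trans htb) (by linarith) (fun x hx => hΩ ⟨?_, ?_⟩)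
    (hN a ⟨?_, ?_⟩ haK) (fun s hs => ?_) t ⟨hat', htb⟩
  · linarith [hx.1]
  · linarith [hx.2]
  · linarith
  · linarith
  · rcases lt_or_ge s t with h | h
    · by_contra hc
      exact absurd (le_csSup hKb ⟨hc, hpa.trans hs.1.le, h.le⟩) (not_le.2 hs.1)
    · exact hb'2 ⟨h, hs.2.trans_le (min_le_left _ _)⟩

open Filter Topology Set in
lemma LocBdd.comp_neg {φ : ℝ → ℝ} {t : ℝ} (h : LocBdd φ t) : LocBdd (fun s => φ (-s)) (-t) := by
  obtain ⟨C, hC⟩ := h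
  refine ⟨C, ?_⟩
  have : Tendsto (fun s : ℝ => -s) (𝓝 (-t)) (𝓝 t) := by
    simpa using (continuous_neg (G := ℝ)).tendsto (-t)
  exact this.eventually hC

open Filter Topology Set in
lemma LocBdd.of_comp_neg {φ : ℝ → ℝ} {t : ℝ} (h : LocBdd (fun s => φ (-s)) t) :
    LocBdd φ (-t) := by
  simpa using h.comp_neg

open Filter Topology Set in
/-- If a function is lower semicontinuous and every bound at an endpoint of a short gap of
local boundedness propagates into the gap, then the function is locally bounded. -/
theorem locBdd_of_gap {Ω : Set ℝ} (hΩ : IsOpen Ω) {φ : ℝ → ℝ}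
    (hlsc : ∀ N, ∀ t ∈ Ω, (∃ᶠ s in 𝓝 t, φ s ≤ N) → φ t ≤ N)
    (hR : ∀ N, ∃ δ > 0, ∃ C, ∀ a b, a < b → b ≤ a + δ → Icc a b ⊆ Ω → φ a ≤ N →
      (∀ t ∈ Ioo a b, LocBdd φ t) → ∀ t ∈ Ioo a b, φ t ≤ C)
    (hL : ∀ N, ∃ δ > 0, ∃ C, ∀ a b, a < b → b ≤ a + δ → Icc a b ⊆ Ω → φ b ≤ N →
      (∀ t ∈ Ioo a b, LocBdd φ t) → ∀ t ∈ Ioo a b, φ t ≤ C) :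
    ∀ t ∈ Ω, LocBdd φ t := by
  by_contra! hne
  obtain ⟨p0, hp0, hp0'⟩ := hne
  set K := Ω ∩ {t | ¬ LocBdd φ t} with hK
  have hKl : IsLocallyClosed K := hΩ.isLocallyClosed.inter
    (isOpen_locBdd φ).isClosed_compl.isLocallyClosed
  have : LocallyCompactSpace K := hKl.locallyCompactSpace
  have : Nonempty K := ⟨⟨p0, hp0, hp0'⟩⟩
  have hcl : ∀ n : ℕ, IsClosed {x : K | φ x ≤ n} := fun n => by
    refine isClosed_of_closure_subset fun x hx => ?_
    refine hlsc n x x.2.1 ?_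
    have := mem_closure_iff_frequently.1 hx
    exact (continuous_subtype_val.tendsto x).frequently this
  obtain ⟨n, ⟨p, hpK⟩, hp⟩ := nonempty_interior_of_iUnion_of_closed hcl
    (eq_univ_of_forall fun x => mem_iUnion.2 (exists_nat_ge (φ x)))
  rw [mem_interior_iff_mem_nhds, nhds_subtype_eq_comap, mem_comap] at hp
  obtain ⟨V, hV, hVs⟩ := hp
  obtain ⟨ε, hε, hεs⟩ := Metric.mem_nhds_iff.1 (inter_mem hV (hΩ.mem_nhds hpK.1))
  obtain ⟨δ, hδ, C, hC⟩ := hR n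
  obtain ⟨δ', hδ', C', hC'⟩ := hL n
  set r := min ε (min δ δ') with hr
  have hr0 : 0 < r := lt_min hε (lt_min hδ hδ')
  have hsub : Ioo (p - r) (p + r) ⊆ V ∩ Ω := by
    rw [← Real.ball_eq_Ioo]
    exact (Metric.ball_subset_ball (min_le_left _ _)).trans hεs
  have hN : ∀ t ∈ Ioo (p - r) (p + r), ¬ LocBdd φ t → φ t ≤ n := fun t ht hb =>
    hVs (a := ⟨t, (hsub ht).2, hb⟩) (hsub ht).1
  refine hpK.2 ⟨max n (max C C'), ?_⟩
  filter_upwards [Ioo_mem_nhds (show p - r < p by linarith) (show p < p + r by linarith)] with t ht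
  by_cases hb : LocBdd φ t
  · rcases lt_trichotomy t p with h | h | h
    · have hR' : ∀ a b, a < b → b ≤ a + δ' → Icc a b ⊆ -Ω → φ (-a) ≤ n →
          (∀ t ∈ Ioo a b, LocBdd (fun s => φ (-s)) t) → ∀ t ∈ Ioo a b, φ (-t) ≤ C' := by
        intro a b hab hb hs hn hl t ht
        refine hC' (-b) (-a) (by linarith) (by linarith) (fun x hx => ?_) hn (fun s hs => ?_) (-t)
          ⟨by linarith [ht.2], by linarith [ht.1]⟩
        · have := hs (a := -x) ⟨by linarith [hx.2], by linarith [hx.1]⟩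
          simpa using this
        · have := (hl (-s) ⟨by linarith [hs.2], by linarith [hs.1]⟩).of_comp_neg
          simpa using this
      have := gap_right (Ω := -Ω) (φ := fun s => φ (-s)) (p := -p) (r := r) (t := -t) hR'
        ((min_le_right _ _).trans (min_le_right _ _)) (fun x hx => ?_) (fun h => ?_)
        (fun s hs hb => ?_) hb.comp_neg (by linarith) (by linarith [ht.1])
      · simp only [neg_neg] at this
        exact this.trans ((le_max_right _ _).trans (le_max_right _ _))
      · exact (hsub (a := -x) ⟨by linarith [hx.2], by linarith [hx.1]⟩).2
      · exact hpK.2 (by simpa using h.of_comp_neg)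
      · exact hN (-s) ⟨by linarith [hs.2], by linarith [hs.1]⟩
          fun h => hb (by simpa using h.comp_neg)
    · exact absurd (h ▸ hb) hpK.2
    · exact (gap_right hC ((min_le_right _ _).trans (min_le_left _ _))
        (hsub.trans inter_subset_right) hpK.2 hN hb h ht.2).trans
        ((le_max_left _ _).trans (le_max_right _ _))
  · exact (hN t ht hb).trans (le_max_left _ _)

/-! ### Time regularity in `L²` -/

lemma tderiv_reverse {v : ℝ → E2 → ℂ} (hv : JS v) (t : ℝ) (x : E2) :
    tderiv (fun t x => v (-t) x) t x = -tderiv v (-t) x := by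
  have := (hv.hasDerivAt_time (-t) x).scomp t (hasDerivAt_neg t)
  rw [show tderiv (fun t x => v (-t) x) t x = _ from this.deriv]; simp

lemma JS.reverse {v : ℝ → E2 → ℂ} (hv : JS v) : JS (fun t x => v (-t) x) :=
  ContDiff.comp (f := fun p : ℝ × E2 => (-p.1, p.2)) hv (by fun_prop)

lemma Aop_conj {f : E2 → ℂ} (hf : ContDiff ℝ (⊤ : ℕ∞) f) (x : E2) :
    Aop (fun x => (starRingEnd ℂ) (f x)) x = (starRingEnd ℂ) (Aop f x) := by
  have hd : Differentiable ℝ f := hf.differentiable (by simp)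
  have h1 : ∀ i, pd i (fun x => (starRingEnd ℂ) (f x)) =
      fun x => (starRingEnd ℂ) (pd i f x) := fun i => by
    ext x; exact pd_conj i hd x
  have h2 : ∀ i, Differentiable ℝ (pd i f) := fun i =>
    ((hf.fderiv_right (m := (⊤ : ℕ∞)) (by simp)).clm_apply contDiff_const).differentiable (by simp)
  simp only [Aop, lap, h1, pd_conj _ (h2 _)]
  simp

/-- Backward-in-time version of `L2norm_growth_forced`. -/
lemma L2norm_growth_forced_rev {v : ℝ → E2 → ℂ} (hv : JS v) {a b M m : ℝ} (hab : a ≤ b)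
    (hv2 : ∀ t ∈ Set.Icc a b, MemLp (v t) 2 ∧ L2norm (v t) ≤ M)
    (hF2 : ∀ t ∈ Set.Icc a b, MemLp (fun x => I * tderiv v t x + Aop (v t) x) 2 ∧
      L2norm (fun x => I * tderiv v t x + Aop (v t) x) ≤ m) :
    L2norm (v a) ≤ L2norm (v b) + m * (b - a) := by
  have e : ∀ t x, I * tderiv (fun t x => (starRingEnd ℂ) (v (-t) x)) t x +
      Aop (fun x => (starRingEnd ℂ) (v (-t) x)) x =
      (starRingEnd ℂ) (I * tderiv v (-t) x + Aop (v (-t)) x) := fun t x => by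
    rw [tderiv_conj hv.reverse]
    beta_reduce
    rw [tderiv_reverse hv, Aop_conj (hv.slice _)]
    simp
  have hmem : ∀ t ∈ Set.Icc (-b) (-a), -t ∈ Set.Icc a b := fun t ht =>
    ⟨by linarith [ht.2], by linarith [ht.1]⟩
  have h := L2norm_growth_forced (v := fun t x => (starRingEnd ℂ) (v (-t) x)) hv.reverse.conj
    (a := -b) (b := -a) (M := M) (m := m) (by linarith)
    (fun t ht => ⟨(hv2 _ (hmem t ht)).1.star, by
      rw [L2norm_conj]; exact (hv2 _ (hmem t ht)).2⟩)
    (fun t ht => by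
      simp only [e, L2norm_conj]
      exact ⟨(hF2 _ (hmem t ht)).1.star, (hF2 _ (hmem t ht)).2⟩)
  simp only [L2norm_conj, neg_neg] at h
  linarith

/-- The `L²` norm of a forced solution is Lipschitz in time. -/
lemma abs_L2norm_sub_le_forced {v : ℝ → E2 → ℂ} (hv : JS v) {a b M m : ℝ} (hab : a ≤ b)
    (hv2 : ∀ t ∈ Set.Icc a b, MemLp (v t) 2 ∧ L2norm (v t) ≤ M)
    (hF2 : ∀ t ∈ Set.Icc a b, MemLp (fun x => I * tderiv v t x + Aop (v t) x) 2 ∧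
      L2norm (fun x => I * tderiv v t x + Aop (v t) x) ≤ m) :
    |L2norm (v b) - L2norm (v a)| ≤ m * (b - a) := by
  have h1 := L2norm_growth_forced hv hab hv2 hF2
  have h2 := L2norm_growth_forced_rev hv hab hv2 hF2
  rw [abs_le]
  constructor <;> linarith

/-- Over short intervals, a solution forced by a term of at most linear size is comparable
with its value at any time. -/
lemma L2norm_le_two_mul_add_one {v : ℝ → E2 → ℂ} (hv : JS v) {a b M D : ℝ} (hab : a ≤ b)
    (hD : 0 < D) (hδ : b ≤ a + 1 / (2 * D))
    (hv2 : ∀ t ∈ Set.Icc a b, MemLp (v t) 2 ∧ L2norm (v t) ≤ M)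
    (hF2 : ∀ t ∈ Set.Icc a b, MemLp (fun x => I * tderiv v t x + Aop (v t) x) 2 ∧
      L2norm (fun x => I * tderiv v t x + Aop (v t) x) ≤ D * (1 + L2norm (v t))) :
    ∀ s ∈ Set.Icc a b, ∀ t ∈ Set.Icc a b, L2norm (v t) ≤ 2 * L2norm (v s) + 1 := by
  intro s hs
  set W := (fun t => L2norm (v t)) '' Set.Icc a b with hW
  have hWb : BddAbove W := ⟨M, by rintro _ ⟨t, ht, rfl⟩; exact (hv2 t ht).2⟩
  have hWn : W.Nonempty := ⟨_, a, ⟨le_rfl, hab⟩, rfl⟩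
  have hle : ∀ t ∈ Set.Icc a b, L2norm (v t) ≤ sSup W := fun t ht =>
    le_csSup hWb ⟨t, ht, rfl⟩
  have hS0 : 0 ≤ sSup W := (L2norm_nonneg _).trans (hle s hs)
  have hδ' : D * (b - a) ≤ 1 / 2 := by
    calc D * (b - a) ≤ D * (1 / (2 * D)) := by gcongr; linarith
      _ = 1 / 2 := by field_simp
  have key : ∀ t ∈ Set.Icc a b, L2norm (v t) ≤ L2norm (v s) + (1 + sSup W) / 2 := by
    intro t ht
    have hsub : ∀ p q, p ∈ Set.Icc a b → q ∈ Set.Icc a b → p ≤ q →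
        |L2norm (v q) - L2norm (v p)| ≤ (1 + sSup W) / 2 := fun p q hp hq hpq => by
      have hin : ∀ t ∈ Set.Icc p q, t ∈ Set.Icc a b := fun t ht =>
        ⟨hp.1.trans ht.1, ht.2.trans hq.2⟩
      refine (abs_L2norm_sub_le_forced hv hpq (fun t ht => hv2 t (hin t ht)) (m := D * (1 + sSup W))
        fun t ht => ⟨(hF2 t (hin t ht)).1, (hF2 t (hin t ht)).2.trans ?_⟩).trans ?_
      · have := hle t (hin t ht)
        gcongr
      · calc D * (1 + sSup W) * (q - p) ≤ D * (1 + sSup W) * (b - a) := by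
              gcongr
              exacts [hq.2, hp.1]
          _ = (D * (b - a)) * (1 + sSup W) := by ring
          _ ≤ 1 / 2 * (1 + sSup W) := by gcongr
          _ = _ := by ring
    rcases le_total s t with h | h
    · linarith [(abs_le.1 (hsub s t hs ht h)).2]
    · linarith [(abs_le.1 (hsub t s ht hs h)).1]
  have hS : sSup W ≤ L2norm (v s) + (1 + sSup W) / 2 :=
    csSup_le hWn (by rintro _ ⟨t, ht, rfl⟩; exact key t ht)
  intro t ht
  linarith [hle t ht]

/-- Lower semicontinuity of `L²` norms along continuous families. -/
lemma L2norm_le_of_frequently {F : ℝ → E2 → ℂ} (hF : JS F) (hF2 : ∀ t, MemLp (F t) 2) {N t : ℝ}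
    (h : ∃ᶠ s in nhds t, L2norm (F s) ≤ N) : L2norm (F t) ≤ N := by
  obtain ⟨s, hs, hsN⟩ := Filter.exists_seq_forall_of_frequently h
  exact (memLp_of_tendsto_of_le (fun n => hF2 (s n)) hsN tendsto_const_nhds
    fun x => ((hF.slice_time x).continuous.tendsto t).comp hs).2

lemma L2norm_sub_le_of_tderiv {V : ℝ → E2 → ℂ} (hV : JS V) {a b M : ℝ} (hab : a ≤ b)
    (h : ∀ t ∈ Set.Icc a b, MemLp (tderiv V t) 2 ∧ L2norm (tderiv V t) ≤ M) :
    L2norm (fun x => V b x - V a x) ≤ M * (b - a) := by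
  have e : ∀ x, ∫ t in a..b, tderiv V t x = V b x - V a x := fun x =>
    intervalIntegral.integral_eq_sub_of_hasDerivAt (f := fun t => V t x)
      (fun t _ => hV.tderiv_eq t x ▸ hV.hasDerivAt_time t x)
      ((hV.tderiv.slice_time x).continuous.intervalIntegrable a b)
  have := (memLp_intervalIntegral hV.tderiv.continuous hab h).2
  simp only [e] at this
  linarith

lemma L2norm_sub_comm (f g : E2 → ℂ) :
    L2norm (fun x => f x - g x) = L2norm (fun x => g x - f x) := by
  rw [← L2norm_neg]; simp

lemma L2norm_taylor_le {F : ℝ → E2 → ℂ} (hF : Reg F) (hF1 : Reg (tderiv F))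
    (hF2 : Reg (tderiv (tderiv F))) {t s M : ℝ}
    (h : ∀ τ ∈ Set.uIcc t s, L2norm (tderiv (tderiv F) τ) ≤ M) :
    L2norm (fun x => F s x - F t x - ((s - t : ℝ) : ℂ) * tderiv F t x) ≤ M * (s - t) ^ 2 := by
  have hM : 0 ≤ M := (L2norm_nonneg _).trans (h t Set.left_mem_uIcc)
  have h1 : ∀ τ ∈ Set.uIcc t s, L2norm (fun x => tderiv F τ x - tderiv F t x) ≤ M * |s - t| := by
    intro τ hτ
    have hsub : ∀ r ∈ Set.uIcc t τ, L2norm (tderiv (tderiv F) r) ≤ M := fun r hr =>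
      h r (Set.uIcc_subset_uIcc_left hτ hr)
    have hle : |τ - t| ≤ |s - t| := Set.abs_sub_left_of_mem_uIcc hτ
    refine le_trans ?_ (mul_le_mul_of_nonneg_left hle hM)
    rcases le_total t τ with hh | hh
    · rw [abs_of_nonneg (by linarith)]
      exact L2norm_sub_le_of_tderiv hF1.js hh fun r hr => ⟨(hF2.sch r).memLp 2, hsub r (by
        rwa [Set.uIcc_of_le hh])⟩
    · rw [abs_of_nonpos (by linarith), L2norm_sub_comm, neg_sub]
      exact L2norm_sub_le_of_tderiv hF1.js hh fun r hr => ⟨(hF2.sch r).memLp 2, hsub r (by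
        rwa [Set.uIcc_of_ge hh])⟩
  set V : ℝ → E2 → ℂ := fun r x => F r x + -(((r : ℝ) : ℂ) * tderiv F t x) with hVdef
  have hc : JS (fun _ x => tderiv F t x) :=
    ContDiff.comp (g := tderiv F t) (hF1.js.slice t) contDiff_snd
  have hr : JS (fun r _ => ((r : ℝ) : ℂ)) :=
    Complex.ofRealCLM.contDiff.comp contDiff_fst
  have hVJ : JS V := by
    have := hF.js.add ((hr.mul hc).const_mul (-1))
    simpa only [neg_one_mul] using this
  have e : ∀ r, tderiv V r = fun x => tderiv F r x - tderiv F t x := fun r => by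
    ext x
    have h1 := (hF.js.hasDerivAt_time r x)
    have h2 : HasDerivAt (fun r : ℝ => ((r : ℝ) : ℂ) * tderiv F t x) (1 * tderiv F t x) r :=
      (Complex.ofRealCLM.hasDerivAt (x := r)).mul_const _
    rw [show tderiv V r x = _ from (h1.add h2.neg).deriv]; ring
  have hm : ∀ r, MemLp (tderiv V r) 2 := fun r => by
    rw [e]; exact ((hF1.sch r).memLp 2).sub ((hF1.sch t).memLp 2)
  have e2 : (fun x => F s x - F t x - ((s - t : ℝ) : ℂ) * tderiv F t x) =
      fun x => V s x - V t x := by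
    ext x; simp only [hVdef]; push_cast; ring
  rw [e2, ← sq_abs, sq, ← mul_assoc]
  rcases le_total t s with hh | hh
  · rw [abs_of_nonneg (by linarith : (0 : ℝ) ≤ s - t)] at h1 ⊢
    exact L2norm_sub_le_of_tderiv hVJ hh fun r hr => ⟨hm r, by
      rw [e]; exact h1 r (by rwa [Set.uIcc_of_le hh])⟩
  · rw [abs_of_nonpos (by linarith : s - t ≤ (0 : ℝ)), neg_sub] at h1 ⊢
    rw [L2norm_sub_comm]
    exact L2norm_sub_le_of_tderiv hVJ hh fun r hr => ⟨hm r, by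
      rw [e]; exact h1 r (by rwa [Set.uIcc_of_ge hh])⟩

open Filter Topology in
lemma hasDerivAt_toLp {F : ℝ → E2 → ℂ} (hF : Reg F) (hF1 : Reg (tderiv F))
    (hF2 : Reg (tderiv (tderiv F))) {t : ℝ}
    (h : LocBdd (fun s => L2norm (tderiv (tderiv F) s)) t) :
    HasDerivAt (fun s => ((hF.sch s).memLp 2).toLp (F s)) (((hF1.sch t).memLp 2).toLp (tderiv F t))
      t := by
  obtain ⟨M, hM⟩ := h
  obtain ⟨ε, hε, hεM⟩ := Metric.eventually_nhds_iff_ball.1 hM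
  rw [hasDerivAt_iff_isLittleO]
  refine Asymptotics.IsBigO.trans_isLittleO (g := fun s => (s - t) ^ 2) ?_ ?_
  · refine Asymptotics.IsBigO.of_bound M ?_
    filter_upwards [Metric.ball_mem_nhds t hε] with s hs
    have hm : MemLp (fun x => F s x - F t x - ((s - t : ℝ) : ℂ) * tderiv F t x) 2 :=
      (((hF.sch s).memLp 2).sub ((hF.sch t).memLp 2)).sub (((hF1.sch t).memLp 2).const_mul _)
    have e : ((hF.sch s).memLp 2).toLp (F s) - ((hF.sch t).memLp 2).toLp (F t) -
        (s - t) • ((hF1.sch t).memLp 2).toLp (tderiv F t) = hm.toLp _ := by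
      rw [← MemLp.toLp_sub, ← MemLp.toLp_const_smul, ← MemLp.toLp_sub]
      congr 1
    rw [e, Lp.norm_toLp, ← L2norm_eq_toReal hm, Real.norm_of_nonneg (by positivity)]
    refine L2norm_taylor_le hF hF1 hF2 fun τ hτ => hεM τ ?_
    exact ((convex_ball t ε).ordConnected.uIcc_subset (Metric.mem_ball_self hε) hs) hτ
  · simpa [sq_abs] using Asymptotics.isLittleO_pow_sub_sub t (m := 2) (by norm_num)

/-- Differentiation of `L²` inner products in time. -/
lemma hasDerivAt_integral_mul_conj {F G : ℝ → E2 → ℂ} (hF : Reg F) (hF1 : Reg (tderiv F))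
    (hF2 : Reg (tderiv (tderiv F))) (hG : Reg G) (hG1 : Reg (tderiv G))
    (hG2 : Reg (tderiv (tderiv G))) {t : ℝ}
    (hbF : LocBdd (fun s => L2norm (tderiv (tderiv F) s)) t)
    (hbG : LocBdd (fun s => L2norm (tderiv (tderiv G) s)) t) :
    HasDerivAt (fun s => ∫ x, F s x * (starRingEnd ℂ) (G s x))
      ((∫ x, tderiv F t x * (starRingEnd ℂ) (G t x)) +
        ∫ x, F t x * (starRingEnd ℂ) (tderiv G t x)) t := by
  have key : ∀ {f g : E2 → ℂ} (hf : MemLp f 2) (hg : MemLp g 2),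
      inner ℂ (hg.toLp g) (hf.toLp f) = ∫ x, f x * (starRingEnd ℂ) (g x) := by
    intro f g hf hg
    rw [L2.inner_def]
    refine integral_congr_ae ?_
    filter_upwards [hf.coeFn_toLp, hg.coeFn_toLp] with x h1 h2
    rw [h1, h2]; rfl
  have h := (hasDerivAt_toLp hG hG1 hG2 hbG).inner ℂ (hasDerivAt_toLp hF hF1 hF2 hbF)
  simp only [key] at h
  exact h

/-! ### A Brezis–Gallouet inequality -/

open FourierTransform LineDeriv in
lemma fourier_pd (g : SchwartzMap E2 ℂ) (i : Fin 2) (ξ : E2) :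
    (𝓕 (∂_{(EuclideanSpace.single i 1 : E2)} g) : SchwartzMap E2 ℂ) ξ =
      2 * Real.pi * I * (((ξ i : ℝ) : ℂ) * (𝓕 g : SchwartzMap E2 ℂ) ξ) := by
  rw [SchwartzMap.fourier_lineDerivOp_eq, smul_apply,
    SchwartzMap.smulLeftCLM_apply_apply (by fun_prop)]
  simp [EuclideanSpace.inner_single_right, Complex.real_smul]

open FourierTransform LineDeriv in
lemma coe_lineDerivOp_eq_pd (g : SchwartzMap E2 ℂ) (i : Fin 2) :
    ⇑(∂_{(EuclideanSpace.single i 1 : E2)} g : SchwartzMap E2 ℂ) = pd i g := by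
  ext x
  rw [SchwartzMap.lineDerivOp_apply_eq_fderiv]; rfl

open FourierTransform LineDeriv in
lemma L2norm_fourier (g : SchwartzMap E2 ℂ) : L2norm (𝓕 g : SchwartzMap E2 ℂ) = L2norm g := by
  rw [L2norm, L2norm, SchwartzMap.integral_norm_sq_fourier]

open FourierTransform LineDeriv in
lemma IsS.exists_fourier {f : E2 → ℂ} (hf : IsS f) : ∃ h : E2 → ℂ, IsS h ∧
    (∀ x, ‖f x‖ ≤ ∫ ξ, ‖h ξ‖) ∧ L2norm h = L2norm f ∧ posN h ≤ gradN f ∧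
    L2norm (fun ξ => (‖ξ‖ : ℂ) ^ 2 * h ξ) ≤ L2norm (_root_.lap f) := by
  obtain ⟨g, rfl⟩ := hf
  have hpi : 1 ≤ 2 * Real.pi := by linarith [Real.pi_gt_three]
  have hn : ‖(2 * Real.pi * I : ℂ)‖ = 2 * Real.pi := by
    rw [show (2 * Real.pi * I : ℂ) = ((2 * Real.pi : ℝ) : ℂ) * I by push_cast; ring, norm_mul,
      Complex.norm_real, norm_I, mul_one, Real.norm_of_nonneg (by positivity)]
  refine ⟨(𝓕 g : SchwartzMap E2 ℂ), ⟨_, rfl⟩, fun x => ?_, L2norm_fourier g, ?_, ?_⟩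
  · have e : g x = 𝓕⁻ (⇑(𝓕 g : SchwartzMap E2 ℂ)) x := by
      rw [← SchwartzMap.fourierInv_coe, fourierInv_fourier_eq]
    rw [e, Real.fourierInv_eq]
    refine (norm_integral_le_integral_norm _).trans_eq ?_
    congr 1 with ξ
    simp
  · refine Finset.sum_le_sum fun i _ => ?_
    have h := L2norm_fourier (∂_{(EuclideanSpace.single i 1 : E2)} g)
    rw [coe_lineDerivOp_eq_pd] at h
    rw [← h, show ⇑(𝓕 (∂_{(EuclideanSpace.single i 1 : E2)} g) : SchwartzMap E2 ℂ) = _ from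
      funext (fourier_pd g i), L2norm_const_mul, hn]
    exact pow_le_pow_left₀ (L2norm_nonneg _) (le_mul_of_one_le_left (L2norm_nonneg _) hpi) 2
  · have h := L2norm_fourier (∑ i : Fin 2, ∂_{(EuclideanSpace.single i 1 : E2)}
      (∂_{(EuclideanSpace.single i 1 : E2)} g))
    have e1 : ⇑(∑ i : Fin 2, ∂_{(EuclideanSpace.single i 1 : E2)}
      (∂_{(EuclideanSpace.single i 1 : E2)} g) : SchwartzMap E2 ℂ) = _root_.lap g := by
      ext x
      simp only [Fin.sum_univ_two, add_apply, coe_lineDerivOp_eq_pd, _root_.lap]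
    have e2 : ⇑(𝓕 (∑ i : Fin 2, ∂_{(EuclideanSpace.single i 1 : E2)}
      (∂_{(EuclideanSpace.single i 1 : E2)} g)) : SchwartzMap E2 ℂ) =
      fun ξ => (-(2 * Real.pi) ^ 2 : ℂ) * ((‖ξ‖ : ℂ) ^ 2 * (𝓕 g : SchwartzMap E2 ℂ) ξ) := by
      ext ξ
      simp only [Fin.sum_univ_two, FourierTransform.fourier_add, add_apply, fourier_pd,
        normSq_eq_coord]
      linear_combination (4 * Real.pi ^ 2 * ((ξ 0 : ℂ) * ξ 0 + ξ 1 * ξ 1) *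
        (𝓕 g : SchwartzMap E2 ℂ) ξ) * I_sq
    rw [e1, e2, L2norm_const_mul] at h
    rw [← h]
    refine le_mul_of_one_le_left (L2norm_nonneg _) ?_
    rw [norm_neg, norm_pow, show (2 * Real.pi : ℂ) = ((2 * Real.pi : ℝ) : ℂ) by push_cast; ring,
      Complex.norm_real, Real.norm_of_nonneg (by positivity)]
    exact one_le_pow₀ hpi


open Filter Topology in
lemma log_weight_integral {ε : ℝ} (h0 : 0 < ε) (h1 : ε ≤ 1 / 2) :
    IntegrableOn (fun y : ℝ => y * (1 / ((1 + y ^ 2) * (1 + ε * y ^ 2)))) (Set.Ioi 0) ∧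
    ∫ y in Set.Ioi (0 : ℝ), y * (1 / ((1 + y ^ 2) * (1 + ε * y ^ 2))) ≤ Real.log (1 / ε) := by
  set L : ℝ → ℝ := fun y => (Real.log (1 + y ^ 2) - Real.log (1 + ε * y ^ 2)) / (2 * (1 - ε)) with hL
  have hp : ∀ y : ℝ, 0 < 1 + y ^ 2 := fun y => by positivity
  have hq : ∀ y : ℝ, 0 < 1 + ε * y ^ 2 := fun y => by positivity
  have hd : ∀ y : ℝ, HasDerivAt L (y * (1 / ((1 + y ^ 2) * (1 + ε * y ^ 2)))) y := fun y => by
    have a1 := ((((hasDerivAt_id y).pow 2).const_add 1).log (hp y).ne')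
    have a2 := (((((hasDerivAt_id y).pow 2).const_mul ε).const_add 1).log (hq y).ne')
    have := (a1.sub a2).div_const (2 * (1 - ε))
    suffices e : y * (1 / ((1 + y ^ 2) * (1 + ε * y ^ 2))) =
        ((2 : ℕ) * id y ^ (2 - 1) * 1 / (1 + id y ^ 2) -
          ε * ((2 : ℕ) * id y ^ (2 - 1) * 1) / (1 + ε * id y ^ 2)) / (2 * (1 - ε)) by
      rw [e]; exact this
    have h2 : 1 - ε ≠ 0 := by linarith
    have := (hp y).ne'
    have := (hq y).ne'
    simp only [id]
    field_simp
    push_cast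
    ring
  have hlim : Tendsto L atTop (𝓝 (Real.log (1 / ε) / (2 * (1 - ε)))) := by
    have e : L = fun y => Real.log (1 / ε - (1 / ε - 1) / (1 + ε * y ^ 2)) / (2 * (1 - ε)) := by
      ext y
      rw [hL]
      beta_reduce
      rw [← Real.log_div (hp y).ne' (hq y).ne']
      congr 2
      have := (hq y).ne'
      field_simp
      ring
    rw [e]
    refine (Tendsto.log ?_ (by positivity)).div_const _
    have : Tendsto (fun y : ℝ => (1 / ε - 1) / (1 + ε * y ^ 2)) atTop (𝓝 0) :=
      Tendsto.div_atTop tendsto_const_nhds (tendsto_atTop_add_const_left _ _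
        ((tendsto_pow_atTop (by norm_num)).const_mul_atTop h0))
    simpa using tendsto_const_nhds.sub this
  have hnn : ∀ y ∈ Set.Ioi (0 : ℝ), 0 ≤ y * (1 / ((1 + y ^ 2) * (1 + ε * y ^ 2))) := fun y hy => by
    have := hp y; have := hq y; have : 0 < y := hy
    positivity
  refine ⟨integrableOn_Ioi_deriv_of_nonneg (hd 0).continuousAt.continuousWithinAt
    (fun y _ => hd y) hnn hlim, ?_⟩
  rw [integral_Ioi_of_hasDerivAt_of_nonneg (hd 0).continuousAt.continuousWithinAt
    (fun y _ => hd y) hnn hlim]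
  have hlog : 0 ≤ Real.log (1 / ε) := Real.log_nonneg (by
    rw [le_div_iff₀ h0]; linarith)
  simp only [hL]
  norm_num
  rw [← Real.log_inv, ← one_div]
  exact div_le_self hlog (by linarith)

lemma weight_integral : ∃ C > 0, ∀ ε : ℝ, 0 < ε → ε ≤ 1 / 2 →
    Integrable (fun x : E2 => 1 / ((1 + ‖x‖ ^ 2) * (1 + ε * ‖x‖ ^ 2))) ∧
    ∫ x : E2, 1 / ((1 + ‖x‖ ^ 2) * (1 + ε * ‖x‖ ^ 2)) ≤ C * Real.log (1 / ε) := by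
  refine ⟨2 * volume.real (Metric.ball (0 : E2) 1), mul_pos two_pos
    (ENNReal.toReal_pos (Metric.measure_ball_pos _ _ one_pos).ne' measure_ball_lt_top.ne),
    fun ε h0 h1 => ?_⟩
  obtain ⟨hi, hle⟩ := log_weight_integral h0 h1
  constructor
  · refine (integrable_fun_norm_addHaar (volume : Measure E2)
      (f := fun y => 1 / ((1 + y ^ 2) * (1 + ε * y ^ 2)))).2 ?_
    simpa using hi
  · rw [integral_fun_norm_addHaar (volume : Measure E2)
      (fun y => 1 / ((1 + y ^ 2) * (1 + ε * y ^ 2)))]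
    simp only [finrank_euclideanSpace, Fintype.card_fin, nsmul_eq_mul, smul_eq_mul,
      Nat.add_one_sub_one, pow_one]
    rw [mul_assoc]
    push_cast
    gcongr

lemma IsS.integral_norm_le : ∃ C > 0, ∀ ε : ℝ, 0 < ε → ε ≤ 1 / 2 → ∀ h : E2 → ℂ, IsS h →
    (∫ ξ, ‖h ξ‖) ^ 2 ≤ C * Real.log (1 / ε) *
      (L2norm h ^ 2 + (1 + ε) * posN h + ε * L2norm (fun ξ => (‖ξ‖ : ℂ) ^ 2 * h ξ) ^ 2) := by
  obtain ⟨C, hC, hCw⟩ := weight_integral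
  refine ⟨C, hC, fun ε h0 h1 h hh => ?_⟩
  obtain ⟨hi, hle⟩ := hCw ε h0 h1
  set w : E2 → ℝ := fun x => (1 + ‖x‖ ^ 2) * (1 + ε * ‖x‖ ^ 2) with hw
  have hwp : ∀ x, 0 < w x := fun x => by positivity
  have hwc : Continuous w := by fun_prop
  have i1 := MemLp.integrable_sq_norm (hh.memLp 2)
  have i2 : ∀ i : Fin 2, Integrable fun x : E2 => ‖((x i : ℝ) : ℂ) * h x‖ ^ 2 := fun i =>
    MemLp.integrable_sq_norm ((hh.coord_mul i).memLp 2)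
  have i3 := MemLp.integrable_sq_norm (hh.normSq_mul.memLp 2)
  have ew : ∀ x, w x * ‖h x‖ ^ 2 = ‖h x‖ ^ 2 + (1 + ε) * (‖((x 0 : ℝ) : ℂ) * h x‖ ^ 2 +
      ‖((x 1 : ℝ) : ℂ) * h x‖ ^ 2) + ε * ‖(‖x‖ : ℂ) ^ 2 * h x‖ ^ 2 := fun x => by
    have hx : ‖x‖ ^ 2 = x 0 ^ 2 + x 1 ^ 2 := by
      rw [EuclideanSpace.norm_sq_eq]; simp
    simp only [norm_mul, norm_pow, Complex.norm_real, mul_pow, Real.norm_eq_abs, sq_abs, hw,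
      abs_norm]
    linear_combination ((1 + ε) * ‖h x‖ ^ 2) * hx
  have i12 : Integrable fun x : E2 => ‖((x 0 : ℝ) : ℂ) * h x‖ ^ 2 +
      ‖((x 1 : ℝ) : ℂ) * h x‖ ^ 2 := (i2 0).add (i2 1)
  have i4 : Integrable fun x : E2 => ‖h x‖ ^ 2 + (1 + ε) * (‖((x 0 : ℝ) : ℂ) * h x‖ ^ 2 +
      ‖((x 1 : ℝ) : ℂ) * h x‖ ^ 2) := i1.add (i12.const_mul _)
  have iw : Integrable fun x => w x * ‖h x‖ ^ 2 := by
    simp only [ew]; exact i4.add (i3.const_mul _)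
  have eint : ∫ x, w x * ‖h x‖ ^ 2 = L2norm h ^ 2 + (1 + ε) * posN h +
      ε * L2norm (fun ξ => (‖ξ‖ : ℂ) ^ 2 * h ξ) ^ 2 := by
    simp only [ew, posN, Fin.sum_univ_two, L2norm_sq]
    rw [integral_add i4 (i3.const_mul _), integral_add i1 (i12.const_mul _), integral_const_mul,
      integral_const_mul, integral_add (i2 0) (i2 1)]
  have hcs := integral_mul_le_Lp_mul_Lq_of_nonneg (μ := (volume : Measure E2))
    Real.HolderConjugate.two_two (f := fun x => √(1 / w x)) (g := fun x => √(w x) * ‖h x‖)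
    (Filter.Eventually.of_forall fun x => Real.sqrt_nonneg _)
    (Filter.Eventually.of_forall fun x => by positivity)
    (by
      rw [ENNReal.ofReal_ofNat]
      refine (memLp_two_iff_integrable_sq (by
        exact (Continuous.sqrt (continuous_const.div hwc fun x => (hwp x).ne')).aestronglyMeasurable)).2 ?_
      refine hi.congr (Filter.Eventually.of_forall fun x => ?_)
      exact (Real.sq_sqrt (by have := hwp x; positivity)).symm)
    (by
      rw [ENNReal.ofReal_ofNat]
      refine (memLp_two_iff_integrable_sq (by
        exact ((Continuous.sqrt hwc).mul hh.continuous.norm).aestronglyMeasurable)).2 ?_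
      refine iw.congr (Filter.Eventually.of_forall fun x => ?_)
      simp only [mul_pow, Real.sq_sqrt (hwp x).le])
  have e1 : ∀ x, √(1 / w x) * (√(w x) * ‖h x‖) = ‖h x‖ := fun x => by
    rw [← mul_assoc, ← Real.sqrt_mul (by have := hwp x; positivity),
      one_div_mul_cancel (hwp x).ne', Real.sqrt_one, one_mul]
  simp only [e1, Real.rpow_two, mul_pow, ← Real.sqrt_eq_rpow] at hcs
  simp only [fun x => Real.sq_sqrt (hwp x).le,
    fun x => Real.sq_sqrt (show 0 ≤ 1 / w x by have := hwp x; positivity), eint] at hcs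
  have hi0 : 0 ≤ ∫ x, 1 / w x := integral_nonneg fun x => by have := hwp x; positivity
  have hT : 0 ≤ L2norm h ^ 2 + (1 + ε) * posN h +
      ε * L2norm (fun ξ => (‖ξ‖ : ℂ) ^ 2 * h ξ) ^ 2 := by
    have := posN_nonneg h; positivity
  calc (∫ ξ, ‖h ξ‖) ^ 2 ≤ (√(∫ x, 1 / w x) * √(_)) ^ 2 :=
        pow_le_pow_left₀ (integral_nonneg fun _ => norm_nonneg _) hcs 2
    _ = (∫ x, 1 / w x) * _ := by rw [mul_pow, Real.sq_sqrt hi0, Real.sq_sqrt hT]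
    _ ≤ _ := mul_le_mul_of_nonneg_right hle hT


lemma brezis_gallouet : ∃ C > 0, ∀ ε : ℝ, 0 < ε → ε ≤ 1 / 2 → ∀ f : E2 → ℂ, IsS f → ∀ x,
    ‖f x‖ ^ 2 ≤ C * Real.log (1 / ε) *
      (L2norm f ^ 2 + (1 + ε) * gradN f + ε * L2norm (lap f) ^ 2) := by
  obtain ⟨C, hC, h⟩ := IsS.integral_norm_le
  refine ⟨C, hC, fun ε h0 h1 f hf x => ?_⟩
  obtain ⟨g, hg, hx, e1, e2, e3⟩ := hf.exists_fourier
  have hlog : 0 ≤ Real.log (1 / ε) := Real.log_nonneg (by rw [le_div_iff₀ h0]; linarith)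
  refine (pow_le_pow_left₀ (norm_nonneg _) (hx x) 2).trans ((h ε h0 h1 g hg).trans ?_)
  rw [e1]
  have := L2norm_nonneg (fun ξ => (‖ξ‖ : ℂ) ^ 2 * g ξ)
  gcongr

lemma IsS.two_mul_L2norm_le {f : E2 → ℂ} (hf : IsS f) : 2 * L2norm f ≤ L2norm (_root_.Aop f) := by
  have key : ∀ i : Fin 2, L2norm f ^ 2 ≤
      L2norm (_root_.pd i f) ^ 2 + L2norm (fun x => ((x i : ℝ) : ℂ) * f x) ^ 2 := fun i => by
    have h := L2norm_add_sq ((hf.pd i).memLp 2) ((hf.coord_mul i).memLp 2)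
    have h2 := IsS.integral_mul_pd i (hf.coord_mul i).conj hf
    have e : ∫ x, _root_.pd i f x * (starRingEnd ℂ) (((x i : ℝ) : ℂ) * f x) =
        -(∫ x, f x * (starRingEnd ℂ) (f x)) -
        (starRingEnd ℂ) (∫ x, _root_.pd i f x * (starRingEnd ℂ) (((x i : ℝ) : ℂ) * f x)) := by
      have i1 : Integrable fun x => f x * (starRingEnd ℂ) (f x) := (hf.mul hf.conj).integrable
      have i2 : Integrable fun x : E2 => (starRingEnd ℂ)
          (_root_.pd i f x * (starRingEnd ℂ) (((x i : ℝ) : ℂ) * f x)) :=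
        ((hf.pd i).mul (hf.coord_mul i).conj).conj.integrable
      have i1' : Integrable fun x => -(f x * (starRingEnd ℂ) (f x)) := i1.neg
      rw [← integral_conj, ← integral_neg, ← integral_sub i1' i2]
      calc ∫ x, _root_.pd i f x * (starRingEnd ℂ) (((x i : ℝ) : ℂ) * f x) =
          ∫ x, (starRingEnd ℂ) (((x i : ℝ) : ℂ) * f x) * _root_.pd i f x := by
            congr 1 with x; ring
        _ = _ := by
          rw [h2, ← integral_neg]
          congr 1 with x
          rw [pd_conj i (hf.coord_mul i).differentiable, hf.pd_coord_mul]
          simp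
          ring
    have hre := congrArg Complex.re e
    rw [integral_self_mul_conj] at hre
    simp only [Complex.sub_re, Complex.neg_re, Complex.ofReal_re, Complex.conj_re] at hre
    nlinarith [sq_nonneg (L2norm fun x => _root_.pd i f x + ((x i : ℝ) : ℂ) * f x)]
  have h := hf.grad_add_pos_le
  simp only [gradN, posN, Fin.sum_univ_two] at h
  have h0 := key 0
  have h1 := key 1
  have h2 : 2 * L2norm f * L2norm f ≤ L2norm (_root_.Aop f) * L2norm f := by nlinarith
  rcases (L2norm_nonneg f).eq_or_lt with h3 | h3
  · rw [← h3, mul_zero]; exact L2norm_nonneg _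
  · exact le_of_mul_le_mul_right h2 h3

lemma sup_le_Aop : ∃ C > 0, ∀ f : E2 → ℂ, IsS f → ∀ x, ‖f x‖ ≤ C * L2norm (Aop f) := by
  obtain ⟨C, hC, h⟩ := brezis_gallouet
  have hl : 0 < Real.log (1 / (1 / 2)) := Real.log_pos (by norm_num)
  refine ⟨√(2 * (C * Real.log (1 / (1 / 2)))), by positivity, fun f hf x => ?_⟩
  have h0 := h (1 / 2) (by norm_num) le_rfl f hf x
  have h1 := hf.two_mul_L2norm_le
  have h2 := hf.gradN_le
  have h3 := hf.lap_sq_le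
  have h4 := L2norm_nonneg f
  refine abs_le_of_sq_le_sq' ?_ (by have := L2norm_nonneg (Aop f); positivity) |>.2
  rw [mul_pow, Real.sq_sqrt (by positivity)]
  refine h0.trans ?_
  rw [mul_comm 2, mul_assoc _ 2]
  refine mul_le_mul_of_nonneg_left ?_ (by positivity)
  nlinarith

lemma sup_sq_le_log : ∃ C > 0, ∀ f : E2 → ℂ, IsS f → ∀ G, L2norm f ^ 2 + gradN f ≤ G → ∀ x,
    ‖f x‖ ^ 2 ≤ C * (1 + G) * Real.log (2 + L2norm (Aop f) ^ 2) := by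
  obtain ⟨C, hC, h⟩ := brezis_gallouet
  refine ⟨4 * C, by positivity, fun f hf G hG x => ?_⟩
  set a := L2norm (Aop f)
  have ha : 0 < 2 + a ^ 2 := by positivity
  have he : 1 / (2 + a ^ 2) ≤ 1 / 2 := one_div_le_one_div_of_le two_pos (by nlinarith [sq_nonneg a])
  have h0 := h (1 / (2 + a ^ 2)) (by positivity) he f hf x
  rw [one_div_one_div] at h0
  have hl : 0 ≤ Real.log (2 + a ^ 2) := Real.log_nonneg (by nlinarith [sq_nonneg a])
  refine h0.trans ?_
  have h3 := hf.lap_sq_le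
  have h4 := gradN_nonneg f
  have h5 : (1 + 1 / (2 + a ^ 2)) * gradN f ≤ (1 + 1 / 2) * gradN f := by gcongr
  have h6 : 1 / (2 + a ^ 2) * L2norm (lap f) ^ 2 ≤
      1 / (2 + a ^ 2) * (2 + a ^ 2) + 1 / 2 * (4 * L2norm f ^ 2) := by
    calc _ ≤ 1 / (2 + a ^ 2) * ((2 + a ^ 2) + 4 * L2norm f ^ 2) := by gcongr; linarith
      _ ≤ _ := by rw [mul_add]; gcongr
  rw [one_div_mul_cancel ha.ne'] at h6
  calc _ ≤ C * Real.log (2 + a ^ 2) * (4 * (1 + G)) := by gcongr; linarith [sq_nonneg (L2norm f)]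
    _ = _ := by ring

lemma norm_fderiv_le (f : E2 → ℂ) (x : E2) : ‖fderiv ℝ f x‖ ≤ ∑ i, ‖pd i f x‖ := by
  refine ContinuousLinearMap.opNorm_le_bound _ (Finset.sum_nonneg fun _ _ => norm_nonneg _)
    fun v => ?_
  have hv : v = ∑ i, v i • EuclideanSpace.single i (1 : ℝ) := by
    ext j; fin_cases j <;> simp
  conv_lhs => rw [hv, map_sum]
  rw [Finset.sum_mul]
  refine (norm_sum_le _ _).trans (Finset.sum_le_sum fun i _ => ?_)
  rw [map_smul, norm_smul, mul_comm]
  exact mul_le_mul_of_nonneg_left (PiLp.norm_apply_le v i) (norm_nonneg _)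

lemma gagliardo : ∃ K ≥ 0, ∀ g : E2 → ℂ, ContDiff ℝ 1 g → HasCompactSupport g →
    ∀ b : E2 → ℝ, Integrable b → (∀ x, ∑ i, ‖pd i g x‖ ≤ b x) → L2norm g ≤ K * ∫ x, b x := by
  refine ⟨eLpNormLESNormFDerivOneConst (volume : Measure E2) ((2 : NNReal) : ℝ), NNReal.coe_nonneg _,
    fun g hg hs b hb h => ?_⟩
  have hp : NNReal.HolderConjugate (Module.finrank ℝ E2) 2 := by
    rw [finrank_euclideanSpace_fin]
    constructor <;> norm_num
  have h1 := eLpNorm_le_eLpNorm_fderiv_one volume hg hs hp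
  have hgL : MemLp g 2 := hg.continuous.memLp_of_hasCompactSupport hs
  have h2 : eLpNorm (fderiv ℝ g) 1 ≤ ENNReal.ofReal (∫ x, b x) := by
    rw [eLpNorm_one_eq_lintegral_enorm, ofReal_integral_eq_lintegral_ofReal hb
      (Filter.Eventually.of_forall fun x =>
        (Finset.sum_nonneg fun _ _ => norm_nonneg _).trans (h x))]
    refine lintegral_mono fun x => ?_
    rw [← ofReal_norm]
    exact ENNReal.ofReal_le_ofReal ((norm_fderiv_le g x).trans (h x))
  have hb0 : 0 ≤ ∫ x, b x := integral_nonneg fun x =>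
    (Finset.sum_nonneg fun _ _ => norm_nonneg _).trans (h x)
  rw [L2norm_eq_toReal hgL]
  refine (ENNReal.toReal_mono ?_ (h1.trans (mul_le_mul_right h2 _))).trans_eq ?_
  · exact ENNReal.mul_ne_top ENNReal.coe_ne_top ENNReal.ofReal_ne_top
  · rw [ENNReal.toReal_mul, ENNReal.toReal_ofReal hb0, ENNReal.coe_toReal]

/-- Ladyzhenskaya's inequality. -/
lemma ladyzhenskaya : ∃ K ≥ 0, ∀ f : E2 → ℂ, IsS f →
    L2norm (fun x => f x * f x) ≤ K * (L2norm f * √(gradN f)) := by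
  obtain ⟨K, hK, h⟩ := gagliardo
  obtain ⟨C, η, hC, hη, hη1, hηd⟩ := exists_cutoffs
  refine ⟨4 * K, by positivity, fun f hf => ?_⟩
  have hfL := hf.memLp 2
  have hgr : ∀ i, L2norm (pd i f) ≤ √(gradN f) := fun i => by
    refine Real.le_sqrt_of_sq_le ?_
    exact Finset.single_le_sum (f := fun i => L2norm (pd i f) ^ 2)
      (fun _ _ => by positivity) (Finset.mem_univ i)
  have hn : ∀ n, L2norm (fun x => (η n x : ℂ) * (f x * f x)) ≤
      K * (2 * (C / (n + 1)) * L2norm f ^ 2 + 4 * (L2norm f * √(gradN f))) := fun n => by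
    have hi : ∀ i, Integrable fun x => C / (n + 1) * (‖f x‖ * ‖f x‖) +
        2 * (‖f x‖ * ‖pd i f x‖) := fun i =>
      ((integrable_norm_mul hfL hfL).const_mul _).add
        ((integrable_norm_mul hfL ((hf.pd i).memLp 2)).const_mul _)
    refine (h _ (((hη n).smooth.mul (hf.contDiff.mul hf.contDiff)).of_le (by simp))
      (hη n).supp.mul_right _ (integrable_finsetSum Finset.univ fun i _ => hi i)
      fun x => Finset.sum_le_sum fun i _ => ?_).trans ?_
    · rw [pd_mul i ((hη n).smooth.differentiable (by simp))
        (g := fun x => f x * f x) (hf.differentiable.mul hf.differentiable), pd_mul i hf.differentiable hf.differentiable]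
      refine (norm_add_le _ _).trans ?_
      have h1 : ‖pd i (fun x => (η n x : ℂ)) x * (f x * f x)‖ ≤ C / (n + 1) * (‖f x‖ * ‖f x‖) := by
        rw [norm_mul, norm_mul (f x)]
        exact mul_le_mul_of_nonneg_right (hηd n i x) (by positivity)
      have h2 : ‖(η n x : ℂ) * (pd i f x * f x + f x * pd i f x)‖ ≤ 2 * (‖f x‖ * ‖pd i f x‖) := by
        rw [show pd i f x * f x + f x * pd i f x = 2 * (f x * pd i f x) by ring, norm_mul]
        refine (mul_le_of_le_one_left (norm_nonneg _) ((hη n).norm_le x)).trans ?_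
        simp
      linarith
    · refine mul_le_mul_of_nonneg_left ?_ hK
      rw [integral_finsetSum _ fun i _ => hi i, Fin.sum_univ_two]
      have hb : ∀ i, ∫ x, (C / (n + 1) * (‖f x‖ * ‖f x‖) + 2 * (‖f x‖ * ‖pd i f x‖)) ≤
          C / (n + 1) * L2norm f ^ 2 + 2 * (L2norm f * √(gradN f)) := fun i => by
        rw [integral_add ((integrable_norm_mul hfL hfL).const_mul _)
          ((integrable_norm_mul hfL ((hf.pd i).memLp 2)).const_mul _), integral_const_mul,
          integral_const_mul]
        have h1 := integral_norm_mul_le hfL hfL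
        have h2 := (integral_norm_mul_le hfL ((hf.pd i).memLp 2)).trans
          (mul_le_mul_of_nonneg_left (hgr i) (L2norm_nonneg f))
        have : 0 ≤ C / (n + 1) := by positivity
        rw [sq]
        gcongr
      have := hb 0
      have := hb 1
      linarith
  refine (memLp_of_tendsto_of_le (fun n => (hη n).memLp (hf.mul hf).continuous) hn
    (M := 4 * K * (L2norm f * √(gradN f))) ?_ fun x => ?_).2
  · have : Filter.Tendsto (fun n : ℕ => C / ((n : ℝ) + 1)) Filter.atTop (nhds 0) := by
      simpa [div_eq_mul_inv] using
        (tendsto_one_div_add_atTop_nhds_zero_nat (𝕜 := ℝ)).const_mul C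
    have h2 := (((this.const_mul 2).mul_const (L2norm f ^ 2)).add_const
      (4 * (L2norm f * √(gradN f)))).const_mul K
    convert h2 using 2
    ring
  · refine tendsto_const_nhds.congr' ?_
    filter_upwards [hη1 x] with n hn
    rw [hn]; simp

lemma LocBdd.mono {φ ψ : ℝ → ℝ} {t : ℝ} {Ω : Set ℝ} (hΩ : IsOpen Ω) (ht : t ∈ Ω)
    (h : LocBdd φ t) (hle : ∀ s ∈ Ω, ψ s ≤ φ s) : LocBdd ψ t := by
  obtain ⟨C, hC⟩ := h
  refine ⟨C, ?_⟩
  filter_upwards [hC, hΩ.mem_nhds ht] with s h1 h2 using (hle s h2).trans h1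

lemma LocBdd.of_le {φ ψ : ℝ → ℝ} {t : ℝ} (h : LocBdd φ t) (hle : ∀ s, ψ s ≤ φ s) : LocBdd ψ t :=
  h.mono isOpen_univ trivial fun s _ => hle s

lemma LocBdd.add {φ ψ : ℝ → ℝ} {t : ℝ} (h : LocBdd φ t) (h' : LocBdd ψ t) :
    LocBdd (fun s => φ s + ψ s) t := by
  obtain ⟨C, hC⟩ := h
  obtain ⟨D, hD⟩ := h'
  exact ⟨C + D, by filter_upwards [hC, hD] with s h1 h2 using add_le_add h1 h2⟩

lemma LocBdd.const_mul {φ : ℝ → ℝ} {t c : ℝ} (hc : 0 ≤ c) (h : LocBdd φ t) :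
    LocBdd (fun s => c * φ s) t := by
  obtain ⟨C, hC⟩ := h
  exact ⟨c * C, by filter_upwards [hC] with s h1 using mul_le_mul_of_nonneg_left h1 hc⟩

lemma LocBdd.uniform {φ : ℕ → ℝ → ℝ} {t : ℝ} {n : ℕ} (h : ∀ i < n, LocBdd (φ i) t) :
    ∃ M, ∀ᶠ s in nhds t, ∀ i < n, φ i s ≤ M := by
  induction n with
  | zero => exact ⟨0, by simp⟩
  | succ n ih =>
    obtain ⟨M, hM⟩ := ih fun i hi => h i (by omega)
    obtain ⟨C, hC⟩ := h n (by omega)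
    refine ⟨max M C, ?_⟩
    filter_upwards [hM, hC] with s h1 h2 i hi
    rcases Nat.lt_succ_iff_lt_or_eq.1 hi with h3 | rfl
    · exact (h1 i h3).trans (le_max_left _ _)
    · exact h2.trans (le_max_right _ _)

/-- A function with forcing of at most linear size has locally bounded `L²` norm. -/
lemma locBdd_of_linear_forcing {v : ℝ → E2 → ℂ} (hv : Reg v) {Ω : Set ℝ} (hΩ : IsOpen Ω) {D : ℝ}
    (hD : 0 < D) (hF : ∀ t, MemLp (fun x => I * tderiv v t x + Aop (v t) x) 2)
    (h : ∀ t ∈ Ω, L2norm (fun x => I * tderiv v t x + Aop (v t) x) ≤ D * (1 + L2norm (v t))) :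
    ∀ t ∈ Ω, LocBdd (fun s => L2norm (v s)) t := by
  have hvL : ∀ t, MemLp (v t) 2 := fun t => (hv.sch t).memLp 2
  have key : ∀ c d, c ≤ d → d ≤ c + 1 / (2 * D) → Set.Icc c d ⊆ Ω → (∃ M, ∀ t ∈ Set.Icc c d,
      L2norm (v t) ≤ M) → ∀ s ∈ Set.Icc c d, ∀ t ∈ Set.Icc c d,
      L2norm (v t) ≤ 2 * L2norm (v s) + 1 := by
    rintro c d hcd hδ hs ⟨M, hM⟩
    exact L2norm_le_two_mul_add_one hv.js hcd hD hδ (fun t ht => ⟨hvL t, hM t ht⟩)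
      fun t ht => ⟨hF t, h t (hs ht)⟩
  refine locBdd_of_gap hΩ (fun N t _ => L2norm_le_of_frequently hv.js hvL) ?_ ?_
  · refine fun N => ⟨1 / (2 * D), by positivity, 2 * N + 1, fun a b hab hδ hs ha hl t ht => ?_⟩
    have h1 : ∀ s ∈ Set.Icc a t, L2norm (v s) ≤ max N (2 * L2norm (v t) + 1) := by
      intro s hst
      rcases hst.1.eq_or_lt with rfl | has
      · exact ha.trans (le_max_left _ _)
      · refine le_trans ?_ (le_max_right _ _)
        refine key s t hst.2 (by linarith [ht.2]) (fun r hr => hs ⟨has.le.trans hr.1,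
          hr.2.trans ht.2.le⟩) (LocBdd.bdd_Icc fun r hr => hl r ⟨has.trans_le hr.1,
          hr.2.trans_lt ht.2⟩) t ⟨hst.2, le_rfl⟩ s ⟨le_rfl, hst.2⟩
    have := key a t ht.1.le (by linarith [ht.2]) (fun r hr => hs ⟨hr.1, hr.2.trans ht.2.le⟩)
      ⟨_, h1⟩ a ⟨le_rfl, ht.1.le⟩ t ⟨ht.1.le, le_rfl⟩
    linarith
  · refine fun N => ⟨1 / (2 * D), by positivity, 2 * N + 1, fun a b hab hδ hs hb hl t ht => ?_⟩
    have h1 : ∀ s ∈ Set.Icc t b, L2norm (v s) ≤ max N (2 * L2norm (v t) + 1) := by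
      intro s hst
      rcases hst.2.eq_or_lt with rfl | hsb
      · exact hb.trans (le_max_left _ _)
      · refine le_trans ?_ (le_max_right _ _)
        refine key t s hst.1 (by linarith [ht.1]) (fun r hr => hs ⟨ht.1.le.trans hr.1,
          hr.2.trans hsb.le⟩) (LocBdd.bdd_Icc fun r hr => hl r ⟨ht.1.trans_le hr.1,
          hr.2.trans_lt hsb⟩) t ⟨le_rfl, hst.1⟩ s ⟨hst.1, le_rfl⟩
    have := key t b ht.2.le (by linarith [ht.1]) (fun r hr => hs ⟨ht.1.le.trans hr.1, hr.2⟩)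
      ⟨_, h1⟩ b ⟨ht.2.le, le_rfl⟩ t ⟨le_rfl, ht.2.le⟩
    linarith

/-- `‖∂ₜᵏ u‖` -/
def normD (u : ℝ → E2 → ℂ) (k : ℕ) (t : ℝ) : ℝ := L2norm (tderiv^[k] u t)

/-- `‖A ∂ₜᵏ u‖` -/
def normA (u : ℝ → E2 → ℂ) (k : ℕ) (t : ℝ) : ℝ := L2norm (Aop (tderiv^[k] u t))

lemma normD_nonneg (u : ℝ → E2 → ℂ) (k : ℕ) (t : ℝ) : 0 ≤ normD u k t := L2norm_nonneg _
lemma normA_nonneg (u : ℝ → E2 → ℂ) (k : ℕ) (t : ℝ) : 0 ≤ normA u k t := L2norm_nonneg _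

lemma L2norm_triple_le : ∃ K ≥ 0, ∀ f g h : E2 → ℂ, IsS f → IsS g → IsS h →
    L2norm (fun x => f x * (g x * h x)) ≤ K * (L2norm (Aop f) * L2norm (Aop g) * L2norm h) := by
  obtain ⟨C, hC, h⟩ := sup_le_Aop
  refine ⟨C * C, by positivity, fun f g k hf hg hk => ?_⟩
  refine (L2norm_mul_le ((hg.mul hk).memLp 2) (h f hf)).trans ?_
  have := L2norm_mul_le (hk.memLp 2) (h g hg)
  have h0 : 0 ≤ C * L2norm (Aop f) := mul_nonneg hC.le (L2norm_nonneg _)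
  calc _ ≤ C * L2norm (Aop f) * (C * L2norm (Aop g) * L2norm k) := by gcongr
    _ = _ := by ring

namespace Sol
variable {σ : ℝ} {u : ℝ → E2 → ℂ}

lemma normD_le (hu : Sol σ u) (k : ℕ) (t : ℝ) : 2 * normD u k t ≤ normA u k t :=
  ((hu.reg_self k).sch t).two_mul_L2norm_le

lemma tri_bound (hu : Sol σ u) {n : ℕ} {F : ℝ → E2 → ℂ} (hF : Tri u n F) :
    ∃ K ≥ 0, ∀ t Q, (∀ a b c, a + b + c = n → a ≤ c → b ≤ c →
      normA u a t * normA u b t * normD u c t ≤ Q) → L2norm (F t) ≤ K * Q := by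
  induction hF with
  | term a b c =>
    obtain ⟨K, hK, h⟩ := L2norm_triple_le
    refine ⟨K, hK, fun t Q hQ => ?_⟩
    have ha := (hu.reg_self a).sch t
    have hb := (hu.reg_self b).sch t
    have hc := (hu.reg_self c).sch t
    have hcc : L2norm (Aop fun x => (starRingEnd ℂ) (tderiv^[c] u t x)) = normA u c t := by
      rw [show (Aop fun x => (starRingEnd ℂ) (tderiv^[c] u t x)) = fun x =>
        (starRingEnd ℂ) (Aop (tderiv^[c] u t) x) from funext fun x => Aop_conj hc.contDiff x,
        L2norm_conj, normA]
    by_cases h1 : a ≤ c ∧ b ≤ c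
    · have := h _ _ _ ha hb hc.conj
      rw [L2norm_conj] at this
      exact this.trans (mul_le_mul_of_nonneg_left (hQ a b c rfl h1.1 h1.2) hK)
    · by_cases h2 : a ≤ b
      · have := h _ _ _ ha hc.conj hb
        rw [hcc] at this
        calc _ = L2norm (fun x => tderiv^[a] u t x *
              ((starRingEnd ℂ) (tderiv^[c] u t x) * tderiv^[b] u t x)) := by
              congr 1 with x; ring
          _ ≤ _ := this.trans (mul_le_mul_of_nonneg_left
              (hQ a c b (by omega) (by omega) (by omega)) hK)
      · have := h _ _ _ hb hc.conj ha
        rw [hcc] at this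
        calc _ = L2norm (fun x => tderiv^[b] u t x *
              ((starRingEnd ℂ) (tderiv^[c] u t x) * tderiv^[a] u t x)) := by
              congr 1 with x; ring
          _ ≤ _ := this.trans (mul_le_mul_of_nonneg_left
              (hQ b c a (by omega) (by omega) (by omega)) hK)
  | add h1 h2 i1 i2 =>
    obtain ⟨K, hK, hk⟩ := i1
    obtain ⟨L, hL, hl⟩ := i2
    refine ⟨K + L, by positivity, fun t Q hQ => ?_⟩
    rw [add_mul]
    exact (L2norm_add_le (((hu.tri_reg h1).sch t).memLp 2) (((hu.tri_reg h2).sch t).memLp 2)).trans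
      (add_le_add (hk t Q hQ) (hl t Q hQ))

lemma forcing_eq (hu : Sol σ u) (k : ℕ) (t : ℝ) :
    (fun x => I * tderiv (tderiv^[k] u) t x + Aop (tderiv^[k] u t) x) =
      fun x => -((σ : ℂ) * tderiv^[k] (cubic u) t x) := by
  ext x
  rw [← Function.iterate_succ_apply' tderiv k u, hu.eqn_iter, ← mul_assoc, I_mul_I]
  ring

lemma forcing_memLp (hu : Sol σ u) (k : ℕ) (t : ℝ) :
    MemLp (fun x => I * tderiv (tderiv^[k] u) t x + Aop (tderiv^[k] u t) x) 2 := by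
  rw [hu.forcing_eq]
  exact (((hu.reg_cubic k).sch t).const_mul σ).neg.memLp 2

lemma L2norm_forcing (hu : Sol σ u) (k : ℕ) (t : ℝ) :
    L2norm (fun x => I * tderiv (tderiv^[k] u) t x + Aop (tderiv^[k] u t) x) =
      |σ| * L2norm (tderiv^[k] (cubic u) t) := by
  rw [hu.forcing_eq, L2norm_neg, L2norm_const_mul, Complex.norm_real, Real.norm_eq_abs]

lemma normA_le (hu : Sol σ u) (k : ℕ) (t : ℝ) :
    normA u k t ≤ normD u (k + 1) t + |σ| * L2norm (tderiv^[k] (cubic u) t) := by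
  have h1 := ((hu.reg_self (k + 1)).sch t).const_mul (-I)
  have h2 := ((hu.reg_cubic k).sch t).const_mul (-σ)
  have e : Aop (tderiv^[k] u t) = fun x => -I * tderiv^[k + 1] u t x +
      -σ * tderiv^[k] (cubic u) t x := by
    ext x
    rw [hu.eqn_iter, ← mul_assoc, neg_mul, I_mul_I]
    ring
  have := L2norm_add_le (h1.memLp 2) (h2.memLp 2)
  rw [← e, L2norm_const_mul, L2norm_const_mul] at this
  simpa [normA, normD] using this

lemma normD_succ_le (hu : Sol σ u) (k : ℕ) (t : ℝ) :
    normD u (k + 1) t ≤ normA u k t + |σ| * L2norm (tderiv^[k] (cubic u) t) := by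
  have h1 := ((hu.reg_self k).sch t).Aop
  have h2 := ((hu.reg_cubic k).sch t).const_mul σ
  have e : tderiv^[k + 1] u t = fun x => I * (Aop (tderiv^[k] u t) x +
      σ * tderiv^[k] (cubic u) t x) := funext fun x => hu.eqn_iter k t x
  have := L2norm_add_le (h1.memLp 2) (h2.memLp 2)
  rw [normD, e, L2norm_const_mul]
  rw [L2norm_const_mul] at this
  simpa [normA, normD] using this

/-- Local boundedness of `‖A u‖` propagates to all time derivatives. -/
lemma locBdd_levels (hu : Sol σ u) {Ω : Set ℝ}
    (h0 : ∀ t ∈ Ω, LocBdd (normA u 0) t) : ∀ k, ∀ t ∈ Ω, LocBdd (normA u k) t := by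
  have hD0 : ∀ t ∈ Ω, LocBdd (normD u 0) t := fun t ht => (h0 t ht).of_le fun s => by
    linarith [hu.normD_le 0 s, normD_nonneg u 0 s]
  have main : ∀ j, (∀ i < j + 2, ∀ t ∈ Ω, LocBdd (normD u i) t) ∧
      (∀ i < j + 1, ∀ t ∈ Ω, LocBdd (normA u i) t) := by
    intro j
    induction j with
    | zero =>
      refine ⟨fun i hi t ht => ?_, fun i hi t ht => ?_⟩
      · obtain rfl | rfl : i = 0 ∨ i = 1 := by omega
        · exact hD0 t ht
        · obtain ⟨K, hK, h⟩ := hu.tri_bound (hu.tri_cubic 0)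
          obtain ⟨C, hC⟩ := h0 t ht
          refine ⟨C + |σ| * (K * (C * C * C)), ?_⟩
          filter_upwards [hC] with s hs
          have hA := normA_nonneg u 0 s
          refine (hu.normD_succ_le 0 s).trans ?_
          have := h s (C * C * C) fun a b c habc _ _ => by
            obtain ⟨rfl, rfl, rfl⟩ : a = 0 ∧ b = 0 ∧ c = 0 := by omega
            have hd : normD u 0 s ≤ C := by linarith [hu.normD_le 0 s, normD_nonneg u 0 s]
            have := normD_nonneg u 0 s
            have : 0 ≤ C := hA.trans hs
            gcongr
          gcongr
      · obtain rfl : i = 0 := by omega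
        exact h0 t ht
    | succ j ih =>
      obtain ⟨ihD, ihA⟩ := ih
      have hN : ∀ t ∈ Ω, ∃ M, 1 ≤ M ∧ ∀ᶠ s in nhds t, (∀ i < j + 2, normD u i s ≤ M) ∧
          (∀ i < j + 1, normA u i s ≤ M) ∧ normA u (j + 1) s ≤ M * (1 + normD u (j + 2) s) := by
        intro t ht
        obtain ⟨M1, h1⟩ := LocBdd.uniform fun i hi => ihD i hi t ht
        obtain ⟨M2, h2⟩ := LocBdd.uniform fun i hi => ihA i hi t ht
        obtain ⟨K, hK, h⟩ := hu.tri_bound (hu.tri_cubic (j + 1))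
        set M3 := max M1 M2
        set M := max (max 1 M3) (|σ| * (K * (M3 * M3 * M3)))
        have hM3 : M3 ≤ M := (le_max_right _ _).trans (le_max_left _ _)
        have hM1 : 1 ≤ M := (le_max_left _ _).trans (le_max_left _ _)
        refine ⟨M, hM1, ?_⟩
        filter_upwards [h1, h2] with s hs1 hs2
        refine ⟨fun i hi => (hs1 i hi).trans ((le_max_left _ _).trans hM3),
          fun i hi => (hs2 i hi).trans ((le_max_right _ _).trans hM3), ?_⟩
        refine (hu.normA_le (j + 1) s).trans ?_
        have h3 := h s (M3 * M3 * M3) fun a b c habc hac hbc => by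
          have ha := (hs2 a (by omega)).trans (le_max_right M1 M2)
          have hb := (hs2 b (by omega)).trans (le_max_right M1 M2)
          have hc := (hs1 c (by omega)).trans (le_max_left M1 M2)
          have a0 := normA_nonneg u a s
          have b0 := normA_nonneg u b s
          have c0 := normD_nonneg u c s
          have : 0 ≤ M3 := a0.trans ha
          gcongr
        have h4 : |σ| * L2norm (tderiv^[j + 1] (cubic u) s) ≤ M :=
          (mul_le_mul_of_nonneg_left h3 (abs_nonneg _)).trans (le_max_right _ _)
        have := normD_nonneg u (j + 2) s
        show normD u (j + 2) s + _ ≤ _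
        nlinarith
      have hX : ∀ t ∈ Ω, LocBdd (normD u (j + 2)) t := by
        intro p hp
        obtain ⟨M, hM, hev⟩ := hN p hp
        obtain ⟨r, hr, hb⟩ := Metric.eventually_nhds_iff_ball.1 hev
        obtain ⟨K, hK, h⟩ := hu.tri_bound (hu.tri_cubic (j + 2))
        refine locBdd_of_linear_forcing (v := tderiv^[j + 2] u) (hu.reg_self (j + 2))
          Metric.isOpen_ball (D := |σ| * (K * (M * M * M)) + 1) (by positivity)
          (hu.forcing_memLp _) (fun s hs => ?_) p (Metric.mem_ball_self hr)
        rw [hu.L2norm_forcing]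
        obtain ⟨hs1, hs2, hs3⟩ := hb s hs
        change _ ≤ _ * (1 + normD u (j + 2) s)
        set X := normD u (j + 2) s with hXdef
        have hX0 : 0 ≤ X := normD_nonneg _ _ _
        have h3 := h s (M * M * M * (1 + X)) fun a b c habc hac hbc => by
          have a0 := normA_nonneg u a s
          have b0 := normA_nonneg u b s
          have c0 := normD_nonneg u c s
          have hM0 : 0 ≤ M := by linarith
          have hMX : M ≤ M * (1 + X) := by nlinarith
          rcases (show c ≤ j + 2 by omega).eq_or_lt with rfl | hc
          · calc _ ≤ M * M * X := by
                  gcongr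
                  exacts [hs2 a (by omega), hs2 b (by omega)]
              _ ≤ M * M * (M * (1 + X)) := by gcongr; nlinarith
              _ = _ := by ring
          · have hc' := hs1 c hc
            rcases (show a ≤ j + 1 by omega).eq_or_lt with rfl | ha
            · calc _ ≤ M * (1 + X) * M * M := by
                    gcongr
                    exact hs2 b (by omega)
                _ = _ := by ring
            · have ha' := hs2 a ha
              have hb' : normA u b s ≤ M * (1 + X) := by
                rcases (show b ≤ j + 1 by omega).eq_or_lt with rfl | hb2
                · exact hs3
                · exact (hs2 b hb2).trans hMX
              calc _ ≤ M * (M * (1 + X)) * M := by gcongr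
                _ = _ := by ring
        calc _ ≤ |σ| * (K * (M * M * M * (1 + X))) := by gcongr
          _ = |σ| * (K * (M * M * M)) * (1 + X) := by ring
          _ ≤ _ := by gcongr; linarith
      refine ⟨fun i hi t ht => ?_, fun i hi t ht => ?_⟩
      · rcases Nat.lt_succ_iff_lt_or_eq.1 hi with h | rfl
        · exact ihD i h t ht
        · exact hX t ht
      · rcases Nat.lt_succ_iff_lt_or_eq.1 hi with h | rfl
        · exact ihA i h t ht
        · obtain ⟨M, hM, hev⟩ := hN t ht
          obtain ⟨C, hC⟩ := hX t ht
          refine ⟨M * (1 + C), ?_⟩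
          filter_upwards [hev, hC] with s h1 h2
          refine h1.2.2.trans ?_
          gcongr
  exact fun k => (main k).2 k (by omega)

end Sol

/-- The `L²` inner product. -/
def ip (f g : E2 → ℂ) : ℂ := ∫ x, f x * (starRingEnd ℂ) (g x)

lemma ip_self (f : E2 → ℂ) : ip f f = ((L2norm f ^ 2 : ℝ) : ℂ) := integral_self_mul_conj f

lemma ip_symm (f g : E2 → ℂ) : ip g f = (starRingEnd ℂ) (ip f g) := by
  rw [ip, ip, ← integral_conj]
  congr 1 with x
  simp [mul_comm]

lemma ip_const_left (c : ℂ) (f g : E2 → ℂ) : ip (fun x => c * f x) g = c * ip f g := by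
  rw [ip, ip, ← integral_const_mul]
  congr 1 with x
  ring

lemma ip_const_right (c : ℂ) (f g : E2 → ℂ) :
    ip f (fun x => c * g x) = (starRingEnd ℂ) c * ip f g := by
  rw [ip_symm, ip_const_left, map_mul, ← ip_symm]

lemma ip_coord (i : Fin 2) (f g : E2 → ℂ) :
    ip (fun x => ((x i : ℝ) : ℂ) * f x) g = ip f (fun x => ((x i : ℝ) : ℂ) * g x) := by
  rw [ip, ip]
  congr 1 with x
  simp
  ring

lemma norm_ip_le {f g : E2 → ℂ} (hf : IsS f) (hg : IsS g) : ‖ip f g‖ ≤ L2norm f * L2norm g :=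
  norm_integral_mul_conj_le (hf.memLp 2) (hg.memLp 2)

namespace IsS
variable {f g h : E2 → ℂ}

lemma ip_add_left (hf : IsS f) (hg : IsS g) (hh : IsS h) :
    ip (fun x => f x + g x) h = ip f h + ip g h := by
  have i1 : Integrable fun x => f x * (starRingEnd ℂ) (h x) := (hf.mul hh.conj).integrable
  have i2 : Integrable fun x => g x * (starRingEnd ℂ) (h x) := (hg.mul hh.conj).integrable
  rw [ip, ip, ip, ← integral_add i1 i2]
  congr 1 with x
  ring

lemma ip_add_right (hf : IsS f) (hg : IsS g) (hh : IsS h) :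
    ip f (fun x => g x + h x) = ip f g + ip f h := by
  rw [ip_symm, hg.ip_add_left hh hf, map_add, ← ip_symm, ← ip_symm]

lemma ip_pd (i : Fin 2) (hf : IsS f) (hg : IsS g) :
    ip (_root_.pd i f) g = -ip f (_root_.pd i g) := by
  have h2 := IsS.integral_mul_pd i hf hg.conj
  simp only [pd_conj i hg.differentiable] at h2
  rw [ip, ip, h2, neg_neg]

/-- `∑ⱼ xⱼ ∂ⱼ h` -/
def _root_.eul (h : E2 → ℂ) (x : E2) : ℂ :=
  ((x 0 : ℝ) : ℂ) * _root_.pd 0 h x + ((x 1 : ℝ) : ℂ) * _root_.pd 1 h x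

lemma _root_.eul_def (h : E2 → ℂ) : _root_.eul h = fun x : E2 =>
    ((x 0 : ℝ) : ℂ) * _root_.pd 0 h x + ((x 1 : ℝ) : ℂ) * _root_.pd 1 h x := rfl

lemma eul (hh : IsS h) : IsS (eul h) := ((hh.pd 0).coord_mul 0).add ((hh.pd 1).coord_mul 1)

lemma re_ip_coord_pd (j : Fin 2) (hh : IsS h) :
    (ip h (fun x => ((x j : ℝ) : ℂ) * _root_.pd j h x)).re = -(1 / 2) * L2norm h ^ 2 := by
  have h1 : ip h (fun x => ((x j : ℝ) : ℂ) * _root_.pd j h x) =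
      -(((L2norm h ^ 2 : ℝ) : ℂ) +
        (starRingEnd ℂ) (ip h (fun x => ((x j : ℝ) : ℂ) * _root_.pd j h x))) := by
    rw [← ip_symm, ← ip_self, ← hh.ip_add_left ((hh.pd j).coord_mul j) hh, ← ip_coord,
      ← neg_inj, neg_neg, ← (hh.coord_mul j).ip_pd j hh]
    congr 1 with x
    rw [hh.pd_coord_mul]
    simp
  have h2 := congrArg Complex.re h1
  simp only [Complex.neg_re, Complex.add_re, Complex.ofReal_re, Complex.conj_re] at h2
  linarith

lemma re_ip_eul (hh : IsS h) : (ip h (_root_.eul h)).re = -L2norm h ^ 2 := by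
  have := hh.ip_add_right ((hh.pd 0).coord_mul 0) ((hh.pd 1).coord_mul 1)
  have := congrArg Complex.re this
  rw [Complex.add_re, hh.re_ip_coord_pd, hh.re_ip_coord_pd] at this
  rw [eul_def]
  linarith

lemma pd_comm (i j : Fin 2) (hh : IsS h) (x : E2) :
    _root_.pd i (_root_.pd j h) x = _root_.pd j (_root_.pd i h) x := by
  have hd : DifferentiableAt ℝ (fderiv ℝ h) x :=
    (hh.contDiff.fderiv_right (m := (⊤ : ℕ∞)) (by simp)).differentiable (by simp) x
  have e : ∀ k l, _root_.pd k (_root_.pd l h) x = fderiv ℝ (fderiv ℝ h) x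
      (EuclideanSpace.single k 1) (EuclideanSpace.single l 1) := fun k l => by
    have h1 : HasFDerivAt (_root_.pd l h) ((ContinuousLinearMap.apply ℝ ℂ
        (EuclideanSpace.single l (1 : ℝ))).comp (fderiv ℝ (fderiv ℝ h) x)) x :=
      HasFDerivAt.comp x (ContinuousLinearMap.hasFDerivAt (ContinuousLinearMap.apply ℝ ℂ
        (EuclideanSpace.single l (1 : ℝ)))) hd.hasFDerivAt
    rw [_root_.pd, h1.fderiv]
    rfl
  rw [e, e]
  exact (hh.contDiff.contDiffAt.isSymmSndFDerivAt (by
    simpa using WithTop.coe_le_coe.2 (le_top : (2 : ℕ∞) ≤ ⊤))).eq _ _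

lemma pd_eul (i : Fin 2) (hh : IsS h) (x : E2) :
    _root_.pd i (_root_.eul h) x = _root_.pd i h x + _root_.eul (_root_.pd i h) x := by
  rw [eul_def, pd_add i ((hh.pd 0).coord_mul 0).differentiable
    ((hh.pd 1).coord_mul 1).differentiable, (hh.pd 0).pd_coord_mul, (hh.pd 1).pd_coord_mul,
    hh.pd_comm i 0, hh.pd_comm i 1, _root_.eul]
  fin_cases i <;> simp <;> ring

lemma coord_mul_eul (i : Fin 2) (hh : IsS h) (x : E2) :
    ((x i : ℝ) : ℂ) * _root_.eul h x =
      _root_.eul (fun x => ((x i : ℝ) : ℂ) * h x) x - ((x i : ℝ) : ℂ) * h x := by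
  rw [_root_.eul, _root_.eul, hh.pd_coord_mul, hh.pd_coord_mul]
  fin_cases i <;> simp <;> ring

/-- The virial identity for the harmonic oscillator. -/
lemma re_ip_Aop_eul (hh : IsS h) :
    (ip (_root_.Aop h) (_root_.eul h)).re = -2 * posN h := by
  have e1 : ∀ i, _root_.pd i (_root_.eul h) =
      fun x => _root_.pd i h x + _root_.eul (_root_.pd i h) x := fun i => funext (hh.pd_eul i)
  have e2 : ∀ i : Fin 2, (fun x : E2 => ((x i : ℝ) : ℂ) * _root_.eul h x) =
      fun x => _root_.eul (fun x => ((x i : ℝ) : ℂ) * h x) x + -1 * (((x i : ℝ) : ℂ) * h x) :=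
    fun i => funext fun x => by rw [hh.coord_mul_eul i]; ring
  have h1 : ip (_root_.Aop h) (_root_.eul h) = ∑ i, (ip (_root_.pd i h) (_root_.pd i (_root_.eul h))
      + ip (fun x => ((x i : ℝ) : ℂ) * h x) (fun x => ((x i : ℝ) : ℂ) * _root_.eul h x)) :=
    hh.integral_Aop hh.eul
  have h2 : ∀ i, (ip (_root_.pd i h) (_root_.pd i (_root_.eul h)) +
      ip (fun x => ((x i : ℝ) : ℂ) * h x) (fun x => ((x i : ℝ) : ℂ) * _root_.eul h x)).re =
      -2 * L2norm (fun x => ((x i : ℝ) : ℂ) * h x) ^ 2 := fun i => by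
    have hi := hh.coord_mul i
    rw [e1, e2, (hh.pd i).ip_add_right (hh.pd i) (hh.pd i).eul,
      hi.ip_add_right hi.eul (hi.const_mul (-1)),
      ip_const_right (-1) _ (fun x : E2 => ((x i : ℝ) : ℂ) * h x), ip_self, ip_self]
    simp only [Complex.add_re, (hh.pd i).re_ip_eul, hi.re_ip_eul, Complex.ofReal_re, map_neg,
      map_one, neg_mul, one_mul, Complex.neg_re]
    ring
  rw [h1, Complex.re_sum, posN, Finset.mul_sum]
  exact Finset.sum_congr rfl fun i _ => h2 i

lemma re_ip_cubic_eul (hh : IsS h) :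
    (ip (fun x => h x * (h x * (starRingEnd ℂ) (h x))) (_root_.eul h)).re =
      -(1 / 2) * L2norm (fun x => h x * h x) ^ 2 := by
  have h1 := (hh.mul hh).re_ip_eul
  have e : ip (fun x => h x * h x) (_root_.eul fun x => h x * h x) =
      2 * ip (fun x => h x * (h x * (starRingEnd ℂ) (h x))) (_root_.eul h) := by
    rw [← ip_const_left, ip, ip]
    congr 1 with x
    rw [_root_.eul, _root_.eul, pd_mul 0 hh.differentiable hh.differentiable,
      pd_mul 1 hh.differentiable hh.differentiable]
    simp only [map_add, map_mul]
    ring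
  rw [e] at h1
  simp only [Complex.mul_re, Complex.re_ofNat, Complex.im_ofNat, zero_mul, sub_zero] at h1
  linarith

lemma ip_cubic_self (h : E2 → ℂ) :
    ip (fun x => h x * (h x * (starRingEnd ℂ) (h x))) h =
      ((L2norm (fun x => h x * h x) ^ 2 : ℝ) : ℂ) := by
  rw [← ip_self, ip, ip]
  congr 1 with x
  simp only [map_mul]
  ring

lemma ip_Aop_self (hh : IsS h) : ip (_root_.Aop h) h = ((gradN h + posN h : ℝ) : ℂ) := hh.form_eq

lemma ip_Aop (hf : IsS f) (hg : IsS g) : ip (_root_.Aop f) g = ip f (_root_.Aop g) := by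
  have h1 := hf.integral_Aop hg
  have h2 := hg.integral_Aop hf
  rw [ip_symm (_root_.Aop g) f, ip, ip, h1, h2, map_sum]
  refine Finset.sum_congr rfl fun i _ => ?_
  rw [map_add, ← integral_conj, ← integral_conj]
  congr 2 <;> ext x <;> simp [mul_comm]

end IsS

lemma IsCutoff.isS_mul {η : E2 → ℝ} (hη : IsCutoff η) {f : E2 → ℂ} (hf : IsS f) :
    IsS (fun x => (η x : ℂ) * f x) :=
  hf.temperate_mul (hη.supp.hasTemperateGrowth hη.smooth)

lemma L2norm_norm (f : E2 → ℂ) : L2norm (fun x => ((‖f x‖ : ℝ) : ℂ)) = L2norm f := by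
  simp [L2norm]

lemma IsS.norm_memLp {f : E2 → ℂ} (hf : IsS f) : MemLp (fun x => ((‖f x‖ : ℝ) : ℂ)) 2 :=
  (hf.memLp 2).norm.ofReal

namespace IsCutoff
variable {η : E2 → ℝ} {f : E2 → ℂ}

lemma isS_compl (hη : IsCutoff η) (hf : IsS f) : IsS (fun x => f x - (η x : ℂ) * f x) :=
  hf.sub (hη.isS_mul hf)

lemma norm_compl_le (hη : IsCutoff η) (f : E2 → ℂ) (x : E2) :
    ‖f x - (η x : ℂ) * f x‖ ≤ ‖f x‖ := by
  rw [← one_sub_mul, norm_mul, ← Complex.ofReal_one, ← Complex.ofReal_sub, Complex.norm_real,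
    Real.norm_of_nonneg (by linarith [hη.le_one x])]
  exact mul_le_of_le_one_left (norm_nonneg _) (by linarith [hη.nonneg x])

lemma gradN_compl_le (hη : IsCutoff η) (hf : IsS f) {C : ℝ}
    (hd : ∀ i x, ‖pd i (fun x => (η x : ℂ)) x‖ ≤ C) :
    gradN (fun x => f x - (η x : ℂ) * f x) ≤ 4 * C ^ 2 * L2norm f ^ 2 + 2 * gradN f := by
  have hi : ∀ i, L2norm (pd i fun x => f x - (η x : ℂ) * f x) ^ 2 ≤
      2 * C ^ 2 * L2norm f ^ 2 + 2 * L2norm (pd i f) ^ 2 := fun i => by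
    have hη' := hη.smooth.differentiable (by simp)
    have e : pd i (fun x => f x - (η x : ℂ) * f x) = fun x =>
        (pd i f x - (η x : ℂ) * pd i f x) - pd i (fun x => (η x : ℂ)) x * f x := funext fun x => by
      have h1 := pd_add i hf.differentiable ((hη.isS_mul hf).const_mul (-1)).differentiable x
      have h2 := pd_const_mul i (-1) (hη.isS_mul hf).differentiable x
      rw [h2, pd_mul i hη' hf.differentiable] at h1
      simp only [neg_one_mul, ← sub_eq_add_neg] at h1
      rw [h1]; ring
    have m1 := (hη.isS_compl (hf.pd i)).memLp 2
    have hs : IsS (fun x => pd i (fun x => (η x : ℂ)) x * f x) := by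
      have e2 : (fun x => pd i (fun x => (η x : ℂ)) x * f x) = fun x =>
          pd i (fun x => (η x : ℂ) * f x) x - (η x : ℂ) * pd i f x := funext fun x => by
        rw [pd_mul i hη' hf.differentiable]; ring
      rw [e2]
      exact ((hη.isS_mul hf).pd i).sub (hη.isS_mul (hf.pd i))
    have h1 := L2norm_sub_le m1 (hs.memLp 2)
    rw [← e] at h1
    have h2 := L2norm_mono ((hf.pd i).memLp 2) (hη.norm_compl_le (pd i f))
    have h3 := L2norm_mul_le (hf.memLp 2) (hd i)
    have h4 : L2norm (pd i fun x => f x - (η x : ℂ) * f x) ≤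
        C * L2norm f + L2norm (pd i f) := by linarith
    have h5 := pow_le_pow_left₀ (L2norm_nonneg _) h4 2
    nlinarith [sq_nonneg (C * L2norm f - L2norm (pd i f))]
  have h0 := hi 0
  have h1 := hi 1
  simp only [gradN, Fin.sum_univ_two] at *
  linarith

lemma L2norm_compl_le (hη : IsCutoff η) (hf : IsS f) {R : ℝ} (hR : 0 ≤ R)
    (h1 : ∀ x, ‖x‖ ≤ R → η x = 1) :
    R ^ 2 * L2norm (fun x => f x - (η x : ℂ) * f x) ^ 2 ≤ posN f := by
  rw [posN]
  simp only [L2norm_sq, Fin.sum_univ_two]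
  rw [← integral_const_mul, ← integral_add
    (MemLp.integrable_sq_norm ((hf.coord_mul 0).memLp 2))
    (MemLp.integrable_sq_norm ((hf.coord_mul 1).memLp 2))]
  refine integral_mono_of_nonneg (Filter.Eventually.of_forall fun x => by positivity)
    ((MemLp.integrable_sq_norm ((hf.coord_mul 0).memLp 2)).add
    (MemLp.integrable_sq_norm ((hf.coord_mul 1).memLp 2)))
    (Filter.Eventually.of_forall fun x => ?_)
  have e : ‖((x 0 : ℝ) : ℂ) * f x‖ ^ 2 + ‖((x 1 : ℝ) : ℂ) * f x‖ ^ 2 = ‖x‖ ^ 2 * ‖f x‖ ^ 2 := by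
    rw [EuclideanSpace.norm_sq_eq, Fin.sum_univ_two]
    simp only [norm_mul, Complex.norm_real]
    ring
  show R ^ 2 * ‖f x - (η x : ℂ) * f x‖ ^ 2 ≤ _
  refine le_of_le_of_eq ?_ e.symm
  by_cases hx : ‖x‖ ≤ R
  · rw [h1 x hx]; simp; positivity
  · push Not at hx
    have := hη.norm_compl_le f x
    gcongr

lemma L2norm_sq_fun_le (hη : IsCutoff η) (hf : IsS f) {K : ℝ} (hK : 0 ≤ K)
    (h : ∀ x ∈ tsupport (fun x => (η x : ℂ)), ‖f x‖ ≤ K) :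
    L2norm (fun x => f x * f x) ≤ K * L2norm f +
      L2norm (fun x => (f x - (η x : ℂ) * f x) * (f x - (η x : ℂ) * f x)) := by
  have hρ := (hη.isS_compl hf).mul (hη.isS_compl hf)
  have m1 : MemLp (fun x => (K : ℂ) * ((‖f x‖ : ℝ) : ℂ)) 2 := hf.norm_memLp.const_mul _
  have h1 := L2norm_add_le m1 hρ.norm_memLp
  rw [L2norm_const_mul, L2norm_norm,
    L2norm_norm (fun x => (f x - (η x : ℂ) * f x) * (f x - (η x : ℂ) * f x)), Complex.norm_real,
    Real.norm_of_nonneg hK] at h1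
  refine (L2norm_mono (m1.add hρ.norm_memLp) fun x => ?_).trans h1
  simp only [Pi.add_apply]
  rw [← Complex.ofReal_mul, ← Complex.ofReal_add, Complex.norm_real,
    Real.norm_of_nonneg (by positivity), norm_mul]
  by_cases hx : x ∈ tsupport (fun x => (η x : ℂ))
  · have := h x hx
    have := norm_nonneg (f x)
    nlinarith [norm_nonneg ((f x - (η x : ℂ) * f x) * (f x - (η x : ℂ) * f x))]
  · have h0 : (η x : ℂ) = 0 := image_eq_zero_of_notMem_tsupport (f := fun x => (η x : ℂ)) hx
    rw [h0, zero_mul, sub_zero, norm_mul]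
    have := norm_nonneg (f x)
    have : 0 ≤ K * ‖f x‖ := by positivity
    linarith

end IsCutoff

/-- For functions with bounded mass and variance that are bounded on a suitable compact set, the
`L⁴` norm is controlled by an arbitrarily small multiple of the gradient. -/
lemma quartic_le_small_grad {M Y ε : ℝ} (hM : 0 ≤ M) (hY : 0 ≤ Y) (hε : 0 < ε) :
    ∃ S : Set E2, IsCompact S ∧ ∀ K, ∃ C ≥ 0, ∀ f : E2 → ℂ, IsS f → L2norm f ^ 2 ≤ M → posN f ≤ Y →
      (∀ x ∈ S, ‖f x‖ ≤ K) → L2norm (fun x => f x * f x) ^ 2 ≤ C + ε * gradN f := by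
  obtain ⟨L, hL, hlad⟩ := ladyzhenskaya
  obtain ⟨C, η, hC, hη, h1, hd⟩ := exists_cutoffs_ball
  obtain ⟨n, hn⟩ := exists_nat_ge (4 * L ^ 2 * Y / ε)
  refine ⟨tsupport (fun x => (η n x : ℂ)), (hη n).supp, fun K' => ?_⟩
  set K := max K' 0
  have hn1 : (1 : ℝ) ≤ (n : ℝ) + 1 := by linarith [(Nat.cast_nonneg n : (0 : ℝ) ≤ n)]
  have hd' : ∀ i x, ‖pd i (fun x => (η n x : ℂ)) x‖ ≤ C := fun i x =>
    (hd n i x).trans (div_le_self hC hn1)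
  refine ⟨2 * K ^ 2 * M + 2 * L ^ 2 * Y * (4 * C ^ 2 * M), by positivity,
    fun f hf hfM hfY hfK => ?_⟩
  have hK0 : 0 ≤ K := le_max_right _ _
  have a1 := (hη n).L2norm_sq_fun_le hf hK0 fun x hx => (hfK x hx).trans (le_max_left _ _)
  have a2 := hlad _ ((hη n).isS_compl hf)
  have a3 := (hη n).gradN_compl_le hf hd'
  have a4 := (hη n).L2norm_compl_le hf (R := n + 1) (by positivity) (h1 n)
  set ρ := fun x => f x - (η n x : ℂ) * f x
  have r0 := L2norm_nonneg ρ
  have g0 := gradN_nonneg ρ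
  have gf0 := gradN_nonneg f
  have b1 : L2norm (fun x => ρ x * ρ x) ^ 2 ≤ L ^ 2 * (L2norm ρ ^ 2 * gradN ρ) := by
    refine (pow_le_pow_left₀ (L2norm_nonneg _) a2 2).trans_eq ?_
    rw [mul_pow, mul_pow, Real.sq_sqrt g0]
  have b2 : L2norm (fun x => f x * f x) ^ 2 ≤
      2 * (K ^ 2 * L2norm f ^ 2) + 2 * L2norm (fun x => ρ x * ρ x) ^ 2 := by
    refine (pow_le_pow_left₀ (L2norm_nonneg _) a1 2).trans ?_
    nlinarith [sq_nonneg (K * L2norm f - L2norm (fun x => ρ x * ρ x))]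
  have b3 : ((n : ℝ) + 1) * L2norm ρ ^ 2 ≤ Y := by
    have : ((n : ℝ) + 1) * L2norm ρ ^ 2 ≤ ((n : ℝ) + 1) ^ 2 * L2norm ρ ^ 2 := by
      gcongr; nlinarith
    linarith
  have b4 : L2norm ρ ^ 2 ≤ Y := by nlinarith [sq_nonneg (L2norm ρ)]
  have b5 : 4 * L ^ 2 * L2norm ρ ^ 2 ≤ ε := by
    rw [div_le_iff₀ hε] at hn
    have : ((n : ℝ) + 1) * (4 * L ^ 2 * L2norm ρ ^ 2) ≤ ((n : ℝ) + 1) * ε := by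
      calc _ = 4 * L ^ 2 * (((n : ℝ) + 1) * L2norm ρ ^ 2) := by ring
        _ ≤ 4 * L ^ 2 * Y := by gcongr
        _ ≤ _ := by linarith
    exact le_of_mul_le_mul_left this (by positivity)
  calc _ ≤ 2 * (K ^ 2 * M) + 2 * (L ^ 2 * (L2norm ρ ^ 2 * (4 * C ^ 2 * M + 2 * gradN f))) := by
        refine b2.trans ?_
        have : gradN ρ ≤ 4 * C ^ 2 * M + 2 * gradN f := a3.trans (by gcongr)
        gcongr
        exact b1.trans (by gcongr)
    _ = 2 * K ^ 2 * M + 2 * L ^ 2 * L2norm ρ ^ 2 * (4 * C ^ 2 * M) +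
        4 * L ^ 2 * L2norm ρ ^ 2 * gradN f := by ring
    _ ≤ _ := by gcongr

namespace IsS
variable {f : E2 → ℂ}

lemma im_ip_Aop_coord (i : Fin 2) (hf : IsS f) :
    (ip (_root_.Aop f) (fun x => ((x i : ℝ) : ℂ) * (((x i : ℝ) : ℂ) * f x))).im =
      2 * (ip (_root_.pd i f) (fun x => ((x i : ℝ) : ℂ) * f x)).im := by
  have hi := hf.coord_mul i
  have hii := hi.coord_mul i
  have h1 : ip (_root_.Aop f) (fun x => ((x i : ℝ) : ℂ) * (((x i : ℝ) : ℂ) * f x)) =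
      ∑ j, (ip (_root_.pd j f)
          (_root_.pd j (fun x => ((x i : ℝ) : ℂ) * (((x i : ℝ) : ℂ) * f x))) +
        ip (fun x => ((x j : ℝ) : ℂ) * f x)
          (fun x => ((x j : ℝ) : ℂ) * (((x i : ℝ) : ℂ) * (((x i : ℝ) : ℂ) * f x)))) :=
    hf.integral_Aop hii
  have h2 : ∀ j : Fin 2, (ip (fun x => ((x j : ℝ) : ℂ) * f x)
      (fun x => ((x j : ℝ) : ℂ) * (((x i : ℝ) : ℂ) * (((x i : ℝ) : ℂ) * f x)))).im = 0 := fun j => by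
    have e : (fun x : E2 => ((x j : ℝ) : ℂ) * (((x i : ℝ) : ℂ) * (((x i : ℝ) : ℂ) * f x))) =
        fun x => ((x i : ℝ) : ℂ) * (((x i : ℝ) : ℂ) * (((x j : ℝ) : ℂ) * f x)) := by
      ext x; ring
    rw [e, ← ip_coord i, ip_self, Complex.ofReal_im]
  have h3 : ∀ j : Fin 2, (ip (_root_.pd j f)
      (_root_.pd j (fun x => ((x i : ℝ) : ℂ) * (((x i : ℝ) : ℂ) * f x)))).im =
      if j = i then 2 * (ip (_root_.pd i f) (fun x => ((x i : ℝ) : ℂ) * f x)).im else 0 := fun j => by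
    have e : _root_.pd j (fun x => ((x i : ℝ) : ℂ) * (((x i : ℝ) : ℂ) * f x)) = fun x =>
        (if j = i then 2 else 0) * (((x i : ℝ) : ℂ) * f x) +
        ((x i : ℝ) : ℂ) * (((x i : ℝ) : ℂ) * _root_.pd j f x) := funext fun x => by
      rw [hi.pd_coord_mul, hf.pd_coord_mul]
      split_ifs <;> ring
    rw [e, (hf.pd j).ip_add_right (hi.const_mul _) (((hf.pd j).coord_mul i).coord_mul i),
      ip_const_right, ← ip_coord i (_root_.pd j f) (fun x => ((x i : ℝ) : ℂ) * _root_.pd j f x), ip_self,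
      Complex.add_im, Complex.ofReal_im, add_zero]
    split_ifs with h
    · subst h; simp
    · simp
  rw [h1, Complex.im_sum]
  simp only [Complex.add_im, h2, h3, add_zero]
  simp

lemma L2norm_coord_le (i : Fin 2) (hf : IsS f) :
    L2norm (fun x => ((x i : ℝ) : ℂ) * f x) ≤ L2norm (_root_.Aop f) := by
  have h1 : L2norm (fun x => ((x i : ℝ) : ℂ) * f x) ^ 2 ≤ posN f :=
    Finset.single_le_sum (f := fun i : Fin 2 => L2norm (fun x => ((x i : ℝ) : ℂ) * f x) ^ 2)
      (fun _ _ => by positivity) (Finset.mem_univ i)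
  have h2 := hf.posN_le
  have h3 := hf.two_mul_L2norm_le
  have h4 := L2norm_nonneg f
  exact (abs_le_of_sq_le_sq' (by nlinarith) (by linarith)).2

lemma L2norm_pd_le (i : Fin 2) (hf : IsS f) :
    L2norm (_root_.pd i f) ≤ L2norm (_root_.Aop f) := by
  have h1 : L2norm (_root_.pd i f) ^ 2 ≤ gradN f :=
    Finset.single_le_sum (f := fun i : Fin 2 => L2norm (_root_.pd i f) ^ 2)
      (fun _ _ => by positivity) (Finset.mem_univ i)
  have h2 := hf.gradN_le
  have h3 := hf.two_mul_L2norm_le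
  have h4 := L2norm_nonneg f
  exact (abs_le_of_sq_le_sq' (by nlinarith) (by linarith)).2

end IsS

lemma re_ip_comm (f g : E2 → ℂ) : (ip g f).re = (ip f g).re := by
  rw [ip_symm, Complex.conj_re]

lemma im_ip_comm (f g : E2 → ℂ) : (ip g f).im = -(ip f g).im := by
  rw [ip_symm, Complex.conj_im]

lemma LocBdd.mul {φ ψ : ℝ → ℝ} {t : ℝ} (h : LocBdd φ t) (h' : LocBdd ψ t) (hφ : ∀ s, 0 ≤ φ s)
    (hψ : ∀ s, 0 ≤ ψ s) : LocBdd (fun s => φ s * ψ s) t := by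
  obtain ⟨C, hC⟩ := h
  obtain ⟨D, hD⟩ := h'
  refine ⟨C * D, ?_⟩
  filter_upwards [hC, hD] with s h1 h2
  exact mul_le_mul h1 h2 (hψ s) ((hφ s).trans h1)

lemma L2norm_mul_le_Aop : ∃ C ≥ 0, ∀ f g : E2 → ℂ, IsS f → IsS g →
    L2norm (fun x => f x * g x) ≤ C * (L2norm (Aop f) * L2norm g) := by
  obtain ⟨C, hC, h⟩ := sup_le_Aop
  refine ⟨C, hC.le, fun f g hf hg => (L2norm_mul_le (hg.memLp 2) (h f hf)).trans_eq ?_⟩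
  ring

namespace Sol
variable {σ : ℝ} {u : ℝ → E2 → ℂ} {t : ℝ}

lemma hasDerivAt_ip (hu : Sol σ u) {F G : ℝ → E2 → ℂ} (hF : Gen u F) (hG : Gen u G)
    (hbF : LocBdd (fun s => L2norm (tderiv (tderiv F) s)) t)
    (hbG : LocBdd (fun s => L2norm (tderiv (tderiv G) s)) t) :
    HasDerivAt (fun s => ip (F s) (G s)) (ip (tderiv F t) (G t) + ip (F t) (tderiv G t)) t :=
  hasDerivAt_integral_mul_conj (hF.reg hu.reg) ((hu.gen_tderiv hF).reg hu.reg)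
    ((hu.gen_tderiv (hu.gen_tderiv hF)).reg hu.reg) (hG.reg hu.reg)
    ((hu.gen_tderiv hG).reg hu.reg) ((hu.gen_tderiv (hu.gen_tderiv hG)).reg hu.reg) hbF hbG

lemma hasDerivAt_ip_re (hu : Sol σ u) {F G : ℝ → E2 → ℂ} (hF : Gen u F) (hG : Gen u G)
    (hbF : LocBdd (fun s => L2norm (tderiv (tderiv F) s)) t)
    (hbG : LocBdd (fun s => L2norm (tderiv (tderiv G) s)) t) :
    HasDerivAt (fun s => (ip (F s) (G s)).re)
      (ip (tderiv F t) (G t) + ip (F t) (tderiv G t)).re t :=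
  Complex.reCLM.hasFDerivAt.comp_hasDerivAt t (hu.hasDerivAt_ip hF hG hbF hbG)

lemma hasDerivAt_ip_im (hu : Sol σ u) {F G : ℝ → E2 → ℂ} (hF : Gen u F) (hG : Gen u G)
    (hbF : LocBdd (fun s => L2norm (tderiv (tderiv F) s)) t)
    (hbG : LocBdd (fun s => L2norm (tderiv (tderiv G) s)) t) :
    HasDerivAt (fun s => (ip (F s) (G s)).im)
      (ip (tderiv F t) (G t) + ip (F t) (tderiv G t)).im t :=
  Complex.imCLM.hasFDerivAt.comp_hasDerivAt t (hu.hasDerivAt_ip hF hG hbF hbG)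

lemma hasDerivAt_L2norm_sq (hu : Sol σ u) {F : ℝ → E2 → ℂ} (hF : Gen u F)
    (hbF : LocBdd (fun s => L2norm (tderiv (tderiv F) s)) t) :
    HasDerivAt (fun s => L2norm (F s) ^ 2) (2 * (ip (tderiv F t) (F t)).re) t := by
  have h := hu.hasDerivAt_ip_re hF hF hbF hbF
  simp only [ip_self, Complex.ofReal_re, Complex.add_re] at h
  rwa [re_ip_comm (tderiv F t), ← two_mul] at h

lemma tderiv_eq (hu : Sol σ u) (t : ℝ) : tderiv u t = fun x =>
    I * (Aop (u t) x + σ * (u t x * (u t x * (starRingEnd ℂ) (u t x)))) := by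
  ext x
  rw [hu.eqn, cubic_eq]

lemma ip_tderiv (hu : Sol σ u) {g : E2 → ℂ} (hg : IsS g) : ip (tderiv u t) g =
    I * (ip (Aop (u t)) g + σ * ip (fun x => u t x * (u t x * (starRingEnd ℂ) (u t x))) g) := by
  have h := hu.reg.sch t
  have hN := h.mul (h.mul h.conj)
  rw [hu.tderiv_eq, ip_const_left I (fun x => Aop (u t) x +
    σ * (u t x * (u t x * (starRingEnd ℂ) (u t x)))),
    h.Aop.ip_add_left (hN.const_mul σ) hg,
    ip_const_left (σ : ℂ) (fun x => u t x * (u t x * (starRingEnd ℂ) (u t x)))]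

lemma re_ip_tderiv_coord (hu : Sol σ u) (i : Fin 2) :
    (ip (tderiv u t) (fun x => ((x i : ℝ) : ℂ) * (((x i : ℝ) : ℂ) * u t x))).re =
      -(2 * (ip (pd i (u t)) (fun x => ((x i : ℝ) : ℂ) * u t x)).im) := by
  have h := hu.reg.sch t
  have e : ip (fun x => u t x * (u t x * (starRingEnd ℂ) (u t x)))
      (fun x => ((x i : ℝ) : ℂ) * (((x i : ℝ) : ℂ) * u t x)) =
      ip (fun x => ((x i : ℝ) : ℂ) * (u t x * u t x))
        (fun x => ((x i : ℝ) : ℂ) * (u t x * u t x)) := by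
    rw [ip, ip]
    congr 1 with x
    simp only [map_mul, Complex.conj_ofReal]
    ring
  rw [hu.ip_tderiv ((h.coord_mul i).coord_mul i), e,
    ip_self (fun x => ((x i : ℝ) : ℂ) * (u t x * u t x)), ← h.im_ip_Aop_coord i, Complex.I_mul_re,
    Complex.add_im, ← Complex.ofReal_mul, Complex.ofReal_im, add_zero]

lemma locBdd_normD (hu : Sol σ u) (hH : ∀ k, LocBdd (normA u k) t)
    (k : ℕ) : LocBdd (normD u k) t :=
  (hH k).of_le fun s => by linarith [hu.normD_le k s, normD_nonneg u k s]

lemma locBdd_coord (hu : Sol σ u) (hH : ∀ k, LocBdd (normA u k) t)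
    (i : Fin 2) :
    LocBdd (fun s => L2norm (tderiv (tderiv fun t x => ((x i : ℝ) : ℂ) * u t x) s)) t := by
  have h1 : Reg (tderiv u) := hu.reg_self 1
  rw [tderiv_coord_mul i hu.reg.js, tderiv_coord_mul i h1.js]
  exact (hH 2).of_le fun s => ((hu.reg_self 2).sch s).L2norm_coord_le i

lemma locBdd_pd (hu : Sol σ u) (hH : ∀ k, LocBdd (normA u k) t)
    (i : Fin 2) :
    LocBdd (fun s => L2norm (tderiv (tderiv fun t => pd i (u t)) s)) t := by
  have h1 : Reg (tderiv u) := hu.reg_self 1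
  rw [tderiv_pd i hu.reg.js, tderiv_pd i h1.js]
  exact (hH 2).of_le fun s => ((hu.reg_self 2).sch s).L2norm_pd_le i

lemma locBdd_Aop (hu : Sol σ u) (hH : ∀ k, LocBdd (normA u k) t)
    (k : ℕ) :
    LocBdd (fun s => L2norm (tderiv (tderiv fun t => Aop (tderiv^[k] u t)) s)) t := by
  have h1 := hu.reg_self (k + 1)
  rw [Function.iterate_succ_apply'] at h1
  rw [tderiv_Aop (hu.reg_self k).js, tderiv_Aop h1.js, ← Function.iterate_succ_apply' tderiv k u,
    ← Function.iterate_succ_apply' tderiv (k + 1) u]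
  exact hH (k + 2)

lemma locBdd_sq (hu : Sol σ u) (hH : ∀ k, LocBdd (normA u k) t) :
    LocBdd (fun s => L2norm (tderiv (tderiv fun t x => u t x * u t x) s)) t := by
  obtain ⟨C, hC, hCb⟩ := L2norm_mul_le_Aop
  have h0 := hu.reg
  have h1 : Reg (tderiv u) := hu.reg_self 1
  have h2 : Reg (tderiv (tderiv u)) := hu.reg_self 2
  have e : tderiv (tderiv fun t x => u t x * u t x) = fun t x =>
      2 * (u t x * tderiv (tderiv u) t x) + 2 * (tderiv u t x * tderiv u t x) := by
    rw [tderiv_mul h0.js h0.js, tderiv_add (h1.js.mul h0.js) (h0.js.mul h1.js),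
      tderiv_mul h1.js h0.js, tderiv_mul h0.js h1.js]
    ext t x
    ring
  rw [e]
  have b1 := (((hH 0).mul (hu.locBdd_normD hH 2) (normA_nonneg u 0) (normD_nonneg u 2)).const_mul
    hC).const_mul (zero_le_two (α := ℝ))
  have b2 := (((hH 1).mul (hu.locBdd_normD hH 1) (normA_nonneg u 1) (normD_nonneg u 1)).const_mul
    hC).const_mul (zero_le_two (α := ℝ))
  refine (b1.add b2).of_le fun s => ?_
  refine (L2norm_add_le ((((h0.mul h2).sch s).const_mul 2).memLp 2)
    ((((h1.mul h1).sch s).const_mul 2).memLp 2)).trans ?_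
  rw [L2norm_const_mul, L2norm_const_mul, Complex.norm_ofNat]
  have := hCb _ _ (h0.sch s) (h2.sch s)
  have := hCb _ _ (h1.sch s) (h1.sch s)
  exact add_le_add (mul_le_mul_of_nonneg_left ‹_› zero_le_two)
    (mul_le_mul_of_nonneg_left ‹_› zero_le_two)

/-- The virial quantity `Im ∫ (x · ∇u) conj u`. -/
def _root_.virial (f : E2 → ℂ) : ℝ :=
  ∑ i, (ip (pd i f) (fun x => ((x i : ℝ) : ℂ) * f x)).im

/-- Twice the energy. -/
def _root_.energy (σ : ℝ) (f : E2 → ℂ) : ℝ :=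
  gradN f + posN f + σ / 2 * L2norm (fun x => f x * f x) ^ 2

lemma hasDerivAt_mass (hu : Sol σ u) (hH : ∀ k, LocBdd (normA u k) t) :
    HasDerivAt (fun s => L2norm (u s) ^ 2) 0 t := by
  have h := hu.reg.sch t
  have := hu.hasDerivAt_L2norm_sq Gen.base (hu.locBdd_normD hH 2)
  rwa [hu.ip_tderiv h, h.ip_Aop_self, IsS.ip_cubic_self, ← Complex.ofReal_mul, ← Complex.ofReal_add,
    Complex.I_mul_re, Complex.ofReal_im, neg_zero, mul_zero] at this

lemma hasDerivAt_energy (hu : Sol σ u) (hH : ∀ k, LocBdd (normA u k) t) :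
    HasDerivAt (fun s => energy σ (u s)) 0 t := by
  have h := hu.reg.sch t
  have h1 : IsS (tderiv u t) := (hu.reg_self 1).sch t
  have hN := h.mul (h.mul h.conj)
  have d1 := hu.hasDerivAt_ip_re Gen.base.Aop Gen.base (hu.locBdd_Aop hH 0)
    (hu.locBdd_normD hH 2)
  have d2 := hu.hasDerivAt_L2norm_sq (Gen.base.mul Gen.base) (hu.locBdd_sq hH)
  have e1 : (fun s => (ip (Aop (u s)) (u s)).re) = fun s => gradN (u s) + posN (u s) := by
    ext s
    rw [(hu.reg.sch s).ip_Aop_self, Complex.ofReal_re]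
  have e2 : ip (tderiv (fun t x => u t x * u t x) t) (fun x => u t x * u t x) =
      2 * ip (tderiv u t) (fun x => u t x * (u t x * (starRingEnd ℂ) (u t x))) := by
    rw [tderiv_mul hu.reg.js hu.reg.js, ← ip_const_left, ip, ip]
    congr 1 with x
    simp only [map_mul, Complex.conj_conj]
    ring
  rw [e1, tderiv_Aop hu.reg.js, Complex.add_re, h1.ip_Aop h, re_ip_comm (tderiv u t)] at d1
  rw [e2] at d2
  suffices e : 0 = (ip (tderiv u t) (Aop (u t))).re + (ip (tderiv u t) (Aop (u t))).re +
      σ / 2 * (2 * (2 * ip (tderiv u t)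
        (fun x => u t x * (u t x * (starRingEnd ℂ) (u t x)))).re) by
    rw [e]
    exact d1.add (d2.const_mul (σ / 2))
  rw [hu.ip_tderiv h.Aop, hu.ip_tderiv hN, ip_self, ip_self]
  have := im_ip_comm (Aop (u t)) (fun x => u t x * (u t x * (starRingEnd ℂ) (u t x)))
  generalize ip (Aop (u t)) (fun x => u t x * (u t x * (starRingEnd ℂ) (u t x))) = w at *
  simp only [Complex.mul_re, Complex.add_im, Complex.add_re, Complex.I_re, Complex.I_im,
    Complex.mul_im, Complex.ofReal_re, Complex.ofReal_im, this, Complex.re_ofNat, Complex.im_ofNat]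
  ring

lemma hasDerivAt_posN (hu : Sol σ u) (hH : ∀ k, LocBdd (normA u k) t) :
    HasDerivAt (fun s => posN (u s)) (-4 * virial (u t)) t := by
  have h1 : IsS (tderiv u t) := (hu.reg_self 1).sch t
  have d : ∀ i : Fin 2, HasDerivAt (fun s => L2norm (fun x => ((x i : ℝ) : ℂ) * u s x) ^ 2)
      (-4 * (ip (pd i (u t)) (fun x => ((x i : ℝ) : ℂ) * u t x)).im) t := fun i => by
    have := hu.hasDerivAt_L2norm_sq (Gen.base.coord_mul i) (hu.locBdd_coord hH i)
    rw [tderiv_coord_mul i hu.reg.js, ip_coord i (tderiv u t), hu.re_ip_tderiv_coord] at this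
    suffices e : -4 * (ip (pd i (u t)) (fun x => ((x i : ℝ) : ℂ) * u t x)).im =
        2 * -(2 * (ip (pd i (u t)) (fun x => ((x i : ℝ) : ℂ) * u t x)).im) by rw [e]; exact this
    ring
  have := (d 0).add (d 1)
  simp only [virial, posN, Fin.sum_univ_two, mul_add]
  exact this

lemma hasDerivAt_virial (hu : Sol σ u) (hH : ∀ k, LocBdd (normA u k) t) :
    HasDerivAt (fun s => virial (u s)) (4 * posN (u t) - 2 * energy σ (u t)) t := by
  have h := hu.reg.sch t
  have h1 : IsS (tderiv u t) := (hu.reg_self 1).sch t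
  have d : ∀ i : Fin 2, HasDerivAt
      (fun s => (ip (pd i (u s)) (fun x => ((x i : ℝ) : ℂ) * u s x)).im)
      (-(ip (tderiv u t) (u t)).im -
        2 * (ip (tderiv u t) (fun x => ((x i : ℝ) : ℂ) * pd i (u t) x)).im) t := fun i => by
    have := hu.hasDerivAt_ip_im (Gen.base.pd i) (Gen.base.coord_mul i) (hu.locBdd_pd hH i)
      (hu.locBdd_coord hH i)
    suffices e : -(ip (tderiv u t) (u t)).im -
        2 * (ip (tderiv u t) (fun x => ((x i : ℝ) : ℂ) * pd i (u t) x)).im =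
        (ip (tderiv (fun t => pd i (u t)) t) (fun x => ((x i : ℝ) : ℂ) * u t x) +
          ip (pd i (u t)) (tderiv (fun t x => ((x i : ℝ) : ℂ) * u t x) t)).im by
      rw [e]; exact this
    have e : pd i (fun x => ((x i : ℝ) : ℂ) * u t x) =
        fun x => u t x + ((x i : ℝ) : ℂ) * pd i (u t) x := funext fun x => by
      rw [h.pd_coord_mul]; simp
    rw [tderiv_pd i hu.reg.js, tderiv_coord_mul i hu.reg.js, h1.ip_pd i (h.coord_mul i), e,
      h1.ip_add_right h ((h.pd i).coord_mul i), ← ip_coord i (pd i (u t)),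
      Complex.add_im, Complex.neg_im, Complex.add_im, im_ip_comm (tderiv u t)]
    ring
  have := (d 0).add (d 1)
  have e1 : (ip (tderiv u t) (u t)).im =
      gradN (u t) + posN (u t) + σ * L2norm (fun x => u t x * u t x) ^ 2 := by
    rw [hu.ip_tderiv h, h.ip_Aop_self, IsS.ip_cubic_self, ← Complex.ofReal_mul,
      ← Complex.ofReal_add, Complex.I_mul_im, Complex.ofReal_re]
  have e2 : (ip (tderiv u t) (fun x => ((x 0 : ℝ) : ℂ) * pd 0 (u t) x)).im +
      (ip (tderiv u t) (fun x => ((x 1 : ℝ) : ℂ) * pd 1 (u t) x)).im =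
      -2 * posN (u t) - σ / 2 * L2norm (fun x => u t x * u t x) ^ 2 := by
    rw [← Complex.add_im, ← h1.ip_add_right ((h.pd 0).coord_mul 0) ((h.pd 1).coord_mul 1),
      ← eul_def, hu.ip_tderiv h.eul, Complex.I_mul_im, Complex.add_re, h.re_ip_Aop_eul,
      Complex.re_ofReal_mul, h.re_ip_cubic_eul]
    ring
  simp only [virial, Fin.sum_univ_two]
  suffices e : 4 * posN (u t) - 2 * energy σ (u t) = -(ip (tderiv u t) (u t)).im -
        2 * (ip (tderiv u t) (fun x => ((x 0 : ℝ) : ℂ) * pd 0 (u t) x)).im +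
        (-(ip (tderiv u t) (u t)).im -
        2 * (ip (tderiv u t) (fun x => ((x 1 : ℝ) : ℂ) * pd 1 (u t) x)).im) by
    rw [e]; exact this
  rw [energy]
  linear_combination 2 * e1 + 2 * e2

end Sol

lemma abs_sub_le_of_hasDerivAt_Ioo {f f' : ℝ → ℝ} {a b C : ℝ}
    (hf : ∀ t ∈ Set.Ioo a b, HasDerivAt f (f' t) t) (hC : ∀ t ∈ Set.Ioo a b, |f' t| ≤ C) :
    ∀ s ∈ Set.Ioo a b, ∀ t ∈ Set.Ioo a b, |f t - f s| ≤ C * |t - s| := fun _ hs _ ht =>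
  (convex_Ioo a b).norm_image_sub_le_of_norm_hasDerivWithin_le
    (fun x hx => (hf x hx).hasDerivWithinAt) hC hs ht

lemma eq_of_hasDerivAt_zero_Ioo {f : ℝ → ℝ} {a b : ℝ}
    (hf : ∀ t ∈ Set.Ioo a b, HasDerivAt f 0 t) :
    ∀ s ∈ Set.Ioo a b, ∀ t ∈ Set.Ioo a b, f t = f s := fun s hs t ht => by
  have := abs_sub_le_of_hasDerivAt_Ioo (f' := fun _ => 0) (C := 0) hf (by simp) s hs t ht
  rw [zero_mul, abs_nonpos_iff] at this
  linarith

lemma abs_le_of_hasDerivAt_Ioo {f f' : ℝ → ℝ} {a b C : ℝ}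
    (hf : ∀ t ∈ Set.Ioo a b, HasDerivAt f (f' t) t) (hC : ∀ t ∈ Set.Ioo a b, |f' t| ≤ C) :
    ∃ B, ∀ t ∈ Set.Ioo a b, |f t| ≤ B := by
  rcases (Set.Ioo a b).eq_empty_or_nonempty with h | ⟨s, hs⟩
  · exact ⟨0, by simp [h]⟩
  refine ⟨|f s| + C * (b - a), fun t ht => ?_⟩
  have h1 := abs_sub_le_of_hasDerivAt_Ioo hf hC s hs t ht
  have hC0 : 0 ≤ C := (abs_nonneg _).trans (hC s hs)
  have h2 : |t - s| ≤ b - a := by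
    rw [abs_le]; constructor <;> linarith [hs.1, hs.2, ht.1, ht.2]
  have h3 : |f t| ≤ |f s| + |f t - f s| := by
    have := abs_add_le (f s) (f t - f s)
    rwa [add_sub_cancel] at this
  linarith [mul_le_mul_of_nonneg_left h2 hC0]

/-- A quantity bounded by a linear term plus a logarithm of itself is bounded by the linear term. -/
lemma le_two_mul_add_of_le_add_log {c : ℝ} (hc : 0 ≤ c) : ∃ D ≥ 0, ∀ a X : ℝ, 0 ≤ a → 0 ≤ X →
    a ≤ X + c * Real.log (2 + a ^ 2) → a ≤ 2 * X + D := by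
  set r := 4 * c + 1
  have hr : 0 < r := by positivity
  refine ⟨2 + 4 * c * |Real.log r|, by positivity, fun a X ha hX h => ?_⟩
  have h1 : Real.log (2 + a ^ 2) ≤ 2 * Real.log (2 + a) := by
    rw [← Real.log_rpow (by positivity)]
    refine Real.log_le_log (by positivity) ?_
    norm_cast
    nlinarith
  have h2 : Real.log (2 + a) ≤ (2 + a) / r - 1 + Real.log r := by
    have := Real.log_le_sub_one_of_pos (x := (2 + a) / r) (by positivity)
    rw [Real.log_div (by positivity) hr.ne'] at this
    linarith
  have h3 : 2 * c * ((2 + a) / r) ≤ (2 + a) / 2 := by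
    rw [mul_div_assoc', div_le_div_iff₀ hr two_pos]
    have : 4 * c ≤ r := by simp [r]
    nlinarith
  have h4 := mul_le_mul_of_nonneg_left h1 hc
  have h5 := mul_le_mul_of_nonneg_left h2 (mul_nonneg zero_le_two hc)
  have h6 := mul_le_mul_of_nonneg_left (le_abs_self (Real.log r)) (mul_nonneg zero_le_two hc)
  nlinarith

lemma one_le_log_three_add {p : ℝ} (hp : 0 ≤ p) : 1 ≤ Real.log (3 + p) := by
  rw [Real.le_log_iff_exp_le (by positivity)]
  linarith [Real.exp_one_lt_three]

lemma log_two_add_sq_le (D : ℝ) : ∃ K ≥ 0, ∀ a X : ℝ, 0 ≤ a → 0 ≤ X →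
    a ≤ 2 * X + D → Real.log (2 + a ^ 2) ≤ K * Real.log (3 + X ^ 2) := by
  have hl : 0 ≤ Real.log (8 + 2 * D ^ 2) := Real.log_nonneg (by nlinarith [sq_nonneg D])
  refine ⟨Real.log (8 + 2 * D ^ 2) + 1, by positivity, fun a X ha hX h => ?_⟩
  have h1 := one_le_log_three_add (sq_nonneg X)
  have h2 : Real.log (2 + a ^ 2) ≤ Real.log ((8 + 2 * D ^ 2) * (3 + X ^ 2)) := by
    refine Real.log_le_log (by positivity) ?_
    have : a ^ 2 ≤ (2 * X + D) ^ 2 := pow_le_pow_left₀ ha h 2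
    nlinarith [sq_nonneg (2 * X - D), mul_nonneg (sq_nonneg D) (sq_nonneg X)]
  rw [Real.log_mul (by positivity) (by positivity)] at h2
  nlinarith

/-- A positive function with `|p'| ≤ D p log (3 + p)` stays bounded on bounded intervals. -/
lemma bdd_of_abs_deriv_le_mul_log {p p' : ℝ → ℝ} {a b D : ℝ}
    (hp : ∀ t ∈ Set.Ioo a b, HasDerivAt p (p' t) t) (h0 : ∀ t, 0 ≤ p t) (hD : 0 ≤ D)
    (hb : ∀ t ∈ Set.Ioo a b, |p' t| ≤ D * (Real.log (3 + p t) * p t)) :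
    ∃ B, ∀ t ∈ Set.Ioo a b, p t ≤ B := by
  obtain ⟨B, hB⟩ := abs_le_of_hasDerivAt_Ioo
    (f := fun t => Real.log (Real.log (3 + p t)))
    (f' := fun t => p' t / (3 + p t) / Real.log (3 + p t)) (a := a) (b := b) (C := D)
    (fun t ht => by
      have h1 := one_le_log_three_add (h0 t)
      have h2 := h0 t
      exact (((hp t ht).const_add 3).log (by positivity)).log (by positivity)) fun t ht => by
      have h1 := one_le_log_three_add (h0 t)
      have h2 := h0 t
      have h3 : 0 < 3 + p t := by positivity
      rw [abs_div, abs_div, abs_of_pos h3, abs_of_pos (zero_lt_one.trans_le h1),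
        div_le_iff₀ (by positivity), div_le_iff₀ h3]
      refine (hb t ht).trans ?_
      rw [mul_assoc]
      gcongr
      linarith
  refine ⟨Real.exp (Real.exp B), fun t ht => ?_⟩
  have h1 := one_le_log_three_add (h0 t)
  have h3 : 0 < 3 + p t := by linarith [h0 t]
  have h4 := (le_abs_self _).trans (hB t ht)
  rw [Real.log_le_iff_le_exp (by positivity), Real.log_le_iff_le_exp h3] at h4
  linarith

namespace Sol
variable {σ : ℝ} {u : ℝ → E2 → ℂ} {a b : ℝ}

lemma conservation (hu : Sol σ u) (hH : ∀ t ∈ Set.Ioo a b, ∀ k, LocBdd (normA u k) t) :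
    ∃ M Y E, ∀ t ∈ Set.Ioo a b, L2norm (u t) ^ 2 = M ∧ posN (u t) ≤ Y ∧ energy σ (u t) = E := by
  rcases (Set.Ioo a b).eq_empty_or_nonempty with h | ⟨s, hs⟩
  · exact ⟨0, 0, 0, by simp [h]⟩
  have hM := eq_of_hasDerivAt_zero_Ioo (fun t ht => hu.hasDerivAt_mass (hH t ht)) s hs
  have hE := eq_of_hasDerivAt_zero_Ioo (fun t ht => hu.hasDerivAt_energy (hH t ht)) s hs
  set E := energy σ (u s)
  have hQ := eq_of_hasDerivAt_zero_Ioo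
    (f := fun t => (posN (u t) - E / 2) ^ 2 + virial (u t) ^ 2) (fun t ht => by
      have d1 := ((hu.hasDerivAt_posN (hH t ht)).sub_const (E / 2)).pow 2
      have d2 := (hu.hasDerivAt_virial (hH t ht)).pow 2
      suffices e : 0 = ((2 : ℕ) : ℝ) * (posN (u t) - E / 2) ^ (2 - 1) * (-4 * virial (u t)) +
          ((2 : ℕ) : ℝ) * virial (u t) ^ (2 - 1) * (4 * posN (u t) - 2 * energy σ (u t)) by
        rw [e]; exact d1.add d2
      rw [hE t ht]
      norm_num
      ring) s hs
  set Q := (posN (u s) - E / 2) ^ 2 + virial (u s) ^ 2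
  refine ⟨L2norm (u s) ^ 2, Q + 1 + E / 2, E, fun t ht => ⟨hM t ht, ?_, hE t ht⟩⟩
  have := hQ t ht
  nlinarith [sq_nonneg (virial (u t)), sq_nonneg (posN (u t) - E / 2 - 1)]

lemma bdd_H1 (hu : Sol σ u) (hH : ∀ t ∈ Set.Ioo a b, ∀ k, LocBdd (normA u k) t) :
    ∃ G, ∀ t ∈ Set.Ioo a b, L2norm (u t) ^ 2 + gradN (u t) ≤ G := by
  obtain ⟨M, Y, E, h⟩ := hu.conservation hH
  obtain ⟨S, hS, hq⟩ := quartic_le_small_grad (abs_nonneg M) (abs_nonneg Y)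
    (ε := 1 / (|σ| + 1)) (by positivity)
  obtain ⟨K, hK⟩ := ((isCompact_Icc (a := a) (b := b)).prod hS).exists_bound_of_continuousOn
    hu.reg.js.continuous.continuousOn
  obtain ⟨C, hC, hq⟩ := hq K
  refine ⟨M + 2 * (|E| + |σ| / 2 * C), fun t ht => ?_⟩
  obtain ⟨h1, h2, h3⟩ := h t ht
  have h4 := hq (u t) (hu.reg.sch t) (h1.le.trans (le_abs_self _)) (h2.trans (le_abs_self _))
    fun x hx => hK (t, x) ⟨⟨ht.1.le, ht.2.le⟩, hx⟩
  rw [energy] at h3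
  set q := L2norm (fun x => u t x * u t x) ^ 2
  have hq0 : 0 ≤ q := by positivity
  have hg0 := gradN_nonneg (u t)
  have hp0 := posN_nonneg (u t)
  have h5 : -(σ / 2 * q) ≤ |σ| / 2 * q := by nlinarith [neg_abs_le σ]
  have h6 := mul_le_mul_of_nonneg_left h4 (show 0 ≤ |σ| / 2 by positivity)
  have h7 : |σ| / 2 * (1 / (|σ| + 1) * gradN (u t)) ≤ gradN (u t) / 2 := by
    have : |σ| * (1 / (|σ| + 1)) ≤ 1 := by
      rw [mul_one_div, div_le_one (by positivity)]; linarith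
    nlinarith
  linarith [le_abs_self E]

lemma norm_tderiv_cubic_le (hu : Sol σ u) (t : ℝ) (x : E2) :
    ‖tderiv (cubic u) t x‖ ≤ 3 * ‖u t x‖ ^ 2 * ‖tderiv u t x‖ := by
  have h := hu.reg.js
  rw [cubic_eq, tderiv_mul h (h.mul h.conj), tderiv_mul h h.conj, tderiv_conj h]
  refine (norm_add_le _ _).trans ?_
  rw [norm_mul (u t x)]
  refine (add_le_add le_rfl (mul_le_mul_of_nonneg_left (norm_add_le _ _) (norm_nonneg _))).trans ?_
  simp only [norm_mul, RCLike.norm_conj]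
  apply le_of_eq
  ring

/-- The `A`-norm of the solution stays bounded on a bounded interval on which it is locally
bounded. -/
lemma bdd_of_gap (hu : Sol σ u) (hH : ∀ t ∈ Set.Ioo a b, ∀ k, LocBdd (normA u k) t) :
    ∃ C, ∀ t ∈ Set.Ioo a b, normA u 0 t ≤ C := by
  obtain ⟨G, hG⟩ := hu.bdd_H1 hH
  obtain ⟨C₀, hC₀, hsup⟩ := sup_sq_le_log
  have hm : ∀ t ∈ Set.Ioo a b, L2norm (u t) ≤ |G| + 1 := fun t ht => by
    have := hG t ht
    have := gradN_nonneg (u t)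
    nlinarith [le_abs_self G, sq_nonneg (L2norm (u t) - 1), L2norm_nonneg (u t)]
  set c := C₀ * (1 + |G|)
  have hc : 0 ≤ c := by positivity
  have hS : ∀ t ∈ Set.Ioo a b, ∀ x, ‖u t x‖ ^ 2 ≤ c * Real.log (2 + normA u 0 t ^ 2) :=
    fun t ht => hsup (u t) (hu.reg.sch t) |G| ((hG t ht).trans (le_abs_self G))
  have hl : ∀ t, 0 ≤ Real.log (2 + normA u 0 t ^ 2) := fun t =>
    Real.log_nonneg (by nlinarith [sq_nonneg (normA u 0 t)])
  obtain ⟨D, hD, hDa⟩ := le_two_mul_add_of_le_add_log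
    (c := |σ| * (c * (|G| + 1))) (by positivity)
  have hA : ∀ t ∈ Set.Ioo a b, normA u 0 t ≤ 2 * normD u 1 t + D := fun t ht => by
    refine hDa _ _ (normA_nonneg _ _ _) (normD_nonneg _ _ _) ((hu.normA_le 0 t).trans ?_)
    have h1 : L2norm (cubic u t) ≤ c * Real.log (2 + normA u 0 t ^ 2) * L2norm (u t) := by
      have := L2norm_mul_le (f := fun x => (‖u t x‖ : ℂ) ^ 2) ((hu.reg.sch t).memLp 2)
        (C := c * Real.log (2 + normA u 0 t ^ 2)) fun x => by
        rw [norm_pow, Complex.norm_real, norm_norm]; exact hS t ht x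
      have e : cubic u t = fun x => (‖u t x‖ : ℂ) ^ 2 * u t x := funext fun x => mul_comm _ _
      rwa [e]
    have h2 := mul_le_mul_of_nonneg_left (hm t ht) (mul_nonneg hc (hl t))
    have h3 := mul_le_mul_of_nonneg_left (h1.trans h2) (abs_nonneg σ)
    simp only [zero_add, Function.iterate_zero, id_eq]
    linarith
  obtain ⟨K, hK, hKa⟩ := log_two_add_sq_le D
  have h1 : Gen u (tderiv u) := hu.gen_iter Gen.base 1
  obtain ⟨B, hB⟩ := bdd_of_abs_deriv_le_mul_log (p := fun t => L2norm (tderiv u t) ^ 2)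
    (D := 6 * |σ| * (c * K)) (fun t ht => hu.hasDerivAt_L2norm_sq h1
      (hu.locBdd_normD (hH t ht) 3)) (fun t => by positivity) (by positivity) fun t ht => by
    have r1 := (h1.reg hu.reg).sch t
    have rN : IsS (tderiv (cubic u) t) := (hu.reg_cubic 1).sch t
    have e : tderiv (tderiv u) t = fun x => I * (Aop (tderiv u t) x + σ * tderiv (cubic u) t x) :=
      funext fun x => hu.eqn_iter 1 t x
    have e2 : (ip (tderiv (tderiv u) t) (tderiv u t)).re =
        -(σ * (ip (tderiv (cubic u) t) (tderiv u t)).im) := by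
      rw [e, ip_const_left I (fun x => Aop (tderiv u t) x + σ * tderiv (cubic u) t x),
        r1.Aop.ip_add_left (rN.const_mul σ) r1, ip_const_left (σ : ℂ), r1.ip_Aop_self,
        Complex.I_mul_re, Complex.add_im, Complex.ofReal_im, Complex.im_ofReal_mul, zero_add]
    have hN : L2norm (tderiv (cubic u) t) ≤
        3 * (c * (K * Real.log (3 + L2norm (tderiv u t) ^ 2))) * L2norm (tderiv u t) := by
      have hx := hKa _ _ (normA_nonneg u 0 t) (normD_nonneg u 1 t) (hA t ht)
      have := one_le_log_three_add (sq_nonneg (L2norm (tderiv u t)))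
      have hn : 0 ≤ 3 * (c * (K * Real.log (3 + L2norm (tderiv u t) ^ 2))) := by positivity
      have := L2norm_mono (g := fun x =>
        ((3 * (c * (K * Real.log (3 + L2norm (tderiv u t) ^ 2))) : ℝ) : ℂ) * tderiv u t x)
        ((r1.memLp 2).const_mul _) (f := tderiv (cubic u) t) fun x => by
        rw [norm_mul, Complex.norm_real, Real.norm_of_nonneg hn]
        refine (hu.norm_tderiv_cubic_le t x).trans ?_
        gcongr
        exact (hS t ht x).trans (mul_le_mul_of_nonneg_left hx hc)
      rwa [L2norm_const_mul, Complex.norm_real, Real.norm_of_nonneg hn] at this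
    have h2 := (Complex.abs_im_le_norm _).trans (norm_ip_le rN r1)
    have h3 := mul_le_mul_of_nonneg_right hN (L2norm_nonneg (tderiv u t))
    rw [e2, abs_mul, abs_neg, abs_mul, abs_two]
    have h4 := mul_le_mul_of_nonneg_left (h2.trans h3) (abs_nonneg σ)
    linarith
  refine ⟨2 * (B + 1) + D, fun t ht => (hA t ht).trans ?_⟩
  have h2 : normD u 1 t ^ 2 ≤ B := hB t ht
  nlinarith [sq_nonneg (normD u 1 t - 1), normD_nonneg u 1 t]

end Sol

/-- A function whose increments are controlled by its size stays controlled for a short time. -/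
lemma le_add_one_of_lipschitz {ψ P : ℝ → ℝ} {a b m R : ℝ} (hP : ∀ r, 0 ≤ P r)
    (hψ : ∀ r s t, a ≤ s → s ≤ t → t ≤ b → (∀ x ∈ Set.Icc s t, ψ x ≤ r) →
      |ψ t - ψ s| ≤ P r * (t - s))
    (hR : ∀ t ∈ Set.Icc a b, ψ t ≤ R) (ha : ψ a ≤ m) (hδ : P (m + 1) * (b - a) ≤ 1 / 2) :
    ∀ t ∈ Set.Icc a b, ψ t ≤ m + 1 := by
  have hPR := hP R
  set h := 1 / (2 * (P R + 1)) with hh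
  have h0 : 0 < h := by positivity
  have hPh : P R * h ≤ 1 / 2 := by
    rw [hh, mul_one_div, div_le_div_iff₀ (by positivity) two_pos]
    linarith
  have key : ∀ n : ℕ, ∀ t ∈ Set.Icc a b, t ≤ a + n * h → ψ t ≤ m + 1 / 2 := by
    intro n
    induction n with
    | zero =>
      intro t ht htn
      simp only [Nat.cast_zero, zero_mul, add_zero] at htn
      rw [le_antisymm htn ht.1]
      linarith
    | succ n ih =>
      intro t ht htn
      push_cast at htn
      have h1 : ∀ r ∈ Set.Icc a t, ψ r ≤ m + 1 := fun r hr => by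
        have h2 := ih (max a (r - h)) ⟨le_max_left _ _, max_le (ht.1.trans ht.2)
          (by linarith [hr.2, ht.2])⟩ (max_le (by nlinarith [(Nat.cast_nonneg n : (0 : ℝ) ≤ n)])
          (by linarith [hr.2]))
        have h3 := hψ R (max a (r - h)) r (le_max_left _ _) (max_le hr.1 (by linarith))
          (hr.2.trans ht.2) fun x hx => hR x ⟨(le_max_left _ _).trans hx.1,
            hx.2.trans (hr.2.trans ht.2)⟩
        have h4 := mul_le_mul_of_nonneg_left
          (show r - max a (r - h) ≤ h by linarith [le_max_right a (r - h)]) hPR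
        linarith [le_abs_self (ψ r - ψ (max a (r - h)))]
      have h5 := hψ (m + 1) a t le_rfl ht.1 ht.2 h1
      have h6 := mul_le_mul_of_nonneg_left (show t - a ≤ b - a by linarith [ht.2]) (hP (m + 1))
      linarith [le_abs_self (ψ t - ψ a)]
  intro t ht
  obtain ⟨n, hn⟩ := exists_nat_ge ((t - a) / h)
  rw [div_le_iff₀ h0] at hn
  linarith [key n t ht (by linarith)]

lemma le_add_one_of_lipschitz_left {ψ P : ℝ → ℝ} {a b m R : ℝ} (hP : ∀ r, 0 ≤ P r)
    (hψ : ∀ r s t, a ≤ s → s ≤ t → t ≤ b → (∀ x ∈ Set.Icc s t, ψ x ≤ r) →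
      |ψ t - ψ s| ≤ P r * (t - s))
    (hR : ∀ t ∈ Set.Icc a b, ψ t ≤ R) (hb : ψ b ≤ m) (hδ : P (m + 1) * (b - a) ≤ 1 / 2) :
    ∀ t ∈ Set.Icc a b, ψ t ≤ m + 1 := by
  have := le_add_one_of_lipschitz (ψ := fun t => ψ (-t)) (a := -b) (b := -a) (m := m) (R := R) hP
    (fun r s t h1 h2 h3 h4 => by
      have := hψ r (-t) (-s) (by linarith) (by linarith) (by linarith) fun x hx => by
        simpa using h4 (-x) ⟨by linarith [hx.2], by linarith [hx.1]⟩
      rw [abs_sub_comm]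
      exact this.trans_eq (by ring))
    (fun t ht => hR (-t) ⟨by linarith [ht.2], by linarith [ht.1]⟩) (by simpa using hb)
    (le_of_eq_of_le (by ring) hδ)
  intro t ht
  simpa using this (-t) ⟨by linarith [ht.2], by linarith [ht.1]⟩

/-- A quantity equivalent to `‖A u‖` with controlled increments. -/
def ctrl (u : ℝ → E2 → ℂ) (t : ℝ) : ℝ := normD u 1 t + L2norm (cubic u t) + normD u 0 t

namespace Sol
variable {σ : ℝ} {u : ℝ → E2 → ℂ}

lemma normA_le_ctrl (hu : Sol σ u) (t : ℝ) : normA u 0 t ≤ (1 + |σ|) * ctrl u t := by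
  have h1 : normA u 0 t ≤ normD u 1 t + |σ| * L2norm (cubic u t) := hu.normA_le 0 t
  have h2 := normD_nonneg u 1 t
  have h3 := normD_nonneg u 0 t
  have h4 := L2norm_nonneg (cubic u t)
  have h5 : 0 ≤ |σ| * normD u 1 t + (1 + |σ|) * normD u 0 t := by positivity
  rw [ctrl]
  nlinarith

lemma ctrl_le (hu : Sol σ u) : ∃ K ≥ 0, ∀ t, ctrl u t ≤
    2 * normA u 0 t + (|σ| + 1) * (K * (normA u 0 t * normA u 0 t * normA u 0 t)) := by
  obtain ⟨K, hK, h⟩ := L2norm_triple_le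
  refine ⟨K, hK, fun t => ?_⟩
  have hr := hu.reg.sch t
  have h1 : normD u 1 t ≤ normA u 0 t + |σ| * L2norm (cubic u t) := hu.normD_succ_le 0 t
  have h2 : L2norm (cubic u t) ≤ K * (normA u 0 t * normA u 0 t * normD u 0 t) := by
    have := h _ _ _ hr hr hr.conj
    rw [L2norm_conj] at this
    rw [cubic_eq]
    exact this
  have h3 := hu.normD_le 0 t
  have h4 := normD_nonneg u 0 t
  have h5 := normA_nonneg u 0 t
  have h6 : K * (normA u 0 t * normA u 0 t * normD u 0 t) ≤
      K * (normA u 0 t * normA u 0 t * normA u 0 t) := by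
    gcongr
    linarith
  have h7 := mul_le_mul_of_nonneg_left (h2.trans h6) (show 0 ≤ |σ| + 1 by positivity)
  rw [ctrl]
  linarith

lemma L2norm_tderiv_cubic_le (hu : Sol σ u) : ∃ K ≥ 0, ∀ t,
    L2norm (tderiv (cubic u) t) ≤ K * (normA u 0 t * normA u 0 t * normD u 1 t) := by
  obtain ⟨K, hK, h⟩ := L2norm_triple_le
  refine ⟨3 * K, by positivity, fun t => ?_⟩
  have hr := hu.reg.sch t
  have h1 : IsS (tderiv u t) := (hu.reg_self 1).sch t
  have h2 := L2norm_mono (f := tderiv (cubic u) t)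
    (((hr.mul (hr.mul h1)).const_mul 3).memLp 2) fun x => by
      refine (hu.norm_tderiv_cubic_le t x).trans_eq ?_
      simp only [norm_mul, Complex.norm_ofNat]
      ring
  rw [L2norm_const_mul, Complex.norm_ofNat] at h2
  refine h2.trans ?_
  rw [mul_assoc]
  exact mul_le_mul_of_nonneg_left (h _ _ _ hr hr h1) (by norm_num)

lemma ctrl_lipschitz (hu : Sol σ u) : ∃ P : ℝ → ℝ, (∀ r, 0 ≤ P r) ∧ ∀ r s t, s ≤ t →
    (∀ x ∈ Set.Icc s t, ctrl u x ≤ r) → |ctrl u t - ctrl u s| ≤ P r * (t - s) := by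
  obtain ⟨K, hK, hKb⟩ := hu.L2norm_tderiv_cubic_le
  refine ⟨fun r => (|σ| + 1) * (K * (((1 + |σ|) * |r|) * ((1 + |σ|) * |r|) * |r|)) + |r|,
    fun r => by positivity, fun r s t hst h => ?_⟩
  have hD1 : ∀ x ∈ Set.Icc s t, normD u 1 x ≤ |r| := fun x hx => by
    have := (h x hx).trans (le_abs_self r)
    rw [ctrl] at this
    linarith [normD_nonneg u 0 x, L2norm_nonneg (cubic u x)]
  have hA : ∀ x ∈ Set.Icc s t, normA u 0 x ≤ (1 + |σ|) * |r| := fun x hx =>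
    (hu.normA_le_ctrl x).trans
      (mul_le_mul_of_nonneg_left ((h x hx).trans (le_abs_self r)) (by positivity))
  set B := K * (((1 + |σ|) * |r|) * ((1 + |σ|) * |r|) * |r|)
  have hN1 : ∀ x ∈ Set.Icc s t, L2norm (tderiv (cubic u) x) ≤ B := fun x hx => by
    refine (hKb x).trans ?_
    have := hA x hx
    have := hD1 x hx
    have := normA_nonneg u 0 x
    have := normD_nonneg u 1 x
    simp only [B]
    gcongr
  have h1 : |normD u 1 t - normD u 1 s| ≤ |σ| * B * (t - s) :=
    abs_L2norm_sub_le_forced (hu.reg_self 1).js hst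
      (fun x hx => ⟨((hu.reg_self 1).sch x).memLp 2, hD1 x hx⟩)
      fun x hx => ⟨hu.forcing_memLp 1 x, by
        rw [hu.L2norm_forcing]; exact mul_le_mul_of_nonneg_left (hN1 x hx) (abs_nonneg σ)⟩
  have hsub : ∀ {F : ℝ → E2 → ℂ} (hF : Reg F) (hF1 : Reg (tderiv F)) {M : ℝ},
      (∀ x ∈ Set.Icc s t, L2norm (tderiv F x) ≤ M) →
      |L2norm (F t) - L2norm (F s)| ≤ M * (t - s) := fun {F} hF hF1 {M} hM => by
    have e := L2norm_sub_le_of_tderiv hF.js hst fun x hx => ⟨(hF1.sch x).memLp 2, hM x hx⟩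
    have m1 := (hF.sch t).memLp 2
    have m2 := (hF.sch s).memLp 2
    have e1 : L2norm (fun x => F t x - F s x + F s x) ≤ _ := L2norm_add_le (((hF.sch t).sub (hF.sch s)).memLp 2) m2
    have e2 := L2norm_sub_le m1 (((hF.sch t).sub (hF.sch s)).memLp 2)
    simp only [sub_add_cancel] at e1
    simp only [sub_sub_cancel] at e2
    rw [abs_le]
    constructor <;> linarith
  have h2 := hsub (hu.reg_cubic 0) (hu.reg_cubic 1) hN1
  have h3 : |normD u 0 t - normD u 0 s| ≤ |r| * (t - s) := hsub hu.reg (hu.reg_self 1) hD1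
  have h4 : |ctrl u t - ctrl u s| ≤ |normD u 1 t - normD u 1 s| +
      |L2norm (cubic u t) - L2norm (cubic u s)| + |normD u 0 t - normD u 0 s| := by
    refine le_of_eq_of_le ?_ (abs_add_three _ _ _)
    congr 1
    simp only [ctrl]
    ring
  refine h4.trans ((add_le_add (add_le_add h1 h2) h3).trans_eq ?_)
  ring

/-- Every Sobolev-type norm of the solution is locally bounded in time. -/
theorem locBdd_normA (hu : Sol σ u) : ∀ k t, LocBdd (normA u k) t := by
  obtain ⟨K, hK, hKc⟩ := hu.ctrl_le
  obtain ⟨P, hP, hPc⟩ := hu.ctrl_lipschitz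
  have hbd : ∀ {a b : ℝ}, (∀ t ∈ Set.Ioo a b, LocBdd (normA u 0) t) →
      ∃ R, ∀ t ∈ Set.Icc a b, ctrl u t ≤ R := fun {a b} h => by
    obtain ⟨C, hC⟩ := hu.bdd_of_gap (fun t ht k => hu.locBdd_levels h k t ht)
    refine ⟨max (2 * C + (|σ| + 1) * (K * (C * C * C))) (max (ctrl u a) (ctrl u b)),
      fun t ht => ?_⟩
    rcases eq_or_lt_of_le ht.1 with rfl | h1
    · exact (le_max_left _ _).trans (le_max_right _ _)
    rcases eq_or_lt_of_le ht.2 with rfl | h2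
    · exact (le_max_right _ _).trans (le_max_right _ _)
    refine ((hKc t).trans ?_).trans (le_max_left _ _)
    have h3 := hC t ⟨h1, h2⟩
    have h4 := normA_nonneg u 0 t
    have h5 : 0 ≤ C := h4.trans h3
    gcongr
  have hm : ∀ {N t : ℝ}, normA u 0 t ≤ N →
      ctrl u t ≤ 2 * N + (|σ| + 1) * (K * (N * N * N)) := fun {N t} h => by
    have h4 := normA_nonneg u 0 t
    have h5 := h4.trans h
    refine (hKc t).trans ?_
    gcongr
  have hδ : ∀ {p d : ℝ}, 0 ≤ p → d ≤ 1 / (2 * (p + 1)) → p * d ≤ 1 / 2 := fun {p d} hp hd => by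
    refine (mul_le_mul_of_nonneg_left hd hp).trans ?_
    rw [mul_one_div, div_le_div_iff₀ (by positivity) two_pos]
    linarith
  have h0 : ∀ t ∈ Set.univ, LocBdd (normA u 0) t := by
    refine locBdd_of_gap isOpen_univ (fun N t _ h => ?_) (fun N => ?_) fun N => ?_
    · exact L2norm_le_of_frequently (Gen.base.Aop.reg hu.reg).js
        (fun t => ((hu.reg.sch t).Aop).memLp 2) h
    · set m := 2 * N + (|σ| + 1) * (K * (N * N * N))
      refine ⟨1 / (2 * (P (m + 1) + 1)), by have := hP (m + 1); positivity,
        (1 + |σ|) * (m + 1), fun a b hab hb _ hN h t ht => ?_⟩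
      obtain ⟨R, hR⟩ := hbd h
      have := le_add_one_of_lipschitz hP (fun r s t _ hst _ => hPc r s t hst) hR (hm hN)
        (hδ (hP _) (by linarith)) t ⟨ht.1.le, ht.2.le⟩
      exact (hu.normA_le_ctrl t).trans (mul_le_mul_of_nonneg_left this (by positivity))
    · set m := 2 * N + (|σ| + 1) * (K * (N * N * N))
      refine ⟨1 / (2 * (P (m + 1) + 1)), by have := hP (m + 1); positivity,
        (1 + |σ|) * (m + 1), fun a b hab hb _ hN h t ht => ?_⟩
      obtain ⟨R, hR⟩ := hbd h
      have := le_add_one_of_lipschitz_left hP (fun r s t _ hst _ => hPc r s t hst) hR (hm hN)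
        (hδ (hP _) (by linarith)) t ⟨ht.1.le, ht.2.le⟩
      exact (hu.normA_le_ctrl t).trans (mul_le_mul_of_nonneg_left this (by positivity))
  exact fun k t => hu.locBdd_levels h0 k t trivial

/-- The modified energy identity. -/
theorem hasDerivAt_normA_sq (hu : Sol σ u) (k : ℕ) (t : ℝ) :
    HasDerivAt (fun s => L2norm (Aop (tderiv^[k] u s)) ^ 2)
      (2 * (-σ * (ip (Aop (tderiv^[k + 1] u t)) (tderiv^[k] (cubic u) t)).re)) t := by
  have h := hu.hasDerivAt_L2norm_sq (hu.gen_iter Gen.base k).Aop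
    (hu.locBdd_Aop (fun k => hu.locBdd_normA k t) k)
  have h1 := (hu.reg_self (k + 1)).sch t
  have hN := (hu.reg_cubic k).sch t
  rw [tderiv_Aop (hu.reg_self k).js, ← Function.iterate_succ_apply' tderiv k u] at h
  have e : Aop (tderiv^[k] u t) = fun x =>
      -I * tderiv^[k + 1] u t x + (-σ : ℂ) * tderiv^[k] (cubic u) t x := funext fun x => by
    rw [hu.eqn_iter]
    linear_combination (Aop (tderiv^[k] u t) x + σ * tderiv^[k] (cubic u) t x) * I_mul_I
  suffices e2 : -σ * (ip (Aop (tderiv^[k + 1] u t)) (tderiv^[k] (cubic u) t)).re =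
      (ip (Aop (tderiv^[k + 1] u t)) (Aop (tderiv^[k] u t))).re by rw [e2]; exact h
  rw [e, h1.Aop.ip_add_right (h1.const_mul _) (hN.const_mul _), ip_const_right, ip_const_right,
    h1.ip_Aop_self]
  simp

end Sol

lemma ip_Aop_eq {f g : E2 → ℂ} (hf : IsS f) (hg : IsS g) : ip (Aop f) g =
    (∑ i, ip (pd i f) (pd i g)) + ip f (fun x => (‖x‖ : ℂ) ^ 2 * g x) := by
  have e : (fun x : E2 => (‖x‖ : ℂ) ^ 2 * g x) = fun x =>
      ((x 0 : ℝ) : ℂ) * (((x 0 : ℝ) : ℂ) * g x) + ((x 1 : ℝ) : ℂ) * (((x 1 : ℝ) : ℂ) * g x) := by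
    ext x
    rw [normSq_eq_coord]
    ring
  have h : ip (Aop f) g = ∑ i, (ip (pd i f) (pd i g) +
      ip (fun x => ((x i : ℝ) : ℂ) * f x) (fun x => ((x i : ℝ) : ℂ) * g x)) := hf.integral_Aop hg
  rw [h, e, hf.ip_add_right ((hg.coord_mul 0).coord_mul 0) ((hg.coord_mul 1).coord_mul 1),
    Finset.sum_add_distrib, Fin.sum_univ_two (fun i : Fin 2 =>
      ip (fun x => ((x i : ℝ) : ℂ) * f x) (fun x => ((x i : ℝ) : ℂ) * g x)),
    ip_coord 0 f, ip_coord 1 f]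

/-- The energy identity
`½ d/dt ‖A ∂ₜᵏ u(t)‖²_{L²} = -σ ( Σᵢ Re ∫ ∂ₜᵏ∂_{xᵢ}(u|u|²) ∂ₜ^{k+1}∂_{xᵢ}conj(u)
  + Re ∫ |x|² ∂ₜᵏ(u|u|²) ∂ₜ^{k+1}conj(u) )`. -/
theorem energy_derivative_identity (σ : ℝ) (hσ : σ = 1 ∨ σ = -1) (k : ℕ)
    (u : ℝ → SchwartzMap E2 ℂ) (hu : IsSolution σ u) (t : ℝ) :
    deriv (fun τ => (1/2) * ∫ x : E2,
        ‖Aop (tderiv^[k] (fun s y => u s y) τ) x‖^2) t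
      = -σ * ((∑ i : Fin 2, (∫ x : E2,
            tderiv^[k] (fun s => pd i (fun y => u s y * (‖u s y‖ : ℂ)^2)) t x
              * tderiv^[k+1] (fun s => pd i (fun y => (starRingEnd ℂ) (u s y))) t x).re)
          + (∫ x : E2, (‖x‖ : ℂ)^2 * tderiv^[k] (fun s y => u s y * (‖u s y‖ : ℂ)^2) t x
              * tderiv^[k+1] (fun s y => (starRingEnd ℂ) (u s y)) t x).re) := by
  have hs := hu.sol
  set v : ℝ → E2 → ℂ := fun s y => u s y
  have h1 := (hs.reg_self (k + 1)).sch t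
  have hN := (hs.reg_cubic k).sch t
  have hd := (hs.hasDerivAt_normA_sq k t).const_mul (1 / 2)
  simp only [L2norm_sq] at hd
  have e1 : ∀ i : Fin 2, ∫ x : E2,
      tderiv^[k] (fun s => pd i (fun y => u s y * (‖u s y‖ : ℂ)^2)) t x
        * tderiv^[k+1] (fun s => pd i (fun y => (starRingEnd ℂ) (u s y))) t x =
      ip (pd i (tderiv^[k] (cubic v) t)) (pd i (tderiv^[k + 1] v t)) := fun i => by
    have a1 := hs.iter_pd (gen_cubic v) i k
    have a2 := hs.iter_pd (Gen.base (u := v)).conj i (k + 1)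
    rw [hs.iter_conj Gen.base] at a2
    change ∫ x : E2, tderiv^[k] (fun s => pd i (cubic v s)) t x *
      tderiv^[k + 1] (fun s => pd i (fun y => (starRingEnd ℂ) (v s y))) t x = _
    rw [a1, a2, ip]
    congr 1 with x
    beta_reduce
    rw [pd_conj i h1.differentiable]
  have e2 : ∫ x : E2, (‖x‖ : ℂ)^2 * tderiv^[k] (fun s y => u s y * (‖u s y‖ : ℂ)^2) t x
      * tderiv^[k+1] (fun s y => (starRingEnd ℂ) (u s y)) t x =
      ip (fun x => (‖x‖ : ℂ) ^ 2 * tderiv^[k] (cubic v) t x) (tderiv^[k + 1] v t) := by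
    have a2 := hs.iter_conj (Gen.base (u := v)) (k + 1)
    change ∫ x : E2, (‖x‖ : ℂ)^2 * tderiv^[k] (cubic v) t x *
      tderiv^[k + 1] (fun s y => (starRingEnd ℂ) (v s y)) t x = _
    rw [a2, ip]
  simp only [e1, e2]
  rw [hd.deriv, ip_Aop_eq h1 hN, Complex.add_re, Complex.re_sum, re_ip_comm (tderiv^[k + 1] v t),
    Finset.sum_congr rfl fun i _ => re_ip_comm (pd i (tderiv^[k + 1] v t)) _]
  ring
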